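/- arXiv:2407.15521 — 2 statements merged into one kernel-verified Lean document; each statement's English description precedes it below -/
import Mathlib

section
/- Assume (H), let 1 ≤ p ≤ ∞ with Hölder conjugate p', and assume m > 2d/p'. Adopt the notation of the context (window g, norm ‖·‖_{W^{1,∞}}, kernel E). Let ν be a finite complex Borel measure on ℝ^d whose Gabor transform V_g ν(x,ξ) := ∫_{ℝ^d} e^{-2πi ξ·y} conj(g(y−x)) dν(y) satisfies ∫_{ℝ^d} ( ∫_{ℝ^d} |V_g ν(x,ξ)|^p dξ )^{1/p} dx < ∞ (essential supremum in ξ when p = ∞); that is, ν ∈ W^{p,1}(ℝ^d). Then for every h ∈ L¹(ℝ^d), setting f(x) := ∫_{ℝ^d} e^{2πi x·ξ} h(ξ) dξ, there exists a unique family (u(t,·))_{t∈[0,∞)} of bounded continuous functions on ℝ^d with ‖u(t,·)‖_{W^{1,∞}} < ∞ for all t, such that t ↦ u(t,·) is continuous with respect to ‖·‖_{W^{1,∞}}, u(0,·) = f, and for every t > 0 and x ∈ ℝ^d, u(t,x) = ∫_{ℝ^d} e^{2πi(x·ξ + tμ(ξ))} h(ξ) dξ + 2πi ∫₀^t ( ∫_{ℝ^d}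 E(t−s, x−y) u(s,y) dν(y) ) ds, where for each s ∈ (0,t) the inner integral converges absolutely and s ↦ ∫ E(t−s,x−y)u(s,y) dν(y) is absolutely integrable on (0,t). -/
open MeasureTheory Real Complex
open scoped ENNReal RealInnerProductSpace

noncomputable section

/-- The Gabor (short-time Fourier) transform `V_g v(x,ξ)` of a function `v` with respect to a
Schwartz window `g`. -/
def gaborT (d : ℕ) (g : SchwartzMap (EuclideanSpace ℝ (Fin d)) ℂ)
    (v : EuclideanSpace ℝ (Fin d) → ℂ) (x ξ : EuclideanSpace ℝ (Fin d)) : ℂ :=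
  ∫ (y : EuclideanSpace ℝ (Fin d)),
    Complex.exp (-(((2 * Real.pi * ⟪ξ, y⟫ : ℝ) : ℂ) * Complex.I)) * v y *
      (starRingEnd ℂ) (g (y - x))

/-- The Wiener amalgam `W^{1,∞}` norm `sup_x ∫ |V_g v(x,ξ)| dξ` (valued in `ℝ≥0∞`). -/
def wOneInfNorm (d : ℕ) (g : SchwartzMap (EuclideanSpace ℝ (Fin d)) ℂ)
    (v : EuclideanSpace ℝ (Fin d) → ℂ) : ℝ≥0∞ :=
  ⨆ x : EuclideanSpace ℝ (Fin d),
    ∫⁻ ξ : EuclideanSpace ℝ (Fin d), (‖gaborT d g v x ξ‖₊ : ℝ≥0∞) ∂volume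

/-- The Gabor transform `V_g ν(x,ξ)` of the complex measure `ν = w dρ` with respect to the
window `g`. -/
def gaborMeas (d : ℕ) (g : SchwartzMap (EuclideanSpace ℝ (Fin d)) ℂ)
    (ρ : Measure (EuclideanSpace ℝ (Fin d))) (w : EuclideanSpace ℝ (Fin d) → ℂ)
    (x ξ : EuclideanSpace ℝ (Fin d)) : ℂ :=
  ∫ (y : EuclideanSpace ℝ (Fin d)),
    Complex.exp (-(((2 * Real.pi * ⟪ξ, y⟫ : ℝ) : ℂ) * Complex.I)) *
      (starRingEnd ℂ) (g (y - x)) * w y ∂ρ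

/-- `u` is a global-in-time solution on `[0,∞)` of the Duhamel formulation of the linear
problem `(1/2πi)∂_t u = μ(D)u + νu`, `u(0) = f = (h)^∨`, where the finite complex measure `ν`
is represented as `w dρ` with `ρ` a finite positive measure and `w` a bounded density, and
`E(t,·)` is the inverse Fourier transform of `e^{2πitμ}`. -/
def IsGlobalSolution (d : ℕ) (μ : EuclideanSpace ℝ (Fin d) → ℝ)
    (g : SchwartzMap (EuclideanSpace ℝ (Fin d)) ℂ)
    (EE : ℝ → EuclideanSpace ℝ (Fin d) → ℂ)
    (ρ : Measure (EuclideanSpace ℝ (Fin d))) (w : EuclideanSpace ℝ (Fin d) → ℂ)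
    (h : EuclideanSpace ℝ (Fin d) → ℂ)
    (u : ℝ → EuclideanSpace ℝ (Fin d) → ℂ) : Prop :=
  (∀ t ∈ Set.Ici (0 : ℝ),
    Continuous (u t) ∧ (∃ M : ℝ, ∀ x, ‖u t x‖ ≤ M) ∧ wOneInfNorm d g (u t) < ⊤) ∧
  (∀ t ∈ Set.Ici (0 : ℝ), ∀ ε : ℝ, 0 < ε → ∃ δ : ℝ, 0 < δ ∧
    ∀ s ∈ Set.Ici (0 : ℝ), |s - t| < δ →
      wOneInfNorm d g (fun x => u s x - u t x) < ENNReal.ofReal ε) ∧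
  (∀ x, u 0 x =
    ∫ (ξ : EuclideanSpace ℝ (Fin d)),
      Complex.exp (((2 * Real.pi * ⟪x, ξ⟫ : ℝ) : ℂ) * Complex.I) * h ξ) ∧
  (∀ t : ℝ, 0 < t → ∀ x : EuclideanSpace ℝ (Fin d),
    (∀ s ∈ Set.Ioo (0 : ℝ) t,
      Integrable (fun y => EE (t - s) (x - y) * u s y * w y) ρ) ∧
    IntegrableOn (fun s => ∫ y, EE (t - s) (x - y) * u s y * w y ∂ρ)
      (Set.Ioo (0 : ℝ) t) volume ∧
    u t x =
      (∫ (ξ : EuclideanSpace ℝ (Fin d)),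
        Complex.exp (((2 * Real.pi * (⟪x, ξ⟫ + t * μ ξ) : ℝ) : ℂ) * Complex.I) * h ξ) +
      (2 * (Real.pi : ℂ)) * Complex.I *
        ∫ s in Set.Ioo (0 : ℝ) t, ∫ y, EE (t - s) (x - y) * u s y * w y ∂ρ)

set_option linter.unusedSectionVars false

/-! ### Fourier algebra -/
section FourierAlg
open FourierTransform

/-- The standard character. -/
def chr (s : ℝ) : ℂ := Complex.exp (((2 * Real.pi * s : ℝ) : ℂ) * Complex.I)

lemma norm_chr (s : ℝ) : ‖chr s‖ = 1 := by
  unfold chr; exact Complex.norm_exp_ofReal_mul_I _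

lemma enorm_chr (s : ℝ) : ‖chr s‖ₑ = 1 := by
  rw [← ofReal_norm, norm_chr]; simp

lemma chr_add (s t : ℝ) : chr (s + t) = chr s * chr t := by
  unfold chr; rw [← Complex.exp_add]; congr 1; push_cast; ring

lemma chr_zero : chr 0 = 1 := by simp [chr]

lemma contDiff_chr : ContDiff ℝ (⊤ : ℕ∞) chr := by
  unfold chr
  have : ContDiff ℝ (⊤ : ℕ∞) (fun s : ℝ => ((2 * Real.pi * s : ℝ) : ℂ)) :=
    Complex.ofRealCLM.contDiff.comp (contDiff_const.mul contDiff_id)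
  exact Complex.contDiff_exp.comp (this.mul contDiff_const)

@[fun_prop]
lemma continuous_chr : Continuous chr := contDiff_chr.continuous

@[fun_prop]
lemma measurable_chr : Measurable chr := continuous_chr.measurable

variable {V : Type*} [NormedAddCommGroup V] [InnerProductSpace ℝ V] [FiniteDimensional ℝ V]
  [MeasurableSpace V] [BorelSpace V]

/-- Fourier transform of the measure `G dρ`. -/
def ft (ρ : Measure V) (G : V → ℂ) (ζ : V) : ℂ := ∫ y, chr (-⟪y, ζ⟫) * G y ∂ρ

/-- Inverse Fourier transform. -/
def ift (a : V → ℂ) (x : V) : ℂ := ∫ ξ, chr ⟪x, ξ⟫ * a ξ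

/-- The Fourier-Lebesgue norm. -/
def lf (f : V → ℂ) : ℝ≥0∞ := ∫⁻ ξ, ‖ft volume f ξ‖ₑ

lemma ft_eq_fourier (f : V → ℂ) : ft volume f = 𝓕 f := by
  ext w; rw [Real.fourier_eq']; unfold ft chr
  refine integral_congr_ae (Filter.Eventually.of_forall fun y => ?_)
  simp only [smul_eq_mul]; congr 3; push_cast; ring

lemma ift_eq_fourierInv (f : V → ℂ) : ift f = 𝓕⁻ f := by
  ext w; rw [Real.fourierInv_eq']; unfold ift chr
  refine integral_congr_ae (Filter.Eventually.of_forall fun y => ?_)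
  simp only [smul_eq_mul]; rw [real_inner_comm]

lemma integrable_chr_mul {X : Type*} [MeasurableSpace X] {ρ : Measure X} {G : X → ℂ}
    (hG : Integrable G ρ) {φ : X → ℝ}
    (hφ : AEMeasurable φ ρ) : Integrable (fun y => chr (φ y) * G y) ρ := by
  refine hG.bdd_mul (c := 1) ?_ (Filter.Eventually.of_forall fun y => (norm_chr _).le)
  exact (measurable_chr.comp_aemeasurable hφ).aestronglyMeasurable

lemma continuous_ft {ρ : Measure V} {G : V → ℂ} (hG : Integrable G ρ) : Continuous (ft ρ G) := by
  unfold ft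
  refine continuous_of_dominated (bound := fun y => ‖G y‖) ?_ ?_ hG.norm ?_
  · intro x; exact (integrable_chr_mul hG (by fun_prop)).aestronglyMeasurable
  · intro x; exact Filter.Eventually.of_forall fun y => by simp [norm_chr]
  · exact Filter.Eventually.of_forall fun y => by fun_prop

lemma continuous_ift {a : V → ℂ} (ha : Integrable a) : Continuous (ift a) := by
  unfold ift
  refine continuous_of_dominated (bound := fun y => ‖a y‖) ?_ ?_ ha.norm ?_
  · intro x; exact (integrable_chr_mul ha (by fun_prop)).aestronglyMeasurable
  · intro x; exact Filter.Eventually.of_forall fun y => by simp [norm_chr]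
  · exact Filter.Eventually.of_forall fun y => by fun_prop

lemma norm_ft_le {ρ : Measure V} (G : V → ℂ) (ζ : V) : ‖ft ρ G ζ‖ ≤ ∫ y, ‖G y‖ ∂ρ := by
  unfold ft
  refine (norm_integral_le_integral_norm _).trans (le_of_eq ?_)
  simp [norm_chr]

lemma norm_ift_le (a : V → ℂ) (x : V) : ‖ift a x‖ ≤ ∫ y, ‖a y‖ := by
  unfold ift
  refine (norm_integral_le_integral_norm _).trans (le_of_eq ?_)
  simp [norm_chr]

lemma ift_ft {f : V → ℂ} (hc : Continuous f) (hf : Integrable f) (hl : lf f < ⊤) :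
    ift (ft volume f) = f := by
  rw [ift_eq_fourierInv, ft_eq_fourier]
  refine hc.fourierInv_fourier_eq hf ?_
  rw [← ft_eq_fourier]
  exact ⟨(continuous_ft hf).aestronglyMeasurable, hl⟩

lemma integrable_ft_of_lf {f : V → ℂ} (hf : Integrable f) (hl : lf f < ⊤) :
    Integrable (ft volume f) :=
  ⟨(continuous_ft hf).aestronglyMeasurable, hl⟩

/-- Multiplication lemma. -/
lemma ft_mul {ρ : Measure V} [SFinite ρ] {a G : V → ℂ} (ha : Integrable a) (hG : Integrable G ρ)
    (ξ : V) : ft ρ (fun y => ift a y * G y) ξ = ∫ η, a η * ft ρ G (ξ - η) := by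
  unfold ft ift
  have h1 : ∀ y, chr (-⟪y, ξ⟫) * ((∫ η, chr ⟪y, η⟫ * a η) * G y)
      = ∫ η, chr (-⟪y, ξ⟫) * chr ⟪y, η⟫ * (a η * G y) := by
    intro y
    rw [← integral_mul_const, ← integral_const_mul]
    congr 1; ext η; ring
  simp_rw [h1]
  rw [integral_integral_swap]
  · congr 1; ext η
    rw [← integral_const_mul]
    congr 1; ext y
    rw [inner_sub_right, neg_sub, sub_eq_add_neg, chr_add]; ring
  · have := (hG.mul_prod ha)
    have h2 : Integrable (fun p : V × V => chr (-⟪p.1, ξ⟫ + ⟪p.1, p.2⟫) * (G p.1 * a p.2))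
      (ρ.prod volume) := integrable_chr_mul this (by fun_prop)
    refine h2.congr (Filter.Eventually.of_forall fun p => ?_)
    simp only [Function.uncurry, chr_add]; ring

lemma lintegral_conv_le {a H k : V → ℂ} (ha : AEStronglyMeasurable a) (hH : Continuous H)
    (hk : AEStronglyMeasurable k) {B : ℝ≥0∞}
    (hB : ∀ η, ∫⁻ ξ, ‖k ξ‖ₑ * ‖H (ξ - η)‖ₑ ≤ B) :
    ∫⁻ ξ, ‖k ξ‖ₑ * ‖∫ η, a η * H (ξ - η)‖ₑ ≤ (∫⁻ η, ‖a η‖ₑ) * B := by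
  calc ∫⁻ ξ, ‖k ξ‖ₑ * ‖∫ η, a η * H (ξ - η)‖ₑ
      ≤ ∫⁻ ξ, ∫⁻ η, ‖k ξ‖ₑ * (‖a η‖ₑ * ‖H (ξ - η)‖ₑ) := by
        refine lintegral_mono fun ξ => ?_
        rw [lintegral_const_mul' _ _ (by simp)]
        gcongr
        refine (enorm_integral_le_lintegral_enorm _).trans (le_of_eq ?_)
        simp only [enorm_mul]
    _ = ∫⁻ η, ∫⁻ ξ, ‖k ξ‖ₑ * (‖a η‖ₑ * ‖H (ξ - η)‖ₑ) := by
        refine lintegral_lintegral_swap ?_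
        have h1 : AEMeasurable (fun p : V × V => ‖k p.1‖ₑ) (volume.prod volume) :=
          hk.enorm.comp_quasiMeasurePreserving Measure.quasiMeasurePreserving_fst
        have h2 : AEMeasurable (fun p : V × V => ‖a p.2‖ₑ) (volume.prod volume) :=
          ha.enorm.comp_quasiMeasurePreserving Measure.quasiMeasurePreserving_snd
        have h3 : Measurable (fun p : V × V => ‖H (p.1 - p.2)‖ₑ) :=
          (hH.comp (continuous_fst.sub continuous_snd)).enorm.measurable
        exact h1.mul (h2.mul h3.aemeasurable)
    _ = ∫⁻ η, ‖a η‖ₑ * ∫⁻ ξ, ‖k ξ‖ₑ * ‖H (ξ - η)‖ₑ := by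
        refine lintegral_congr fun η => ?_
        rw [← lintegral_const_mul' _ _ (by simp)]
        refine lintegral_congr fun ξ => ?_
        ring
    _ ≤ ∫⁻ η, ‖a η‖ₑ * B := lintegral_mono fun η => by gcongr; exact hB η
    _ = _ := lintegral_mul_const'' _ ha.enorm

lemma lf_ift_mul_le {a G : V → ℂ} (ha : Integrable a) (hG : Integrable G) :
    lf (fun y => ift a y * G y) ≤ (∫⁻ η, ‖a η‖ₑ) * lf G := by
  unfold lf
  simp_rw [ft_mul ha hG]
  have := lintegral_conv_le (a := a) (H := ft volume G) (k := fun _ => 1) (B := lf G)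
    ha.aestronglyMeasurable (continuous_ft hG) aestronglyMeasurable_const (by
      intro η; unfold lf
      simp only [enorm_one, one_mul]
      exact (lintegral_sub_right_eq_self (fun ξ => ‖ft volume G ξ‖ₑ) η).le)
  simpa [lf] using this

lemma lf_mul_le {f G : V → ℂ} (hc : Continuous f) (hf : Integrable f) (hl : lf f < ⊤)
    (hG : Integrable G) : lf (fun y => f y * G y) ≤ lf f * lf G := by
  have := lf_ift_mul_le (integrable_ft_of_lf hf hl) hG
  rw [ift_ft hc hf hl] at this
  exact this

lemma enorm_le_lf {f : V → ℂ} (hc : Continuous f) (hf : Integrable f) (x : V) :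
    ‖f x‖ₑ ≤ lf f := by
  by_cases hl : lf f < ⊤
  · conv_lhs => rw [← ift_ft hc hf hl]
    unfold ift lf
    refine (enorm_integral_le_lintegral_enorm _).trans (le_of_eq ?_)
    simp [enorm_chr]
  · rw [not_lt, top_le_iff] at hl; simp [hl]

lemma lf_translate (f : V → ℂ) (x : V) : lf (fun y => f (y - x)) = lf f := by
  unfold lf
  refine lintegral_congr fun ξ => ?_
  have : ft volume (fun y => f (y - x)) ξ = chr (-⟪x, ξ⟫) * ft volume f ξ := by
    unfold ft
    rw [← integral_const_mul, ← integral_sub_right_eq_self (fun y => chr (-⟪x, ξ⟫) * (chr (-⟪y, ξ⟫) * f y)) x]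
    congr 1; ext y
    beta_reduce
    rw [inner_sub_left, neg_sub, sub_eq_add_neg, ← mul_assoc, ← chr_add]
    congr 2; ring
  rw [this, enorm_mul, enorm_chr, one_mul]

lemma lf_add_le {f h : V → ℂ} (hf : Integrable f) (hh : Integrable h) :
    lf (fun y => f y + h y) ≤ lf f + lf h := by
  unfold lf
  rw [← lintegral_add_left (continuous_ft hf).enorm.measurable]
  refine lintegral_mono fun ξ => ?_
  have : ft volume (fun y => f y + h y) ξ = ft volume f ξ + ft volume h ξ := by
    unfold ft; rw [← integral_add]
    · simp only [mul_add]
    · exact integrable_chr_mul hf (by fun_prop)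
    · exact integrable_chr_mul hh (by fun_prop)
  rw [this]; exact enorm_add_le _ _

lemma lf_const_mul (c : ℂ) (f : V → ℂ) : lf (fun y => c * f y) = ‖c‖ₑ * lf f := by
  unfold lf
  rw [← lintegral_const_mul' _ _ (by simp)]
  refine lintegral_congr fun ξ => ?_
  have : ft volume (fun y => c * f y) ξ = c * ft volume f ξ := by
    unfold ft; rw [← integral_const_mul]; congr 1; ext y; ring
  rw [this, enorm_mul]

/-- Minkowski. -/
lemma lf_integral_le {Z : Type*} [MeasurableSpace Z] {σ : Measure Z} [SFinite σ]
    {Φ : Z → V → ℂ} (hΦ : Integrable (Function.uncurry Φ) (σ.prod volume)) :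
    lf (fun y => ∫ z, Φ z y ∂σ) ≤ ∫⁻ z, lf (Φ z) ∂σ := by
  have h1 : ∀ ξ, ft volume (fun y => ∫ z, Φ z y ∂σ) ξ = ∫ z, ft volume (Φ z) ξ ∂σ := by
    intro ξ
    unfold ft
    rw [integral_integral_swap]
    · congr 1; ext y; rw [integral_const_mul]
    · exact integrable_chr_mul (G := Function.uncurry Φ) hΦ (φ := fun p : Z × V => -⟪p.2, ξ⟫)
        (by fun_prop)
  have h2 : AEMeasurable (Function.uncurry fun (z : Z) (ξ : V) => ‖ft volume (Φ z) ξ‖ₑ)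
      (σ.prod volume) := by
    have h3 : AEStronglyMeasurable (fun p : Z × V => ∫ y, chr (-⟪y, p.2⟫) * Φ p.1 y)
        (σ.prod volume) := by
      refine AEStronglyMeasurable.integral_prod_right' (f := fun q : (Z × V) × V =>
        chr (-⟪q.2, q.1.2⟫) * Φ q.1.1 q.2) ?_
      refine AEStronglyMeasurable.mul ?_ ?_
      · exact Measurable.aestronglyMeasurable (by fun_prop)
      · have h4 : Measure.QuasiMeasurePreserving (fun q : (Z × V) × V => (q.1.1, q.2))
            ((σ.prod volume).prod volume) (σ.prod volume) := by
          have : Measure.QuasiMeasurePreserving (Prod.map (Prod.fst : Z × V → Z) (id : V → V))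
            ((σ.prod volume).prod volume) (σ.prod volume) :=
            MeasureTheory.QuasiMeasurePreserving.prodMap Measure.quasiMeasurePreserving_fst
              (Measure.QuasiMeasurePreserving.id _)
          exact this
        exact hΦ.aestronglyMeasurable.comp_quasiMeasurePreserving h4
    exact h3.enorm
  unfold lf
  simp_rw [h1]
  calc ∫⁻ ξ, ‖∫ z, ft volume (Φ z) ξ ∂σ‖ₑ ≤ ∫⁻ ξ, ∫⁻ z, ‖ft volume (Φ z) ξ‖ₑ ∂σ :=
        lintegral_mono fun ξ => enorm_integral_le_lintegral_enorm _
    _ = _ := (lintegral_lintegral_swap h2).symm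

/-- Schwartz functions have finite norm. -/
lemma lf_schwartz (f : SchwartzMap V ℂ) : lf f < ⊤ := by
  unfold lf
  rw [ft_eq_fourier, ← SchwartzMap.fourier_coe]
  exact (𝓕 f).integrable.2

end FourierAlg

/-! ### Window norms -/
section Windows
open FourierTransform

variable {V : Type*} [NormedAddCommGroup V] [InnerProductSpace ℝ V] [FiniteDimensional ℝ V]
  [MeasurableSpace V] [BorelSpace V]

/-- Bounded continuous functions. -/
def BC (v : V → ℂ) : Prop := Continuous v ∧ ∃ M : ℝ, ∀ x, ‖v x‖ ≤ M

lemma BC.add {u v : V → ℂ} (hu : BC u) (hv : BC v) : BC (fun x => u x + v x) := by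
  obtain ⟨M, hM⟩ := hu.2
  obtain ⟨M', hM'⟩ := hv.2
  exact ⟨hu.1.add hv.1, M + M', fun x => (norm_add_le _ _).trans (add_le_add (hM x) (hM' x))⟩

lemma BC.const_mul {u : V → ℂ} (hu : BC u) (c : ℂ) : BC (fun x => c * u x) := by
  obtain ⟨M, hM⟩ := hu.2
  refine ⟨continuous_const.mul hu.1, ‖c‖ * M, fun x => ?_⟩
  rw [norm_mul]; gcongr; exact hM x

lemma BC.sub {u v : V → ℂ} (hu : BC u) (hv : BC v) : BC (fun x => u x - v x) := by
  obtain ⟨M, hM⟩ := hu.2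
  obtain ⟨M', hM'⟩ := hv.2
  exact ⟨hu.1.sub hv.1, M + M', fun x => (norm_sub_le _ _).trans (add_le_add (hM x) (hM' x))⟩

lemma BC.ift {a : V → ℂ} (ha : Integrable a) : BC (_root_.ift a) :=
  ⟨continuous_ift ha, _, norm_ift_le a⟩

/-- The `W^{1,∞}` norm with window `c` (no conjugation). -/
def Nw (c v : V → ℂ) : ℝ≥0∞ := ⨆ x, lf (fun y => v y * c (y - x))

lemma schwartz_sub_integrable (c : SchwartzMap V ℂ) (x : V) :
    Integrable (fun y => c (y - x)) := c.integrable.comp_sub_right x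

lemma BC.mul_integrable {v : V → ℂ} (hv : BC v) {G : V → ℂ} {ρ : Measure V}
    (hG : Integrable G ρ) :
    Integrable (fun y => v y * G y) ρ := by
  obtain ⟨M, hM⟩ := hv.2
  exact hG.bdd_mul hv.1.aestronglyMeasurable (Filter.Eventually.of_forall hM)

lemma lf_le_Nw (c v : V → ℂ) (x : V) : lf (fun y => v y * c (y - x)) ≤ Nw c v :=
  le_iSup (fun x => lf (fun y => v y * c (y - x))) x

lemma Nw_add_le (c : SchwartzMap V ℂ) {u v : V → ℂ} (hu : BC u) (hv : BC v) :
    Nw c (fun x => u x + v x) ≤ Nw c u + Nw c v := by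
  refine iSup_le fun x => ?_
  simp_rw [add_mul]
  refine (lf_add_le (hu.mul_integrable (schwartz_sub_integrable c x))
    (hv.mul_integrable (schwartz_sub_integrable c x))).trans ?_
  exact add_le_add (lf_le_Nw _ _ _) (lf_le_Nw _ _ _)

lemma Nw_const_mul (c : V → ℂ) (a : ℂ) (u : V → ℂ) :
    Nw c (fun x => a * u x) = ‖a‖ₑ * Nw c u := by
  unfold Nw
  rw [ENNReal.mul_iSup]
  congr 1; ext x
  rw [← lf_const_mul]; simp_rw [mul_assoc]

lemma Nw_neg (c : V → ℂ) (u : V → ℂ) : Nw c (fun x => - u x) = Nw c u := by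
  have := Nw_const_mul c (-1) u
  simpa using this

lemma Nw_sub_le (c : SchwartzMap V ℂ) {u v : V → ℂ} (hu : BC u) (hv : BC v) :
    Nw c (fun x => u x - v x) ≤ Nw c u + Nw c v := by
  have hv' : BC (fun x => - v x) := by simpa using hv.const_mul (-1)
  have := Nw_add_le c hu hv'
  rw [Nw_neg] at this
  simpa [sub_eq_add_neg] using this

lemma Nw_sub_comm (c : V → ℂ) (u v : V → ℂ) :
    Nw c (fun x => u x - v x) = Nw c (fun x => v x - u x) := by
  rw [← Nw_neg]; simp

lemma enorm_le_Nw (c : SchwartzMap V ℂ) {v : V → ℂ} (hv : BC v) (x : V) :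
    ‖v x‖ₑ * ‖c 0‖ₑ ≤ Nw c v := by
  have h := enorm_le_lf (f := fun y => v y * c (y - x))
    (hv.1.mul (c.continuous.comp (continuous_id.sub continuous_const)))
    (hv.mul_integrable (schwartz_sub_integrable c x)) x
  simp only [sub_self, enorm_mul] at h
  exact h.trans (lf_le_Nw _ _ _)

lemma Nw_ift_le (c : SchwartzMap V ℂ) {a : V → ℂ} (ha : Integrable a) :
    Nw c (ift a) ≤ (∫⁻ η, ‖a η‖ₑ) * lf c := by
  refine iSup_le fun x => ?_
  rw [← lf_translate c x]
  exact lf_ift_mul_le ha (schwartz_sub_integrable c x)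

/-- Passing to a smaller window. -/
lemma Nw_small (q c : SchwartzMap V ℂ) (κ : V → ℂ) (hκ : ∀ y, κ y = q y * c y) {v : V → ℂ}
    (hv : BC v) : Nw κ v ≤ lf q * Nw c v := by
  refine iSup_le fun x => ?_
  have h := lf_mul_le (f := fun y => q (y - x)) (G := fun y => v y * c (y - x))
    (q.continuous.comp (continuous_id.sub continuous_const)) (schwartz_sub_integrable q x)
    (by rw [lf_translate]; exact lf_schwartz q)
    (hv.mul_integrable (schwartz_sub_integrable c x))
  rw [lf_translate] at h
  have e : (fun y => v y * κ (y - x)) = fun y => q (y - x) * (v y * c (y - x)) := by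
    ext y; rw [hκ]; ring
  rw [e]
  exact h.trans (by gcongr; exact lf_le_Nw _ _ _)

lemma lf_le_deriv : ∃ C : ℝ≥0∞, C < ⊤ ∧ ∀ f : SchwartzMap V ℂ,
    lf f ≤ C * ∑ p ∈ Finset.range (Module.finrank ℝ V + 2), ∫⁻ y, ‖iteratedFDeriv ℝ p f y‖ₑ := by
  set N := Module.finrank ℝ V + 1 with hN
  have hIntg : Integrable (fun x : V => (1 + ‖x‖) ^ (-(N : ℝ))) :=
    integrable_one_add_norm (by rw [hN]; push_cast; linarith)
  refine ⟨(∫⁻ x : V, ‖(1 + ‖x‖) ^ (-(N : ℝ))‖ₑ) * ENNReal.ofReal (2 ^ N * (1 + 2 ^ N)),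
    ENNReal.mul_lt_top hIntg.2 ENNReal.ofReal_lt_top, fun f => ?_⟩
  set S : ℝ := ∑ p ∈ Finset.range (N + 1), ∫ y, ‖iteratedFDeriv ℝ p f y‖ with hS
  have hi : ∀ p : ℕ, Integrable (fun y => ‖iteratedFDeriv ℝ p f y‖) := fun p => by
    simpa using f.integrable_pow_mul_iteratedFDeriv volume 0 p
  have hS0 : 0 ≤ S := Finset.sum_nonneg fun p _ => integral_nonneg fun y => norm_nonneg _
  have key : ∀ w, (1 + ‖w‖) ^ N * ‖ft volume f w‖ ≤ 2 ^ N * (1 + 2 ^ N) * S := by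
    intro w
    have h := fun n : ℕ => Real.pow_mul_norm_iteratedFDeriv_fourier_le (f := (f : V → ℂ)) (K := ⊤)
      (N := ⊤) (f.smooth ⊤) (fun k n _ _ => f.integrable_pow_mul_iteratedFDeriv volume k n)
      (k := 0) (n := n) le_top le_top w
    simp only [norm_iteratedFDeriv_zero, pow_zero, CharP.cast_eq_zero, mul_zero, zero_add,
      Finset.range_one, Finset.singleton_product, Finset.sum_map, Function.Embedding.coeFn_mk,
      one_mul] at h
    rw [← ft_eq_fourier] at h
    have h0 := h 0
    have hN' := h N
    simp only [pow_zero, one_mul, zero_add, Finset.range_one, Finset.sum_singleton] at h0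
    have h0' : ‖ft volume f w‖ ≤ S := by
      refine h0.trans ?_
      exact Finset.single_le_sum (f := fun p => ∫ y, ‖iteratedFDeriv ℝ p f y‖)
        (fun p _ => integral_nonneg fun y => norm_nonneg _) (by simp)
    have hp : (1 + ‖w‖) ^ N ≤ 2 ^ N * (1 + ‖w‖ ^ N) := by
      have := add_pow_le (zero_le_one' ℝ) (norm_nonneg w) N
      rw [one_pow] at this
      refine this.trans ?_
      gcongr
      · norm_num
      · omega
    calc (1 + ‖w‖) ^ N * ‖ft volume f w‖ ≤ (2 ^ N * (1 + ‖w‖ ^ N)) * ‖ft volume f w‖ := by gcongr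
      _ = 2 ^ N * (‖ft volume f w‖ + ‖w‖ ^ N * ‖ft volume f w‖) := by ring
      _ ≤ 2 ^ N * (S + 2 ^ N * S) := by gcongr
      _ = _ := by ring
  have hsum : ∑ p ∈ Finset.range (N + 1), ∫⁻ y, ‖iteratedFDeriv ℝ p f y‖ₑ = ENNReal.ofReal S := by
    rw [hS, ENNReal.ofReal_sum_of_nonneg (fun p _ => integral_nonneg fun y => norm_nonneg _)]
    refine Finset.sum_congr rfl fun p _ => ?_
    rw [ofReal_integral_eq_lintegral_ofReal (hi p) (Filter.Eventually.of_forall fun y =>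
      norm_nonneg _)]
    simp_rw [ofReal_norm]
  change lf f ≤ _ * ∑ p ∈ Finset.range (N + 1), _
  rw [hsum, mul_assoc, ← ENNReal.ofReal_mul (by positivity)]
  unfold lf
  rw [← lintegral_mul_const' _ _ ENNReal.ofReal_ne_top]
  refine lintegral_mono fun w => ?_
  rw [← ofReal_norm, ← ofReal_norm, ← ENNReal.ofReal_mul (norm_nonneg _)]
  refine ENNReal.ofReal_le_ofReal ?_
  have hpos : 0 < (1 + ‖w‖) ^ N := by positivity
  rw [Real.norm_of_nonneg (by positivity), Real.rpow_neg (by positivity), Real.rpow_natCast,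
    inv_mul_eq_div, le_div_iff₀ hpos, mul_comm]
  exact key w

/-- Product of a translated Schwartz function with another one. -/
def prodS (κ c : SchwartzMap V ℂ) (z : V) : SchwartzMap V ℂ :=
  SchwartzMap.pairing (ContinuousLinearMap.mul ℂ ℂ) (SchwartzMap.compSubConstCLM ℂ z κ) c

lemma prodS_apply (κ c : SchwartzMap V ℂ) (z y : V) : prodS κ c z y = κ (y - z) * c y := by
  simp [prodS]

lemma S0_finite (κ c : SchwartzMap V ℂ) :
    ∫⁻ z, lf (fun y => κ (y - z) * c y) < ⊤ := by
  obtain ⟨C, hC, h⟩ := lf_le_deriv (V := V)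
  have h1 : ∀ z, lf (fun y => κ (y - z) * c y) ≤ C * ∑ p ∈ Finset.range (Module.finrank ℝ V + 2),
      ∑ i ∈ Finset.range (p + 1), (p.choose i : ℝ≥0∞) *
        ∫⁻ y, ‖iteratedFDeriv ℝ i κ (y - z)‖ₑ * ‖iteratedFDeriv ℝ (p - i) c y‖ₑ := by
    intro z
    have := h (prodS κ c z)
    have e : (prodS κ c z : V → ℂ) = fun y => κ (y - z) * c y := by
      ext y; rw [prodS_apply]
    rw [e] at this
    refine this.trans ?_
    gcongr with p hp
    have : ∀ y, ‖iteratedFDeriv ℝ p (fun y => κ (y - z) * c y) y‖ₑ ≤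
        ∑ i ∈ Finset.range (p + 1), (p.choose i : ℝ≥0∞) *
        (‖iteratedFDeriv ℝ i κ (y - z)‖ₑ * ‖iteratedFDeriv ℝ (p - i) c y‖ₑ) := by
      intro y
      have h2 := norm_iteratedFDeriv_mul_le (𝕜 := ℝ) (f := fun y => κ (y - z)) (g := c) (N := (⊤ : ℕ∞))
        ((κ.smooth ⊤).comp (contDiff_id.sub contDiff_const)) (c.smooth ⊤) y (n := p)
        (by exact_mod_cast le_top)
      rw [← ofReal_norm]
      refine (ENNReal.ofReal_le_ofReal h2).trans (le_of_eq ?_)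
      rw [ENNReal.ofReal_sum_of_nonneg (fun i _ => by positivity)]
      refine Finset.sum_congr rfl fun i _ => ?_
      rw [ENNReal.ofReal_mul (by positivity), ENNReal.ofReal_mul (by positivity),
        ENNReal.ofReal_natCast, ofReal_norm, ofReal_norm, iteratedFDeriv_comp_sub, mul_assoc]
    refine (lintegral_mono this).trans (le_of_eq ?_)
    rw [lintegral_finsetSum']
    · refine Finset.sum_congr rfl fun i _ => ?_
      rw [lintegral_const_mul' _ _ (by simp)]
    · intro i _
      refine Measurable.aemeasurable (Measurable.const_mul ?_ _)
      have hk := (κ.smooth ⊤).continuous_iteratedFDeriv (m := i) (by exact_mod_cast le_top)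
      have hc := (c.smooth ⊤).continuous_iteratedFDeriv (m := p - i)
        (WithTop.coe_le_coe.mpr le_top)
      exact ((hk.comp (continuous_id.sub continuous_const)).enorm.measurable).mul
        hc.enorm.measurable
  refine (lintegral_mono h1).trans_lt ?_
  have hm : ∀ p i : ℕ, Measurable (Function.uncurry fun z y : V =>
      ‖iteratedFDeriv ℝ i κ (y - z)‖ₑ * ‖iteratedFDeriv ℝ (p - i) c y‖ₑ) := by
    intro p i
    have hk := (κ.smooth ⊤).continuous_iteratedFDeriv (m := i) (WithTop.coe_le_coe.mpr le_top)
    have hc := (c.smooth ⊤).continuous_iteratedFDeriv (m := p - i)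
      (WithTop.coe_le_coe.mpr le_top)
    exact ((hk.comp (continuous_snd.sub continuous_fst)).enorm.measurable).mul
      ((hc.comp continuous_snd).enorm.measurable)
  rw [lintegral_const_mul' _ _ hC.ne, lintegral_finsetSum']
  swap
  · intro p _
    exact (Finset.measurable_fun_sum _ fun i _ =>
      ((hm p i).lintegral_prod_right).const_mul _).aemeasurable
  refine ENNReal.mul_lt_top hC (ENNReal.sum_lt_top.mpr fun p _ => ?_)
  rw [lintegral_finsetSum' _ (fun i _ => (((hm p i).lintegral_prod_right).const_mul _).aemeasurable)]
  refine ENNReal.sum_lt_top.mpr fun i _ => ?_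
  rw [lintegral_const_mul' _ _ (by simp)]
  refine ENNReal.mul_lt_top (by simp) ?_
  rw [lintegral_lintegral_swap (hm p i).aemeasurable]
  have hi : ∀ (f : SchwartzMap V ℂ) (i : ℕ), ∫⁻ y, ‖iteratedFDeriv ℝ i f y‖ₑ < ⊤ := by
    intro f i
    have : Integrable (fun y => ‖iteratedFDeriv ℝ i f y‖) := by
      simpa using f.integrable_pow_mul_iteratedFDeriv volume 0 i
    have := this.2
    unfold HasFiniteIntegral at this
    simpa using this
  calc _ = ∫⁻ y, (∫⁻ z, ‖iteratedFDeriv ℝ i κ z‖ₑ) * ‖iteratedFDeriv ℝ (p - i) c y‖ₑ := by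
        refine lintegral_congr fun y => ?_
        rw [lintegral_mul_const' _ _ (by simp),
          lintegral_sub_left_eq_self (fun z => ‖iteratedFDeriv ℝ i κ z‖ₑ) y]
    _ < ⊤ := by
        rw [lintegral_const_mul' _ _ (hi κ i).ne]
        exact ENNReal.mul_lt_top (hi κ i) (hi c _)

/-- Changing to an arbitrary window. -/
lemma Nw_large (κ c : SchwartzMap V ℂ) (hκ : ∫ z, κ z * κ z = 1) :
    ∃ C : ℝ≥0∞, C < ⊤ ∧ ∀ v : V → ℂ, BC v → Nw c v ≤ C * Nw κ v := by
  refine ⟨(∫⁻ z, lf (fun y => κ (y - z) * c y)) + 1,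
    ENNReal.add_lt_top.mpr ⟨S0_finite κ c, ENNReal.one_lt_top⟩, fun v hv => iSup_le fun x => ?_⟩
  have hκs : ∀ z, Continuous (fun y => κ (y - z)) := fun z =>
    κ.continuous.comp (continuous_id.sub continuous_const)
  have e : (fun y => v y * c (y - x)) =
      fun y => ∫ z, (κ (y - z) * c (y - x)) * (v y * κ (y - z)) := by
    ext y
    have : ∫ z, κ (y - z) * κ (y - z) = 1 := by
      rw [← hκ]; exact integral_sub_left_eq_self (fun z => κ z * κ z) volume y
    calc v y * c (y - x) = (v y * c (y - x)) * ∫ z, κ (y - z) * κ (y - z) := by rw [this, mul_one]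
      _ = _ := by
        rw [← integral_const_mul]; congr 1; ext z; ring
  rw [e]
  have hkk : Integrable (fun z => κ (-z) * κ (-z)) := by
    have : Integrable (fun z => κ z * κ z) := by
      obtain ⟨M, hM⟩ : ∃ M, ∀ z, ‖κ z‖ ≤ M := ⟨_, fun z => κ.norm_le_seminorm ℂ z⟩
      exact κ.integrable.bdd_mul κ.continuous.aestronglyMeasurable (Filter.Eventually.of_forall hM)
    exact this.comp_neg
  refine (lf_integral_le (Φ := fun z y => (κ (y - z) * c (y - x)) * (v y * κ (y - z))) ?_).trans ?_
  · have := (hv.mul_integrable (schwartz_sub_integrable c x)).convolution_integrand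
      (ContinuousLinearMap.mul ℂ ℂ) hkk
    refine this.congr (Filter.Eventually.of_forall fun p => ?_)
    simp only [ContinuousLinearMap.mul_apply', Function.uncurry, neg_sub]
    ring
  · have hb : ∀ z, lf (fun y => (κ (y - z) * c (y - x)) * (v y * κ (y - z))) ≤
        lf (fun y => κ (y - (z - x)) * c y) * Nw κ v := by
      intro z
      have e1 : (fun y => κ (y - z) * c (y - x)) = fun y => prodS κ c (z - x) (y - x) := by
        ext y; rw [prodS_apply]; congr 2; abel
      have e2 : (fun y => κ (y - (z - x)) * c y) = prodS κ c (z - x) := by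
        ext y; rw [prodS_apply]
      have h := lf_mul_le (f := fun y => κ (y - z) * c (y - x)) (G := fun y => v y * κ (y - z))
        ((hκs z).mul (c.continuous.comp (continuous_id.sub continuous_const)))
        (by rw [e1]; exact schwartz_sub_integrable _ _)
        (by rw [e1, lf_translate]; exact lf_schwartz _)
        (hv.mul_integrable (schwartz_sub_integrable κ z))
      refine h.trans ?_
      rw [e1, lf_translate, e2]
      gcongr
      exact lf_le_Nw _ _ _
    refine (lintegral_mono hb).trans ?_
    by_cases hN : Nw κ v = ⊤
    · rw [hN, ENNReal.mul_top (by simp)]; exact le_top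
    · rw [lintegral_mul_const' _ _ hN,
        lintegral_sub_right_eq_self (fun z => lf (fun y => κ (y - z) * c y)) x]
      gcongr
      exact le_self_add

end Windows

/-! ### Geometry of the symbol -/
section Symbol
open Topology

variable {V : Type*} [NormedAddCommGroup V] [InnerProductSpace ℝ V] [FiniteDimensional ℝ V]
  [MeasurableSpace V] [BorelSpace V]

/-- Positive homogeneity away from the origin. -/
def Homog {F : Type*} [NormedAddCommGroup F] [NormedSpace ℝ F] (s : ℝ) (f : V → F) : Prop :=
  ∀ c : ℝ, 0 < c → ∀ x : V, x ≠ 0 → f (c • x) = c ^ s • f x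

lemma Homog.fderiv {F : Type*} [NormedAddCommGroup F] [NormedSpace ℝ F] {s : ℝ} {f : V → F}
    (hf : Homog s f) : Homog (s - 1) (fderiv ℝ f) := by
  intro c hc x hx
  have h1 : (fun y => f (c • y)) =ᶠ[𝓝 x] c ^ s • f := by
    filter_upwards [isOpen_ne.mem_nhds hx] with y hy
    exact hf c hc y hy
  have h2 := h1.fderiv_eq (𝕜 := ℝ)
  rw [fderiv_comp_smul, fderiv_const_smul_field, Pi.smul_apply] at h2
  rw [Real.rpow_sub_one hc.ne', div_eq_inv_mul, mul_smul, ← h2, smul_smul,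
    inv_mul_cancel₀ hc.ne', one_smul]

lemma Homog.iteratedFDeriv {F : Type*} [NormedAddCommGroup F] [NormedSpace ℝ F] {s : ℝ}
    {f : V → F} (hf : Homog s f) (n : ℕ) : Homog (s - n) (iteratedFDeriv ℝ n f) := by
  induction n with
  | zero =>
    intro c hc x hx
    ext v
    simp [hf c hc x hx]
  | succ n ih =>
    intro c hc x hx
    have := ih.fderiv c hc x hx
    rw [iteratedFDeriv_succ_eq_comp_left, Function.comp_apply, this, map_smul]
    simp only [Function.comp_apply]
    congr 2
    push_cast; ring

/-- The standing hypotheses on the symbol. -/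
structure Disp (m : ℝ) (μ : V → ℝ) : Prop where
  hm : 2 ≤ m
  smooth : ContDiffOn ℝ (⊤ : ℕ∞) μ {x | x ≠ 0}
  hom : Homog m μ
  hess : ∀ x : V, ‖x‖ = 1 → Function.Bijective ⇑(fderiv ℝ (fderiv ℝ μ) x)

namespace Disp
variable {m : ℝ} {μ : V → ℝ}

lemma contDiffAt (H : Disp m μ) {x : V} (hx : x ≠ 0) : ContDiffAt ℝ (⊤ : ℕ∞) μ x :=
  H.smooth.contDiffAt (isOpen_ne.mem_nhds hx)

lemma contDiffAt_fderiv (H : Disp m μ) {x : V} (hx : x ≠ 0) :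
    ContDiffAt ℝ (⊤ : ℕ∞) (fderiv ℝ μ) x :=
  (H.contDiffAt hx).fderiv_right (m := (⊤ : ℕ∞)) (by exact_mod_cast le_top)

lemma continuousAt_iter (H : Disp m μ) {x : V} (hx : x ≠ 0) (k : ℕ) :
    ContinuousAt (iteratedFDeriv ℝ k μ) x :=
  (H.contDiffAt hx).continuousAt_iteratedFDeriv (WithTop.coe_le_coe.mpr le_top)

lemma bij (H : Disp m μ) {x : V} (hx : x ≠ 0) :
    Function.Bijective ⇑(fderiv ℝ (fderiv ℝ μ) x) := by
  have hx' : 0 < ‖x‖ := norm_pos_iff.mpr hx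
  have h1 := H.hess (‖x‖⁻¹ • x) (by rw [norm_smul]; simp [hx'.ne'])
  have h2 := H.hom.fderiv.fderiv ‖x‖ hx' (‖x‖⁻¹ • x) (by simp [hx])
  rw [smul_smul, mul_inv_cancel₀ hx'.ne', one_smul] at h2
  rw [h2]
  have hp : ‖x‖ ^ (m - 1 - 1) ≠ 0 := (Real.rpow_pos_of_pos hx' _).ne'
  exact (MulAction.bijective (Units.mk0 _ hp)).comp h1

lemma fderiv_ne_zero (H : Disp m μ) {x : V} (hx : x ≠ 0) : fderiv ℝ μ x ≠ 0 := by
  intro h0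
  have hd : HasFDerivAt (fderiv ℝ μ) (fderiv ℝ (fderiv ℝ μ) x) ((1 : ℝ) • x) := by
    rw [one_smul]
    exact ((H.contDiffAt_fderiv hx).differentiableAt (by simp)).hasFDerivAt
  have h1 : HasDerivAt (fun c : ℝ => fderiv ℝ μ (c • x)) (fderiv ℝ (fderiv ℝ μ) x x) 1 := by
    have hs : HasDerivAt (fun c : ℝ => c • x) x 1 := by
      simpa using (hasDerivAt_id (1 : ℝ)).smul_const x
    exact hd.comp_hasDerivAt 1 hs
  have h2 : (fun c : ℝ => fderiv ℝ μ (c • x)) =ᶠ[𝓝 1] fun _ => 0 := by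
    filter_upwards [lt_mem_nhds (zero_lt_one' ℝ)] with c hc
    rw [H.hom.fderiv c hc x hx, h0, smul_zero]
  have h3 := h1.unique ((hasDerivAt_const (1 : ℝ) (0 : V →L[ℝ] ℝ)).congr_of_eventuallyEq h2)
  exact hx ((H.bij hx).1 (by rw [h3, map_zero]))

lemma norm_fderiv_bounds (H : Disp m μ) : ∃ c₀ C₀ : ℝ, 0 < c₀ ∧ 0 < C₀ ∧ ∀ x : V, x ≠ 0 →
    c₀ * ‖x‖ ^ (m - 1) ≤ ‖fderiv ℝ μ x‖ ∧ ‖fderiv ℝ μ x‖ ≤ C₀ * ‖x‖ ^ (m - 1) := by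
  have hc : IsCompact (Metric.sphere (0 : V) 1) := isCompact_sphere _ _
  have hne : ∀ x ∈ Metric.sphere (0 : V) 1, x ≠ 0 := by
    intro x hx h; simp [h] at hx
  have hcont : ContinuousOn (fun x => ‖fderiv ℝ μ x‖) (Metric.sphere (0 : V) 1) := fun x hx =>
    (H.contDiffAt_fderiv (hne x hx)).continuousAt.norm.continuousWithinAt
  obtain ⟨c₀, hc₀, h1⟩ := hc.exists_forall_le' hcont (a := 0)
    (fun x hx => norm_pos_iff.mpr (H.fderiv_ne_zero (hne x hx)))
  obtain ⟨C₀, h2⟩ := hc.exists_bound_of_continuousOn hcont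
  refine ⟨c₀, max C₀ 1, hc₀, by positivity, fun x hx => ?_⟩
  have hx' : 0 < ‖x‖ := norm_pos_iff.mpr hx
  have hs : (‖x‖⁻¹ • x) ∈ Metric.sphere (0 : V) 1 := by
    simp [norm_smul, hx'.ne']
  have h3 := H.hom.fderiv ‖x‖ hx' (‖x‖⁻¹ • x) (by simp [hx])
  rw [smul_smul, mul_inv_cancel₀ hx'.ne', one_smul] at h3
  have hp : 0 < ‖x‖ ^ (m - 1) := Real.rpow_pos_of_pos hx' _
  rw [h3, norm_smul, Real.norm_of_nonneg hp.le, mul_comm]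
  have h4 := h1 _ hs
  have h5 := h2 _ hs
  rw [norm_norm] at h5
  constructor
  · gcongr
  · rw [mul_comm]; gcongr; exact h5.trans (le_max_left _ _)

/-- Local bi-Lipschitz lower bound. -/
lemma local_lower (H : Disp m μ) {x : V} (hx : x ≠ 0) : ∃ c : ℝ, 0 < c ∧ ∃ U ∈ 𝓝 x,
    (∀ y ∈ U, y ≠ 0) ∧
    ∀ y ∈ U, ∀ z ∈ U, ‖y - z‖ ≤ c * ‖fderiv ℝ μ y - fderiv ℝ μ z‖ := by
  have hs : HasStrictFDerivAt (fderiv ℝ μ) (fderiv ℝ (fderiv ℝ μ) x) x :=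
    (H.contDiffAt_fderiv hx).hasStrictFDerivAt (by simp)
  set A : V ≃L[ℝ] (V →L[ℝ] ℝ) :=
    (LinearEquiv.ofBijective (fderiv ℝ (fderiv ℝ μ) x).toLinearMap (H.bij hx)).toContinuousLinearEquiv
  have hA : ((A : V ≃L[ℝ] (V →L[ℝ] ℝ)) : V →L[ℝ] (V →L[ℝ] ℝ)) = fderiv ℝ (fderiv ℝ μ) x := by
    ext v; rfl
  rw [← hA] at hs
  have hsub : ∃ c : NNReal, (Subsingleton V ∨ c < ‖((A.symm : (V →L[ℝ] ℝ) ≃L[ℝ] V) : (V →L[ℝ] ℝ) →L[ℝ] V)‖₊⁻¹) ∧ 0 < c := by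
    by_cases hV : Subsingleton V
    · exact ⟨1, Or.inl hV, one_pos⟩
    · refine ⟨‖((A.symm : (V →L[ℝ] ℝ) ≃L[ℝ] V) : (V →L[ℝ] ℝ) →L[ℝ] V)‖₊⁻¹ / 2, Or.inr ?_, ?_⟩
      · apply NNReal.half_lt_self
        have : Nontrivial V := not_subsingleton_iff_nontrivial.mp hV
        have h : 0 < ‖((A.symm : (V →L[ℝ] ℝ) ≃L[ℝ] V) : (V →L[ℝ] ℝ) →L[ℝ] V)‖₊ :=
          A.symm.norm_pos
        exact (inv_pos.mpr h).ne'
      · have : Nontrivial V := not_subsingleton_iff_nontrivial.mp hV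
        have := A.symm.norm_pos
        have h : 0 < ‖((A.symm : (V →L[ℝ] ℝ) ≃L[ℝ] V) : (V →L[ℝ] ℝ) →L[ℝ] V)‖₊ := this
        positivity
  obtain ⟨c, hc, hc0⟩ := hsub
  obtain ⟨U, hU, hap⟩ := hs.approximates_deriv_on_nhds (c := c) (Or.inr hc0)
  have hanti := hap.antilipschitz hc
  set K := (‖((A.symm : (V →L[ℝ] ℝ) ≃L[ℝ] V) : (V →L[ℝ] ℝ) →L[ℝ] V)‖₊⁻¹ - c)⁻¹
  refine ⟨K + 1, by positivity, U ∩ {y | y ≠ 0}, Filter.inter_mem hU (isOpen_ne.mem_nhds hx),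
    fun y hy => hy.2, fun y hy z hz => ?_⟩
  have := hanti.le_mul_dist ⟨y, hy.1⟩ ⟨z, hz.1⟩
  simp only [Subtype.dist_eq, dist_eq_norm, Set.domRestrict_apply] at this
  refine this.trans ?_
  gcongr
  simp

/-- Volume of the pieces, uniformly over a compact set avoiding the origin. -/
lemma vol_compact (H : Disp m μ) {S : Set V} (hS : IsCompact S) (h0 : ∀ x ∈ S, x ≠ 0) :
    ∃ C : ℝ≥0∞, C < ⊤ ∧ ∀ K : ℝ, 0 < K → ∀ r : ℝ, 0 < r → ∀ L : V →L[ℝ] ℝ,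
      volume {ζ : V | r⁻¹ • ζ ∈ S ∧ ‖L + fderiv ℝ μ ζ‖ ≤ K * r ^ (m - 2)} ≤
        C * ENNReal.ofReal (K ^ Module.finrank ℝ V) := by
  refine hS.induction_on (p := fun S => ∃ C : ℝ≥0∞, C < ⊤ ∧ ∀ K : ℝ, 0 < K → ∀ r : ℝ, 0 < r →
    ∀ L : V →L[ℝ] ℝ, volume {ζ : V | r⁻¹ • ζ ∈ S ∧ ‖L + fderiv ℝ μ ζ‖ ≤ K * r ^ (m - 2)} ≤
        C * ENNReal.ofReal (K ^ Module.finrank ℝ V)) ?_ ?_ ?_ ?_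
  · exact ⟨0, by simp, fun K _ r _ L => by simp⟩
  · rintro s t hst ⟨C, hC, h⟩
    refine ⟨C, hC, fun K hK r hr L => le_trans (measure_mono ?_) (h K hK r hr L)⟩
    rintro ζ ⟨h1, h2⟩
    exact ⟨hst h1, h2⟩
  · rintro s t ⟨C, hC, h⟩ ⟨C', hC', h'⟩
    refine ⟨C + C', ENNReal.add_lt_top.mpr ⟨hC, hC'⟩, fun K hK r hr L => ?_⟩
    rw [add_mul]
    refine le_trans ?_ (add_le_add (h K hK r hr L) (h' K hK r hr L))
    refine le_trans (measure_mono ?_) (measure_union_le _ _)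
    rintro ζ ⟨h1 | h1, h2⟩
    · exact Or.inl ⟨h1, h2⟩
    · exact Or.inr ⟨h1, h2⟩
  · intro x hx
    obtain ⟨c, hc, U, hU, hU0, hUl⟩ := H.local_lower (h0 x hx)
    refine ⟨U, mem_nhdsWithin_of_mem_nhds hU,
      ENNReal.ofReal ((2 * c) ^ Module.finrank ℝ V) * volume (Metric.ball (0 : V) 1),
      ENNReal.mul_lt_top ENNReal.ofReal_lt_top measure_ball_lt_top, fun K hK r hr L => ?_⟩
    set T := {ζ : V | r⁻¹ • ζ ∈ U ∧ ‖L + fderiv ℝ μ ζ‖ ≤ K * r ^ (m - 2)} with hT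
    rcases T.eq_empty_or_nonempty with hE | ⟨ζ₀, hζ₀⟩
    · rw [hE]; simp
    · have hsub : T ⊆ Metric.closedBall ζ₀ (2 * c * K) := by
        intro ζ hζ
        rw [Metric.mem_closedBall, dist_eq_norm]
        have key : ∀ ζ ∈ T, fderiv ℝ μ ζ = r ^ (m - 1) • fderiv ℝ μ (r⁻¹ • ζ) := by
          intro ζ hζ
          have := H.hom.fderiv r hr (r⁻¹ • ζ) (hU0 _ hζ.1)
          rwa [smul_smul, mul_inv_cancel₀ hr.ne', one_smul] at this
        have h1 := hUl _ hζ.1 _ hζ₀.1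
        have h2 : ‖fderiv ℝ μ ζ - fderiv ℝ μ ζ₀‖ ≤ 2 * (K * r ^ (m - 2)) := by
          have e : fderiv ℝ μ ζ - fderiv ℝ μ ζ₀ = (L + fderiv ℝ μ ζ) - (L + fderiv ℝ μ ζ₀) := by abel
          rw [e, two_mul]
          exact (norm_sub_le _ _).trans (add_le_add hζ.2 hζ₀.2)
        rw [key ζ hζ, key ζ₀ hζ₀, ← smul_sub, norm_smul, Real.norm_of_nonneg (by positivity)] at h2
        rw [← smul_sub, norm_smul, Real.norm_of_nonneg (by positivity)] at h1
        have e2 : r ^ (m - 1) = r * r ^ (m - 2) := by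
          rw [show m - 1 = 1 + (m - 2) by ring, Real.rpow_add hr, Real.rpow_one]
        have hp : 0 < r ^ (m - 2) := by positivity
        rw [e2] at h2
        set D := ‖fderiv ℝ μ (r⁻¹ • ζ) - fderiv ℝ μ (r⁻¹ • ζ₀)‖
        have h3 : r * D ≤ 2 * K := by
          have : (r * D) * r ^ (m - 2) ≤ (2 * K) * r ^ (m - 2) := by linarith
          exact le_of_mul_le_mul_right this hp
        calc ‖ζ - ζ₀‖ = r * (r⁻¹ * ‖ζ - ζ₀‖) := by field_simp
          _ ≤ r * (c * D) := by gcongr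
          _ = c * (r * D) := by ring
          _ ≤ c * (2 * K) := by gcongr
          _ = 2 * c * K := by ring
      refine (measure_mono hsub).trans ?_
      rw [Measure.addHaar_closedBall _ _ (by positivity), mul_pow, ENNReal.ofReal_mul (by positivity)]
      exact le_of_eq (by ring)

/-- Volume of the near-critical set for the unit-time phase. -/
lemma vol_A (H : Disp m μ) : ∃ C : ℝ≥0∞, C < ⊤ ∧ ∀ K : ℝ, 1 ≤ K → ∀ L : V →L[ℝ] ℝ,
      volume {ζ : V | ζ ≠ 0 ∧ ‖L + fderiv ℝ μ ζ‖ ≤ K * max 1 (‖ζ‖ ^ (m - 2))} ≤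
        C * ENNReal.ofReal (K ^ Module.finrank ℝ V) := by
  have hm := H.hm
  obtain ⟨c₀, C₀, hc₀, hC₀, hb⟩ := H.norm_fderiv_bounds
  set C₁ : ℝ := max 1 (4 / c₀) with hC₁
  set Q : ℝ := max 1 (2 * C₀ / c₀) with hQ
  have hQ1 : 1 ≤ Q := le_max_left _ _
  have hC₁1 : 1 ≤ C₁ := le_max_left _ _
  have hcpt : IsCompact (Metric.closedBall (0 : V) Q \ Metric.ball 0 Q⁻¹) :=
    (isCompact_closedBall _ _).diff Metric.isOpen_ball
  obtain ⟨C, hC, hv⟩ := H.vol_compact hcpt (by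
    rintro x ⟨_, h2⟩ rfl
    apply h2
    simp only [Metric.mem_ball, dist_self]
    positivity)
  refine ⟨ENNReal.ofReal (C₁ ^ Module.finrank ℝ V) * volume (Metric.ball (0 : V) 1) +
    C * ENNReal.ofReal ((Q ^ (m - 2)) ^ Module.finrank ℝ V),
    ENNReal.add_lt_top.mpr ⟨ENNReal.mul_lt_top ENNReal.ofReal_lt_top measure_ball_lt_top,
      ENNReal.mul_lt_top hC ENNReal.ofReal_lt_top⟩, fun K hK L => ?_⟩
  have hK0 : 0 < K := by linarith
  set A := {ζ : V | ζ ≠ 0 ∧ ‖L + fderiv ℝ μ ζ‖ ≤ K * max 1 (‖ζ‖ ^ (m - 2))} with hA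
  have hball : volume (Metric.closedBall (0 : V) (C₁ * K)) =
      ENNReal.ofReal (C₁ ^ Module.finrank ℝ V) * volume (Metric.ball (0 : V) 1) *
        ENNReal.ofReal (K ^ Module.finrank ℝ V) := by
    rw [Measure.addHaar_closedBall _ _ (by positivity), mul_pow, ENNReal.ofReal_mul (by positivity)]
    ring
  by_cases hex : ∃ ζ ∈ A, C₁ * K < ‖ζ‖
  swap
  · push Not at hex
    refine (measure_mono (t := Metric.closedBall (0 : V) (C₁ * K)) ?_).trans ?_
    · intro ζ hζ; simpa using hex ζ hζ
    · rw [hball, add_mul]; exact le_self_add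
  obtain ⟨ζs, hζs, hbig⟩ := hex
  have hCK : 1 ≤ C₁ * K := one_le_mul_of_one_le_of_one_le hC₁1 hK
  -- the set for large frequencies
  have hlarge : ∀ ζ ∈ A, C₁ * K < ‖ζ‖ → ‖L + fderiv ℝ μ ζ‖ ≤ K * ‖ζ‖ ^ (m - 2) := by
    intro ζ hζ h
    have h1 : 1 ≤ ‖ζ‖ := by linarith
    have := hζ.2
    rwa [max_eq_right (Real.one_le_rpow h1 (by linarith))] at this
  have hlarge2 : ∀ ζ ∈ A, C₁ * K < ‖ζ‖ → K * ‖ζ‖ ^ (m - 2) ≤ c₀ / 4 * ‖ζ‖ ^ (m - 1) := by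
    intro ζ hζ h
    have h1 : 0 < ‖ζ‖ := by linarith
    have e2 : ‖ζ‖ ^ (m - 1) = ‖ζ‖ * ‖ζ‖ ^ (m - 2) := by
      rw [show m - 1 = 1 + (m - 2) by ring, Real.rpow_add h1, Real.rpow_one]
    rw [e2, ← mul_assoc]
    gcongr
    have : 4 / c₀ * K ≤ ‖ζ‖ := le_trans (by gcongr; exact le_max_right _ _) h.le
    calc K = c₀ / 4 * (4 / c₀ * K) := by field_simp
      _ ≤ _ := by gcongr
  have ratio : ∀ ζ ∈ A, ∀ ζ' ∈ A, C₁ * K < ‖ζ‖ → C₁ * K < ‖ζ'‖ → ‖ζ‖ ≤ Q * ‖ζ'‖ := by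
    intro ζ hζ ζ' hζ' h h'
    have p1 : 0 < ‖ζ‖ := by linarith
    have p2 : 0 < ‖ζ'‖ := by linarith
    by_cases hle : ‖ζ‖ ≤ ‖ζ'‖
    · exact hle.trans (le_mul_of_one_le_left p2.le hQ1)
    push Not at hle
    have h1 := (hb ζ hζ.1).1
    have h2 := (hb ζ' hζ'.1).2
    have h3 : ‖fderiv ℝ μ ζ‖ ≤ ‖fderiv ℝ μ ζ'‖ + ‖L + fderiv ℝ μ ζ‖ + ‖L + fderiv ℝ μ ζ'‖ := by
      have e : fderiv ℝ μ ζ = fderiv ℝ μ ζ' + (L + fderiv ℝ μ ζ) - (L + fderiv ℝ μ ζ') := by abel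
      conv_lhs => rw [e]
      exact (norm_sub_le _ _).trans (by gcongr; exact norm_add_le _ _)
    have h4 := (hlarge ζ hζ h).trans (hlarge2 ζ hζ h)
    have h5 := (hlarge ζ' hζ' h').trans (hlarge2 ζ' hζ' h')
    have h6 : ‖ζ'‖ ^ (m - 1) ≤ ‖ζ‖ ^ (m - 1) := Real.rpow_le_rpow p2.le hle.le (by linarith)
    have h7 : c₀ / 2 * ‖ζ‖ ^ (m - 1) ≤ C₀ * ‖ζ'‖ ^ (m - 1) := by
      nlinarith
    have h8 : (‖ζ‖ / ‖ζ'‖) ^ (m - 1) ≤ 2 * C₀ / c₀ := by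
      rw [Real.div_rpow p1.le p2.le, div_le_div_iff₀ (by positivity) hc₀]
      linarith
    have h9 : ‖ζ‖ / ‖ζ'‖ ≤ (‖ζ‖ / ‖ζ'‖) ^ (m - 1) := by
      have : 1 ≤ ‖ζ‖ / ‖ζ'‖ := by rw [le_div_iff₀ p2]; linarith
      exact Real.self_le_rpow_of_one_le this (by linarith)
    have h10 : ‖ζ‖ / ‖ζ'‖ ≤ Q := (h9.trans h8).trans (le_max_right _ _)
    rwa [div_le_iff₀ p2] at h10
  have hρ : 0 < ‖ζs‖ := by linarith
  have hsub : A ⊆ Metric.closedBall (0 : V) (C₁ * K) ∪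
      {ζ : V | ‖ζs‖⁻¹ • ζ ∈ (Metric.closedBall (0 : V) Q \ Metric.ball 0 Q⁻¹) ∧
        ‖L + fderiv ℝ μ ζ‖ ≤ (K * Q ^ (m - 2)) * ‖ζs‖ ^ (m - 2)} := by
    intro ζ hζ
    by_cases h : ‖ζ‖ ≤ C₁ * K
    · left; simpa using h
    push Not at h
    right
    have r1 := ratio ζ hζ ζs hζs h hbig
    have r2 := ratio ζs hζs ζ hζ hbig h
    refine ⟨⟨?_, ?_⟩, ?_⟩
    · simp only [Metric.mem_closedBall, dist_zero_right, norm_smul, norm_inv, norm_norm]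
      rw [inv_mul_le_iff₀ hρ, mul_comm]; exact r1
    · simp only [Metric.mem_ball, dist_zero_right, norm_smul, norm_inv, norm_norm, not_lt]
      rw [inv_mul_eq_div, le_div_iff₀ hρ, inv_mul_le_iff₀ (by linarith)]; exact r2
    · refine (hlarge ζ hζ h).trans ?_
      rw [mul_assoc, ← Real.mul_rpow (by linarith) hρ.le]
      gcongr
  refine (measure_mono hsub).trans ((measure_union_le _ _).trans ?_)
  rw [add_mul]
  refine add_le_add hball.le ((hv (K * Q ^ (m - 2)) (by positivity) _ hρ L).trans (le_of_eq ?_))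
  rw [mul_pow, ENNReal.ofReal_mul (by positivity)]
  ring

/-- Volume of the near-critical set at time `t`. -/
lemma vol_S (H : Disp m μ) : ∃ C : ℝ≥0∞, C < ⊤ ∧ ∀ K : ℝ, 1 ≤ K → ∀ t : ℝ, 0 < t →
    ∀ L : V →L[ℝ] ℝ,
      volume {ζ : V | ζ ≠ 0 ∧ ‖L + t • fderiv ℝ μ ζ‖ ≤ K * max 1 (t * ‖ζ‖ ^ (m - 2))} ≤
        C * ENNReal.ofReal (K ^ Module.finrank ℝ V) *
          ENNReal.ofReal (t ^ (-(2 * Module.finrank ℝ V / m)) + 1) := by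
  obtain ⟨C, hC, h⟩ := H.vol_A
  have hm := H.hm
  refine ⟨C, hC, fun K hK t ht L => ?_⟩
  by_cases ht1 : 1 ≤ t
  · have : 1 ≤ ENNReal.ofReal (t ^ (-(2 * Module.finrank ℝ V / m)) + 1) := by
      rw [← ENNReal.ofReal_one]
      exact ENNReal.ofReal_le_ofReal (by simp; positivity)
    refine le_trans ?_ (le_mul_of_one_le_right' this)
    refine (measure_mono ?_).trans (h K hK (t⁻¹ • L))
    rintro ζ ⟨h1, h2⟩
    refine ⟨h1, ?_⟩
    have e : t⁻¹ • L + fderiv ℝ μ ζ = t⁻¹ • (L + t • fderiv ℝ μ ζ) := by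
      rw [smul_add, smul_smul, inv_mul_cancel₀ ht.ne', one_smul]
    rw [e, norm_smul, Real.norm_of_nonneg (by positivity), inv_mul_le_iff₀ ht]
    refine h2.trans ?_
    rw [mul_left_comm]
    gcongr
    rw [mul_max_of_nonneg _ _ ht.le]
    gcongr
    linarith
  · push Not at ht1
    set l : ℝ := t ^ (-(1 / m)) with hl
    have hl0 : 0 < l := by positivity
    have hl1 : 1 ≤ l := by
      rw [hl]; exact Real.one_le_rpow_of_pos_of_le_one_of_nonpos ht ht1.le (by simp; linarith)
    have htl : t = l ^ (-m) := by
      rw [hl, ← Real.rpow_mul ht.le]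
      have : -(1 / m) * -m = 1 := by field_simp
      rw [this, Real.rpow_one]
    have hsub : {ζ : V | ζ ≠ 0 ∧ ‖L + t • fderiv ℝ μ ζ‖ ≤ K * max 1 (t * ‖ζ‖ ^ (m - 2))} ⊆
        (fun ζ => l⁻¹ • ζ) ⁻¹' {ζ : V | ζ ≠ 0 ∧ ‖l • L + fderiv ℝ μ ζ‖ ≤
          (K * l) * max 1 (‖ζ‖ ^ (m - 2))} := by
      rintro ζ ⟨h1, h2⟩
      have h1' : l⁻¹ • ζ ≠ 0 := by simp [h1, hl0.ne']
      refine ⟨h1', ?_⟩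
      have e1 : l • (l⁻¹ • ζ) = ζ := by rw [smul_smul, mul_inv_cancel₀ hl0.ne', one_smul]
      have e2 := H.hom.fderiv l hl0 _ h1'
      rw [e1] at e2
      have e3 : l • L + fderiv ℝ μ (l⁻¹ • ζ) = l • (L + t • fderiv ℝ μ ζ) := by
        rw [e2, smul_add, smul_smul, smul_smul, htl]
        have : l * (l ^ (-m) * l ^ (m - 1)) = 1 := by
          rw [← Real.rpow_add hl0, show -m + (m - 1) = -1 by ring, Real.rpow_neg_one,
            mul_inv_cancel₀ hl0.ne']
        rw [← mul_assoc] at this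
        rw [this, one_smul]
      rw [e3, norm_smul, Real.norm_of_nonneg hl0.le, mul_comm K l, mul_assoc]
      gcongr
      refine h2.trans ?_
      gcongr
      have e4 : ‖ζ‖ = l * ‖l⁻¹ • ζ‖ := by
        rw [norm_smul, norm_inv, Real.norm_of_nonneg hl0.le]; field_simp
      rw [e4, Real.mul_rpow hl0.le (norm_nonneg _), ← mul_assoc, htl, ← Real.rpow_add hl0]
      refine mul_le_of_le_one_left (by positivity) ?_
      exact Real.rpow_le_one_of_one_le_of_nonpos hl1 (by linarith)
    refine (measure_mono hsub).trans ?_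
    rw [Measure.addHaar_preimage_smul _ (by positivity)]
    have hKl : 1 ≤ K * l := one_le_mul_of_one_le_of_one_le hK hl1
    refine (mul_le_mul_right (h (K * l) hKl (l • L)) _).trans ?_
    have e5 : l ^ Module.finrank ℝ V * l ^ Module.finrank ℝ V = t ^ (-(2 * Module.finrank ℝ V / m)) := by
      rw [← pow_add, hl, ← Real.rpow_natCast, ← Real.rpow_mul ht.le]
      congr 1; push_cast; field_simp; ring
    rw [abs_of_pos (by positivity), inv_pow, inv_inv, mul_pow, ENNReal.ofReal_mul (by positivity)]
    calc _ = C * ENNReal.ofReal (K ^ Module.finrank ℝ V) *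
          (ENNReal.ofReal (l ^ Module.finrank ℝ V) * ENNReal.ofReal (l ^ Module.finrank ℝ V)) := by ring
      _ ≤ _ := by
        rw [← ENNReal.ofReal_mul (by positivity), e5]
        gcongr
        linarith

end Disp
end Symbol

/-! ### Stationary phase bounds -/
section Phase
open Topology FourierTransform

variable {V : Type*} [NormedAddCommGroup V] [InnerProductSpace ℝ V] [FiniteDimensional ℝ V]
  [MeasurableSpace V] [BorelSpace V]

lemma iteratedDeriv_chr (i : ℕ) : iteratedDeriv i chr = fun s => (2 * Real.pi * Complex.I) ^ i * chr s := by
  have hd : ∀ s, HasDerivAt chr ((2 * Real.pi * Complex.I) * chr s) s := by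
    intro s
    unfold chr
    have h1 : HasDerivAt (fun s : ℝ => ((2 * Real.pi * s : ℝ) : ℂ) * Complex.I)
        (2 * Real.pi * Complex.I) s := by
      have := (((hasDerivAt_id s).const_mul (2 * Real.pi)).ofReal_comp).mul_const Complex.I
      simpa using this
    rw [mul_comm (2 * (Real.pi : ℂ) * Complex.I)]
    exact h1.cexp
  induction i with
  | zero => simp
  | succ n ih =>
    rw [iteratedDeriv_succ, ih]
    ext s
    rw [((hd s).const_mul _).deriv]
    ring

lemma norm_iteratedFDeriv_chr (i : ℕ) (s : ℝ) : ‖iteratedFDeriv ℝ i chr s‖ = (2 * Real.pi) ^ i := by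
  rw [norm_iteratedFDeriv_eq_norm_iteratedDeriv, iteratedDeriv_chr]
  simp [norm_chr, abs_of_pos Real.pi_pos]

/-- Second-order Taylor remainder of the symbol. -/
def mus (μ : V → ℝ) (ξ η : V) : ℝ := μ (ξ + η) - μ ξ - fderiv ℝ μ ξ η

lemma add_ne_zero_of_half {ξ η : V} (hξ : 1 ≤ ‖ξ‖) (hη : ‖η‖ ≤ 1 / 2) : ξ + η ≠ 0 := by
  intro h
  have : ξ = -η := eq_neg_of_add_eq_zero_left h
  rw [this, norm_neg] at hξ
  linarith

namespace Disp
variable {m : ℝ} {μ : V → ℝ}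

lemma iter_bound (H : Disp m μ) (k : ℕ) (hk : 2 ≤ k) : ∃ C : ℝ, 0 ≤ C ∧ ∀ ξ η : V, 1 ≤ ‖ξ‖ →
    ‖η‖ ≤ 1 / 2 → ‖iteratedFDeriv ℝ k μ (ξ + η)‖ ≤ C * ‖ξ‖ ^ (m - 2) := by
  have hcpt : IsCompact (Metric.closedBall (0 : V) (3 / 2) \ Metric.ball 0 (1 / 2)) :=
    (isCompact_closedBall _ _).diff Metric.isOpen_ball
  obtain ⟨C, hC⟩ := hcpt.exists_bound_of_continuousOn (f := iteratedFDeriv ℝ k μ) (by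
    intro x hx
    refine (H.continuousAt_iter ?_ k).continuousWithinAt
    rintro rfl
    exact hx.2 (by simp))
  refine ⟨max C 0, le_max_right _ _, fun ξ η hξ hη => ?_⟩
  have hξ0 : 0 < ‖ξ‖ := by linarith
  set x := ‖ξ‖⁻¹ • (ξ + η) with hx
  have hx1 : x ≠ 0 := by
    exact smul_ne_zero (inv_ne_zero hξ0.ne') (add_ne_zero_of_half hξ hη)
  have e := H.hom.iteratedFDeriv k ‖ξ‖ hξ0 x hx1
  have e1 : ‖ξ‖ • x = ξ + η := by rw [hx, smul_smul, mul_inv_cancel₀ hξ0.ne', one_smul]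
  rw [e1] at e
  have hm1 : x ∈ Metric.closedBall (0 : V) (3 / 2) \ Metric.ball 0 (1 / 2) := by
    have h1 : ‖ξ + η‖ ≤ ‖ξ‖ + ‖η‖ := norm_add_le _ _
    have h2 : ‖ξ‖ - ‖η‖ ≤ ‖ξ + η‖ := by
      have := norm_sub_norm_le ξ (-η); simpa using this
    constructor
    · simp only [hx, Metric.mem_closedBall, dist_zero_right, norm_smul, norm_inv, norm_norm]
      rw [inv_mul_le_iff₀ hξ0]; linarith
    · simp only [hx, Metric.mem_ball, dist_zero_right, norm_smul, norm_inv, norm_norm, not_lt]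
      rw [inv_mul_eq_div, le_div_iff₀ hξ0]; linarith
  rw [e, norm_smul, Real.norm_of_nonneg (by positivity), mul_comm]
  gcongr
  · exact (hC x hm1).trans (le_max_left _ _)
  · exact_mod_cast hk

lemma fderiv_mus (H : Disp m μ) {ξ η : V} (h : ξ + η ≠ 0) :
    fderiv ℝ (mus μ ξ) η = fderiv ℝ μ (ξ + η) - fderiv ℝ μ ξ := by
  have h1 : HasFDerivAt (fun η => μ (ξ + η)) (fderiv ℝ μ (ξ + η)) η := by
    have := ((H.contDiffAt h).differentiableAt (by simp)).hasFDerivAt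
    have h2 : HasFDerivAt (fun η => ξ + η) (ContinuousLinearMap.id ℝ V) η :=
      (hasFDerivAt_id η).const_add ξ
    exact this.comp η h2
  have := (h1.sub_const (μ ξ)).sub (fderiv ℝ μ ξ).hasFDerivAt
  exact this.fderiv

lemma mus_bound (H : Disp m μ) (N : ℕ) : ∃ C : ℝ, 1 ≤ C ∧ ∀ ξ η : V, 1 ≤ ‖ξ‖ →
    ‖η‖ < 1 / 2 → ∀ k, 1 ≤ k → k ≤ N → ‖iteratedFDeriv ℝ k (mus μ ξ) η‖ ≤ C * ‖ξ‖ ^ (m - 2) := by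
  have hex : ∀ k : ℕ, ∃ C : ℝ, 0 ≤ C ∧ ∀ ξ η : V, 1 ≤ ‖ξ‖ →
    ‖η‖ ≤ 1 / 2 → ‖iteratedFDeriv ℝ (k + 2) μ (ξ + η)‖ ≤ C * ‖ξ‖ ^ (m - 2) :=
      fun k => H.iter_bound (k + 2) (by omega)
  choose C hC0 hC using hex
  have hle : ∀ k ≤ N, C k ≤ 1 + ∑ k ∈ Finset.range (N + 1), C k := by
    intro k hk
    have := Finset.single_le_sum (f := C) (fun i _ => hC0 i) (Finset.mem_range.mpr (Nat.lt_succ_of_le hk))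
    linarith
  refine ⟨1 + ∑ k ∈ Finset.range (N + 1), C k, by
    have := Finset.sum_nonneg (s := Finset.range (N + 1)) (fun i _ => hC0 i); linarith,
    fun ξ η hξ hη k hk hkN => ?_⟩
  have hev : fderiv ℝ (mus μ ξ) =ᶠ[𝓝 η] fun η => fderiv ℝ μ (ξ + η) - fderiv ℝ μ ξ := by
    filter_upwards [Metric.isOpen_ball.mem_nhds (show η ∈ Metric.ball (0 : V) (1 / 2) by simpa using hη)] with y hy
    exact H.fderiv_mus (add_ne_zero_of_half hξ (by simpa using (Metric.mem_ball.mp hy).le))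
  obtain ⟨j, rfl⟩ : ∃ j, k = j + 1 := ⟨k - 1, by omega⟩
  rw [← norm_iteratedFDeriv_fderiv, (hev.iteratedFDeriv ℝ j).eq_of_nhds]
  rcases j with _ | j
  · rw [norm_iteratedFDeriv_zero]
    have hconv := Convex.norm_image_sub_le_of_norm_fderiv_le (𝕜 := ℝ) (f := fderiv ℝ μ)
      (s := Metric.closedBall ξ (1 / 2)) (C := C 0 * ‖ξ‖ ^ (m - 2)) (x := ξ) (y := ξ + η) (by
        intro y hy
        have hy' : ‖y - ξ‖ ≤ 1 / 2 := by simpa [dist_eq_norm] using hy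
        have : y ≠ 0 := by have := add_ne_zero_of_half hξ hy'; simpa using this
        exact (H.contDiffAt_fderiv this).differentiableAt (by simp))
      (by
        intro y hy
        have hy' : ‖y - ξ‖ ≤ 1 / 2 := by simpa [dist_eq_norm] using hy
        have := hC 0 ξ (y - ξ) hξ hy'
        rw [add_sub_cancel] at this
        rwa [zero_add, ← norm_iteratedFDeriv_fderiv, ← norm_iteratedFDeriv_fderiv,
          norm_iteratedFDeriv_zero] at this)
      (convex_closedBall _ _) (by simp) (by simpa using hη.le)
    refine hconv.trans ?_
    rw [add_sub_cancel_left]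
    have h1 := hle 0 (by omega)
    have h2 : 0 ≤ C 0 * ‖ξ‖ ^ (m - 2) := mul_nonneg (hC0 0) (by positivity)
    calc C 0 * ‖ξ‖ ^ (m - 2) * ‖η‖ ≤ C 0 * ‖ξ‖ ^ (m - 2) * 1 := by gcongr; linarith
      _ ≤ _ := by rw [mul_one]; gcongr
  · rw [← norm_iteratedFDeriv_fderiv]
    have e : fderiv ℝ (fun η => fderiv ℝ μ (ξ + η) - fderiv ℝ μ ξ) =
        fun η => fderiv ℝ (fderiv ℝ μ) (ξ + η) := by
      ext1 y
      rw [fderiv_sub_const, fderiv_comp_add_left]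
    rw [e, iteratedFDeriv_comp_add_left, norm_iteratedFDeriv_fderiv, norm_iteratedFDeriv_fderiv]
    refine (hC j ξ η hξ hη.le).trans ?_
    gcongr
    exact hle j (by omega)

/-- The localized oscillatory amplitude. -/
def amp (χ : V → ℂ) (μ : V → ℝ) (t : ℝ) (ξ η : V) : ℂ := χ η * chr (t * mus μ ξ η)

lemma contDiffOn_chr_mus (H : Disp m μ) {ξ : V} (hξ : 1 ≤ ‖ξ‖) (t : ℝ) :
    ContDiffOn ℝ (⊤ : ℕ∞) (fun η => t * mus μ ξ η) (Metric.ball (0 : V) (1 / 2)) := by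
  intro η hη
  refine ContDiffAt.contDiffWithinAt ?_
  have h := H.contDiffAt (add_ne_zero_of_half hξ (by simpa using (Metric.mem_ball.mp hη).le))
  refine contDiffAt_const.mul ((ContDiffAt.sub ?_ contDiffAt_const).sub (fderiv ℝ μ ξ).contDiff.contDiffAt)
  exact ContDiffAt.comp η h (contDiffAt_const.add contDiffAt_id)

lemma amp_smooth (H : Disp m μ) {χ : V → ℂ} (hχ : ContDiff ℝ (⊤ : ℕ∞) χ)
    (hs : tsupport χ ⊆ Metric.closedBall 0 (1 / 4)) {ξ : V} (hξ : 1 ≤ ‖ξ‖) (t : ℝ) :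
    ContDiff ℝ (⊤ : ℕ∞) (amp χ μ t ξ) := by
  rw [contDiff_iff_contDiffAt]
  intro η
  by_cases hη : η ∈ Metric.ball (0 : V) (1 / 2)
  · have h1 := (H.contDiffOn_chr_mus hξ t).contDiffAt (Metric.isOpen_ball.mem_nhds hη)
    exact hχ.contDiffAt.mul (contDiff_chr.contDiffAt.comp η h1)
  · have h2 : η ∉ tsupport χ := fun h => hη (Metric.closedBall_subset_ball (by norm_num) (hs h))
    have h3 : amp χ μ t ξ =ᶠ[𝓝 η] fun _ => 0 := by
      filter_upwards [notMem_tsupport_iff_eventuallyEq.mp h2] with y hy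
      simp [amp, hy]
    exact contDiffAt_const.congr_of_eventuallyEq h3

lemma amp_deriv (H : Disp m μ) {χ : V → ℂ} (hχ : ContDiff ℝ (⊤ : ℕ∞) χ)
    (hs : tsupport χ ⊆ Metric.closedBall 0 (1 / 4)) (N : ℕ) :
    ∃ C : ℝ, 0 ≤ C ∧ ∀ (ξ : V), 1 ≤ ‖ξ‖ → ∀ t : ℝ, 0 < t → ∀ n ≤ N, ∀ η,
      ‖iteratedFDeriv ℝ n (amp χ μ t ξ) η‖ ≤
        (Metric.closedBall (0 : V) (1 / 4)).indicator
          (fun _ => C * (max 1 (t * ‖ξ‖ ^ (m - 2))) ^ N) η := by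
  obtain ⟨C₁, hC₁, h1⟩ := H.mus_bound N
  have hcs : HasCompactSupport χ :=
    HasCompactSupport.of_support_subset_isCompact (isCompact_closedBall 0 (1 / 4))
      ((subset_tsupport χ).trans hs)
  have hXex : ∀ i : ℕ, ∃ X : ℝ, 0 ≤ X ∧ ∀ η, ‖iteratedFDeriv ℝ i χ η‖ ≤ X := by
    intro i
    obtain ⟨X, hX⟩ := (hcs.iteratedFDeriv (𝕜 := ℝ) i).exists_bound_of_continuous
      (hχ.continuous_iteratedFDeriv (m := i) (WithTop.coe_le_coe.mpr le_top))
    exact ⟨X, (norm_nonneg _).trans (hX 0), hX⟩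
  choose X hX0 hX using hXex
  set B : ℝ := (N.factorial : ℝ) * (2 * Real.pi) ^ N * C₁ ^ N with hB
  have hpi : 1 ≤ 2 * Real.pi := by linarith [Real.pi_gt_three]
  set Y : ℝ := ∑ i ∈ Finset.range (N + 1), X i with hY
  have hXY : ∀ i ≤ N, X i ≤ Y := fun i hi =>
    Finset.single_le_sum (f := X) (fun i _ => hX0 i) (Finset.mem_range.mpr (Nat.lt_succ_of_le hi))
  have hY0 : 0 ≤ Y := Finset.sum_nonneg fun i _ => hX0 i
  refine ⟨2 ^ N * Y * B, by positivity, fun ξ hξ t ht n hn η => ?_⟩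
  set M := max 1 (t * ‖ξ‖ ^ (m - 2)) with hM
  have hM1 : 1 ≤ M := le_max_left _ _
  by_cases hη : η ∈ Metric.closedBall (0 : V) (1 / 4)
  swap
  · have h2 : η ∉ tsupport χ := fun h => hη (hs h)
    have h3 : amp χ μ t ξ =ᶠ[𝓝 η] fun _ => 0 := by
      filter_upwards [notMem_tsupport_iff_eventuallyEq.mp h2] with y hy
      simp [amp, hy]
    rw [Set.indicator_of_notMem hη, (h3.iteratedFDeriv ℝ n).eq_of_nhds]
    rw [iteratedFDeriv_fun_zero]; simp
  rw [Set.indicator_of_mem hη]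
  have hη2 : η ∈ Metric.ball (0 : V) (1 / 2) := Metric.closedBall_subset_ball (by norm_num) hη
  have hop : IsOpen (Metric.ball (0 : V) (1 / 2)) := Metric.isOpen_ball
  have hud := hop.uniqueDiffOn (𝕜 := ℝ)
  have hphase := H.contDiffOn_chr_mus hξ t
  have hcomp : ∀ j ≤ N, ‖iteratedFDerivWithin ℝ j (fun η => chr (t * mus μ ξ η))
      (Metric.ball (0 : V) (1 / 2)) η‖ ≤ B * M ^ N := by
    intro j hj
    have := norm_iteratedFDerivWithin_comp_le (𝕜 := ℝ) (g := chr) (f := fun η => t * mus μ ξ η)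
      (n := j) (s := Metric.ball (0 : V) (1 / 2)) (t := Set.univ) (x := η) (N := (⊤ : ℕ∞))
      contDiff_chr.contDiffOn hphase (WithTop.coe_le_coe.mpr le_top) uniqueDiffOn_univ hud
      (fun _ _ => Set.mem_univ _) hη2 (C := (2 * Real.pi) ^ N) (D := C₁ * M) (by
        intro i hi
        rw [iteratedFDerivWithin_univ, norm_iteratedFDeriv_chr]
        exact pow_le_pow_right₀ hpi (hi.trans hj)) (by
        intro i hi1 hi
        rw [iteratedFDerivWithin_of_isOpen i hop hη2]
        have hsm : ContDiffAt ℝ i (mus μ ξ) η := by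
          have h5 := (H.contDiffOn_chr_mus hξ 1).contDiffAt (hop.mem_nhds hη2)
          simp only [one_mul] at h5
          exact h5.of_le (WithTop.coe_le_coe.mpr le_top)
        have e : (fun η => t * mus μ ξ η) = t • mus μ ξ := by ext; simp
        rw [e, iteratedFDeriv_const_smul_apply hsm, norm_smul, Real.norm_of_nonneg ht.le]
        have h6 := h1 ξ η hξ (by simpa using hη2) i hi1 (hi.trans hj)
        calc t * ‖iteratedFDeriv ℝ i (mus μ ξ) η‖ ≤ t * (C₁ * ‖ξ‖ ^ (m - 2)) := by gcongr
          _ = C₁ * (t * ‖ξ‖ ^ (m - 2)) := by ring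
          _ ≤ C₁ * M := by gcongr; exact le_max_right _ _
          _ ≤ (C₁ * M) ^ i := le_self_pow₀ (one_le_mul_of_one_le_of_one_le hC₁ hM1) (by omega))
    refine this.trans ?_
    have g1 : (j.factorial : ℝ) ≤ N.factorial := by exact_mod_cast Nat.factorial_le hj
    have g2 : (C₁ * M) ^ j ≤ (C₁ * M) ^ N :=
      pow_le_pow_right₀ (one_le_mul_of_one_le_of_one_le hC₁ hM1) hj
    calc (j.factorial : ℝ) * (2 * Real.pi) ^ N * (C₁ * M) ^ j
        ≤ N.factorial * (2 * Real.pi) ^ N * (C₁ * M) ^ N := by gcongr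
      _ = B * M ^ N := by rw [hB, mul_pow C₁ M]; ring
  rw [← iteratedFDerivWithin_of_isOpen n hop hη2]
  have hmul := norm_iteratedFDerivWithin_mul_le (𝕜 := ℝ) (f := χ) (g := fun η => chr (t * mus μ ξ η))
    (N := (⊤ : ℕ∞)) (s := Metric.ball (0 : V) (1 / 2)) hχ.contDiffOn
    (contDiff_chr.comp_contDiffOn hphase) hud hη2 (n := n) (WithTop.coe_le_coe.mpr le_top)
  refine hmul.trans ?_
  calc ∑ i ∈ Finset.range (n + 1), (n.choose i : ℝ) *
        ‖iteratedFDerivWithin ℝ i χ (Metric.ball (0 : V) (1 / 2)) η‖ *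
        ‖iteratedFDerivWithin ℝ (n - i) (fun η => chr (t * mus μ ξ η)) (Metric.ball (0 : V) (1 / 2)) η‖
      ≤ ∑ i ∈ Finset.range (n + 1), (n.choose i : ℝ) * Y * (B * M ^ N) := by
        refine Finset.sum_le_sum fun i hi => ?_
        have hi' : i ≤ n := Nat.lt_succ_iff.mp (Finset.mem_range.mp hi)
        gcongr
        · rw [iteratedFDerivWithin_of_isOpen i hop hη2]
          exact (hX i η).trans (hXY i (hi'.trans hn))
        · exact hcomp (n - i) (by omega)
    _ = 2 ^ n * Y * (B * M ^ N) := by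
        simp_rw [mul_assoc]
        rw [← Finset.sum_mul, ← Nat.cast_sum, Nat.sum_range_choose]; push_cast; ring
    _ ≤ 2 ^ N * Y * (B * M ^ N) := by
        gcongr
        norm_num
    _ = _ := by ring

/-- Decay of the Fourier transform of the amplitude. -/
lemma amp_decay (H : Disp m μ) {χ : V → ℂ} (hχ : ContDiff ℝ (⊤ : ℕ∞) χ)
    (hs : tsupport χ ⊆ Metric.closedBall 0 (1 / 4)) (N : ℕ) :
    ∃ C : ℝ, 0 ≤ C ∧ ∀ (ξ : V), 1 ≤ ‖ξ‖ → ∀ t : ℝ, 0 < t → ∀ y,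
      ‖y‖ ^ N * ‖ft volume (amp χ μ t ξ) y‖ ≤ C * (max 1 (t * ‖ξ‖ ^ (m - 2))) ^ N := by
  obtain ⟨C, hC, h⟩ := H.amp_deriv hχ hs N
  set b : ℝ := (volume (Metric.closedBall (0 : V) (1 / 4))).toReal with hb
  refine ⟨2 ^ N * ((N + 1) * (b * C)), by positivity, fun ξ hξ t ht y => ?_⟩
  set M := max 1 (t * ‖ξ‖ ^ (m - 2)) with hM
  have hcs : HasCompactSupport (amp χ μ t ξ) := by
    refine HasCompactSupport.of_support_subset_isCompact (isCompact_closedBall 0 (1 / 4)) ?_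
    intro η hη
    by_contra hn
    have h2 : η ∉ tsupport χ := fun h => hn (hs h)
    exact hη (by simp [amp, image_eq_zero_of_notMem_tsupport h2])
  set f : SchwartzMap V ℂ := hcs.toSchwartzMap (H.amp_smooth hχ hs hξ t) with hf
  have hfe : (f : V → ℂ) = amp χ μ t ξ := by ext; rfl
  have h0 := Real.pow_mul_norm_iteratedFDeriv_fourier_le (f := (f : V → ℂ)) (K := ⊤)
      (N := ⊤) (f.smooth ⊤) (fun k n _ _ => f.integrable_pow_mul_iteratedFDeriv volume k n)
      (k := 0) (n := N) le_top le_top y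
  simp only [norm_iteratedFDeriv_zero, pow_zero, CharP.cast_eq_zero, mul_zero, zero_add,
      Finset.range_one, Finset.singleton_product, Finset.sum_map, Function.Embedding.coeFn_mk,
      one_mul] at h0
  rw [← ft_eq_fourier, hfe] at h0
  refine h0.trans ?_
  rw [mul_assoc]
  gcongr
  have hIntg : ∀ p ∈ Finset.range (N + 1), ∫ v, ‖iteratedFDeriv ℝ p (amp χ μ t ξ) v‖ ≤ b * C * M ^ N := by
    intro p hp
    have hp' : p ≤ N := Nat.lt_succ_iff.mp (Finset.mem_range.mp hp)
    refine (integral_mono_of_nonneg (Filter.Eventually.of_forall fun _ => norm_nonneg _) ?_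
      (Filter.Eventually.of_forall fun v => h ξ hξ t ht p hp' v)).trans (le_of_eq ?_)
    · exact (integrable_indicator_iff measurableSet_closedBall).mpr
        (integrableOn_const (isCompact_closedBall _ _).measure_lt_top.ne)
    · rw [integral_indicator measurableSet_closedBall, setIntegral_const, smul_eq_mul, mul_assoc]
      rfl
  refine (Finset.sum_le_sum hIntg).trans (le_of_eq ?_)
  simp; ring

/-- The local frequency profile of the kernel. -/
def etil (χ : V → ℂ) (μ : V → ℝ) (t : ℝ) (r ξ : V) : ℂ :=
  ∫ η, chr ⟪r, η⟫ * (chr (t * μ (ξ + η)) * χ η)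

lemma norm_etil_le (χ : V → ℂ) (μ : V → ℝ) (t : ℝ) (r ξ : V) :
    ‖etil χ μ t r ξ‖ ≤ ∫ η, ‖χ η‖ := by
  unfold etil
  refine (norm_integral_le_integral_norm _).trans (le_of_eq ?_)
  simp [norm_chr]

lemma norm_etil_eq (χ : V → ℂ) (μ : V → ℝ) (t : ℝ) (r ξ : V) :
    ∃ y : V, ‖y‖ = ‖innerSL ℝ r + t • fderiv ℝ μ ξ‖ ∧
      ‖etil χ μ t r ξ‖ = ‖ft volume (amp χ μ t ξ) y‖ := by
  set L : V →L[ℝ] ℝ := innerSL ℝ r + t • fderiv ℝ μ ξ with hL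
  refine ⟨-(InnerProductSpace.toDual ℝ V).symm L, by rw [norm_neg, LinearIsometryEquiv.norm_map], ?_⟩
  have e : etil χ μ t r ξ = chr (t * μ ξ) *
      ft volume (amp χ μ t ξ) (-(InnerProductSpace.toDual ℝ V).symm L) := by
    unfold etil ft
    rw [← integral_const_mul]
    congr 1; ext η
    have e1 : -⟪η, -(InnerProductSpace.toDual ℝ V).symm L⟫ = ⟪r, η⟫ + t * fderiv ℝ μ ξ η := by
      rw [inner_neg_right, neg_neg, real_inner_comm, InnerProductSpace.toDual_symm_apply, hL]
      simp
    have e2 : t * μ (ξ + η) = t * μ ξ + t * fderiv ℝ μ ξ η + t * mus μ ξ η := by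
      unfold mus; ring
    rw [e1, e2, chr_add, chr_add, chr_add]
    unfold amp
    ring
  rw [e, norm_mul, norm_chr, one_mul]

lemma etil_lintegral (H : Disp m μ) {χ : V → ℂ} (hχ : ContDiff ℝ (⊤ : ℕ∞) χ)
    (hs : tsupport χ ⊆ Metric.closedBall 0 (1 / 4)) :
    ∃ C : ℝ≥0∞, C < ⊤ ∧ ∀ t : ℝ, 0 < t → ∀ r : V,
      ∫⁻ ξ, ‖etil χ μ t r ξ‖ₑ ≤ C * ENNReal.ofReal (t ^ (-(2 * Module.finrank ℝ V / m)) + 1) := by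
  set d := Module.finrank ℝ V with hd
  obtain ⟨C₁, hC₁, h1⟩ := H.amp_decay hχ hs (d + 1)
  obtain ⟨C₂, hC₂, h2⟩ := H.vol_S
  set C₃ : ℝ := max C₁ (∫ η, ‖χ η‖) with hC₃
  have hC₃0 : 0 ≤ C₃ := hC₁.trans (le_max_left _ _)
  set S : ℝ → V → ℕ → Set V := fun t r j => {ζ : V | ζ ≠ 0 ∧ ‖innerSL ℝ r + t • fderiv ℝ μ ζ‖ ≤
    (2 : ℝ) ^ j * max 1 (t * ‖ζ‖ ^ (m - 2))} with hS
  set c : ℕ → ℝ≥0∞ := fun j => ENNReal.ofReal (C₃ * 2 ^ (d + 1) * ((1 / 2) ^ j) ^ (d + 1)) with hc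
  have key : ∀ t : ℝ, 0 < t → ∀ r ξ : V, ‖etil χ μ t r ξ‖ₑ ≤
      (Metric.ball (0 : V) 1).indicator (fun _ => ENNReal.ofReal C₃) ξ +
        ∑' j, (toMeasurable volume (S t r j)).indicator (fun _ => c j) ξ := by
    intro t ht r ξ
    have hb := norm_etil_le χ μ t r ξ
    by_cases hξ : ξ ∈ Metric.ball (0 : V) 1
    · refine le_trans ?_ le_self_add
      rw [Set.indicator_of_mem hξ, ← ofReal_norm]
      exact ENNReal.ofReal_le_ofReal (hb.trans (le_max_right _ _))
    refine le_trans ?_ le_add_self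
    have hξ1 : 1 ≤ ‖ξ‖ := by simpa using hξ
    have hξ0 : ξ ≠ 0 := by rintro rfl; simp at hξ1; linarith
    obtain ⟨y, hy1, hy2⟩ := norm_etil_eq χ μ t r ξ
    have hdec := h1 ξ hξ1 t ht y
    rw [hy1, ← hy2] at hdec
    set M := max 1 (t * ‖ξ‖ ^ (m - 2)) with hM
    have hM1 : 1 ≤ M := le_max_left _ _
    have hM0 : 0 < M := by linarith
    set a := ‖innerSL ℝ r + t • fderiv ℝ μ ξ‖ with ha
    have fin : ∀ j, a ≤ 2 ^ j * M → ‖etil χ μ t r ξ‖ ≤ C₃ * 2 ^ (d + 1) * ((1 / 2) ^ j) ^ (d + 1) →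
        ‖etil χ μ t r ξ‖ₑ ≤ ∑' j, (toMeasurable volume (S t r j)).indicator (fun _ => c j) ξ := by
      intro j hj hle
      refine le_trans ?_ (ENNReal.le_tsum j)
      have hmem : ξ ∈ S t r j := ⟨hξ0, hj⟩
      rw [Set.indicator_of_mem (subset_toMeasurable _ _ hmem), ← ofReal_norm]
      exact ENNReal.ofReal_le_ofReal hle
    by_cases hsm : a ≤ M
    · refine fin 0 (by simpa using hsm) ?_
      simp only [pow_zero, one_pow, mul_one]
      refine (hb.trans (le_max_right C₁ _)).trans ?_
      exact le_mul_of_one_le_right hC₃0 (one_le_pow₀ (by norm_num))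
    · push Not at hsm
      obtain ⟨j, hj1, hj2⟩ := exists_nat_pow_near (x := a / M) (y := (2 : ℝ))
        (by rw [le_div_iff₀ hM0]; linarith) (by norm_num)
      rw [le_div_iff₀ hM0] at hj1
      rw [div_lt_iff₀ hM0] at hj2
      refine fin (j + 1) hj2.le ?_
      have e : C₃ * 2 ^ (d + 1) * ((1 / 2 : ℝ) ^ (j + 1)) ^ (d + 1) = C₃ / (2 ^ j) ^ (d + 1) := by
        rw [pow_succ (1 / 2 : ℝ) j, mul_pow, one_div, inv_pow, inv_pow, inv_pow]
        field_simp
      rw [e, le_div_iff₀ (by positivity)]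
      have h3 : (2 ^ j * M) ^ (d + 1) * ‖etil χ μ t r ξ‖ ≤ C₁ * M ^ (d + 1) :=
        le_trans (by gcongr) hdec
      rw [mul_pow] at h3
      have h4 : (2 ^ j) ^ (d + 1) * ‖etil χ μ t r ξ‖ * M ^ (d + 1) ≤ C₁ * M ^ (d + 1) := by
        linarith
      have h5 := le_of_mul_le_mul_right h4 (by positivity)
      rw [mul_comm]
      exact h5.trans (le_max_left _ _)
  set A : ℝ≥0∞ := ∑' j : ℕ, ENNReal.ofReal (C₃ * 2 ^ (d + 1)) * C₂ * ENNReal.ofReal ((1 / 2) ^ j)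
  have hA : A < ⊤ := by
    change (∑' j : ℕ, ENNReal.ofReal (C₃ * 2 ^ (d + 1)) * C₂ * ENNReal.ofReal ((1 / 2) ^ j)) < ⊤
    rw [ENNReal.tsum_mul_left]
    refine ENNReal.mul_lt_top (ENNReal.mul_lt_top ENNReal.ofReal_lt_top hC₂) ?_
    rw [← ENNReal.ofReal_tsum_of_nonneg (fun j => by positivity) (summable_geometric_of_lt_one (by norm_num) (by norm_num))]
    exact ENNReal.ofReal_lt_top
  refine ⟨ENNReal.ofReal C₃ * volume (Metric.ball (0 : V) 1) + A,
    ENNReal.add_lt_top.mpr ⟨ENNReal.mul_lt_top ENNReal.ofReal_lt_top measure_ball_lt_top, hA⟩,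
    fun t ht r => ?_⟩
  set T := ENNReal.ofReal (t ^ (-(2 * d / m)) + 1) with hT
  have hT1 : 1 ≤ T := by
    rw [hT, ← ENNReal.ofReal_one]
    exact ENNReal.ofReal_le_ofReal (by simp; positivity)
  refine (lintegral_mono (key t ht r)).trans ?_
  rw [lintegral_add_left (measurable_const.indicator measurableSet_ball),
    lintegral_indicator_const measurableSet_ball, lintegral_tsum (fun j =>
      (measurable_const.indicator (measurableSet_toMeasurable _ _)).aemeasurable), add_mul]
  refine add_le_add (le_mul_of_one_le_right' hT1) ?_
  rw [← ENNReal.tsum_mul_right]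
  refine ENNReal.tsum_le_tsum fun j => ?_
  rw [lintegral_indicator_const (measurableSet_toMeasurable _ _), measure_toMeasurable]
  refine (mul_le_mul_right (h2 (2 ^ j) (one_le_pow₀ (by norm_num)) t ht (innerSL ℝ r)) _).trans (le_of_eq ?_)
  have e : c j * ENNReal.ofReal ((2 ^ j) ^ d) = ENNReal.ofReal (C₃ * 2 ^ (d + 1)) * ENNReal.ofReal ((1 / 2) ^ j) := by
    rw [hc, ← ENNReal.ofReal_mul (by positivity), ← ENNReal.ofReal_mul (by positivity)]
    congr 1
    rw [pow_succ ((1 / 2 : ℝ) ^ j)]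
    have : ((1 / 2 : ℝ) ^ j) ^ d * (2 ^ j) ^ d = 1 := by
      rw [← mul_pow, ← mul_pow]; norm_num
    linear_combination C₃ * 2 ^ (d + 1) * (1 / 2 : ℝ) ^ j * this
  calc _ = (c j * ENNReal.ofReal ((2 ^ j) ^ d)) * C₂ * T := by ring
    _ = _ := by rw [e]; ring

end Disp

end Phase

/-! ### The kernel -/
section Kernel
open Topology FourierTransform

variable {V : Type*} [NormedAddCommGroup V] [InnerProductSpace ℝ V] [FiniteDimensional ℝ V]
  [MeasurableSpace V] [BorelSpace V]

/-- `E` is the inverse Fourier transform of `chr (t μ)`. -/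
def IsKer (μ : V → ℝ) (t : ℝ) (E : V → ℂ) : Prop :=
  BC E ∧ ∀ φ : SchwartzMap V ℂ, ∫ x, E x * φ x = ∫ ξ, chr (t * μ ξ) * ift φ ξ

lemma ft_kernel {μ : V → ℝ} {t : ℝ} {E : V → ℂ} (hE : IsKer μ t E) {χ : V → ℂ}
    (hχ : ContDiff ℝ (⊤ : ℕ∞) χ) (hs : HasCompactSupport χ) (r ξ : V) :
    ft volume (fun x => E x * ft volume χ (x - r)) ξ = Disp.etil χ μ t r ξ := by
  set ψ : V → ℂ := fun η => chr ⟪r, η - ξ⟫ * χ (η - ξ) with hψ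
  have hψs : HasCompactSupport ψ := by
    have h1 : HasCompactSupport (fun η => χ (η - ξ)) := by
      have := hs.comp_homeomorph (Homeomorph.subRight ξ)
      exact this
    exact h1.mul_left
  have hψd : ContDiff ℝ (⊤ : ℕ∞) ψ := by
    have h1 : ContDiff ℝ (⊤ : ℕ∞) (fun η : V => η - ξ) := contDiff_id.sub contDiff_const
    exact (contDiff_chr.comp (contDiff_const.inner ℝ h1)).mul (hχ.comp h1)
  set Ψ : SchwartzMap V ℂ := hψs.toSchwartzMap hψd with hΨ
  have hΨψ : (Ψ : V → ℂ) = ψ := by ext x; simp [hΨ]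
  set φ : SchwartzMap V ℂ := 𝓕 Ψ with hφ
  have hφ1 : (φ : V → ℂ) = ft volume ψ := by
    rw [hφ, SchwartzMap.fourier_coe, ← ft_eq_fourier, hΨψ]
  have hφ2 : ift φ = ψ := by
    rw [hφ1, ← hΨψ]
    exact ift_ft Ψ.continuous Ψ.integrable (lf_schwartz Ψ)
  have hφ3 : ∀ x, φ x = chr (-⟪x, ξ⟫) * ft volume χ (x - r) := by
    intro x
    rw [hφ1, ft, ft, ← integral_const_mul,
      ← integral_sub_right_eq_self (fun a => chr (-⟪x, ξ⟫) * (chr (-⟪a, x - r⟫) * χ a)) ξ]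
    congr 1; ext η
    rw [hψ]; simp only
    rw [← mul_assoc, ← mul_assoc, ← chr_add, ← chr_add]
    congr 2
    simp only [inner_sub_left, inner_sub_right, real_inner_comm]
    ring
  have := hE.2 φ
  rw [hφ2] at this
  rw [ft]
  calc ∫ y, chr (-⟪y, ξ⟫) * (E y * ft volume χ (y - r)) = ∫ x, E x * φ x := by
        congr 1; ext x; rw [hφ3]; ring
    _ = _ := this
    _ = _ := by
      rw [Disp.etil, ← integral_sub_right_eq_self (fun a => chr ⟪r, a⟫ * (chr (t * μ (ξ + a)) * χ a)) ξ]
      congr 1; ext η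
      rw [hψ]; simp only
      rw [add_sub_cancel]; ring

/-- Division by a nonvanishing function. -/
lemma div_schwartz (f g : SchwartzMap V ℂ) (hf : HasCompactSupport f)
    (h : ∀ x ∈ tsupport f, g x ≠ 0) :
    ∃ q : SchwartzMap V ℂ, tsupport q ⊆ tsupport f ∧ HasCompactSupport q ∧ ∀ x, f x = q x * g x := by
  have hcd : ContDiff ℝ (⊤ : ℕ∞) (fun x => f x * (g x)⁻¹) := by
    rw [contDiff_iff_contDiffAt]
    intro x
    by_cases hx : x ∈ tsupport f
    · exact f.smooth'.contDiffAt.mul ((g.smooth'.contDiffAt).inv (h x hx))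
    · have : (fun x => f x * (g x)⁻¹) =ᶠ[𝓝 x] fun _ => 0 := by
        filter_upwards [notMem_tsupport_iff_eventuallyEq.mp hx] with y hy
        simp [hy]
      exact contDiffAt_const.congr_of_eventuallyEq this
  have hcs : HasCompactSupport (fun x => f x * (g x)⁻¹) := hf.mul_right
  have e : (hcs.toSchwartzMap hcd : V → ℂ) = (fun x => f x * (g x)⁻¹) := by ext; simp
  refine ⟨hcs.toSchwartzMap hcd, ?_, ?_, fun x => ?_⟩
  · rw [e]; exact tsupport_mul_subset_left
  · rw [e]; exact hcs
  · rw [e]; simp only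
    by_cases hx : x ∈ tsupport f
    · rw [mul_assoc, inv_mul_cancel₀ (h x hx), mul_one]
    · rw [image_eq_zero_of_notMem_tsupport hx]; simp

/-- Complex bump as a Schwartz function. -/
lemma exists_bump (ε : ℝ) (hε : 0 < ε) : ∃ f : SchwartzMap V ℂ,
    tsupport f ⊆ Metric.closedBall 0 ε ∧ HasCompactSupport f ∧ (∀ x ∈ Metric.ball (0 : V) (ε * (2 / 3)), f x = 1) ∧
    (∀ x, ε ≤ ‖x‖ → f x = 0) ∧ (∫ x, f x ≠ 0) ∧ (∫ x, f x * f x ≠ 0) := by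
  set B : ContDiffBump (0 : V) := ⟨ε * (2 / 3), ε, by positivity, by linarith⟩ with hB
  have hcd : ContDiff ℝ (⊤ : ℕ∞) (fun x => ((B x : ℝ) : ℂ)) :=
    Complex.ofRealCLM.contDiff.comp B.contDiff
  have hcs : HasCompactSupport (fun x => ((B x : ℝ) : ℂ)) :=
    B.hasCompactSupport.comp_left (g := fun x : ℝ => (x : ℂ)) (by simp)
  have e : (hcs.toSchwartzMap hcd : V → ℂ) = (fun x => ((B x : ℝ) : ℂ)) := by ext; simp
  have hz : ∀ x, ε ≤ ‖x‖ → B x = 0 := by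
    intro x hx
    have : x ∉ Function.support B := by
      rw [B.support_eq]; simpa [hB] using hx
    simpa using this
  refine ⟨hcs.toSchwartzMap hcd, ?_, ?_, ?_, ?_, ?_, ?_⟩
  · rw [e]
    refine closure_minimal (fun x hx => ?_) Metric.isClosed_closedBall
    by_contra hx'
    simp only [Metric.mem_closedBall, dist_zero_right, not_le] at hx'
    exact hx (by simp [hz x hx'.le])
  · rw [e]; exact hcs
  · rw [e]; intro x hx
    have := B.one_of_mem_closedBall (x := x) (Metric.ball_subset_closedBall hx)
    simp [this]
  · rw [e]; intro x hx
    simp [hz x hx]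
  · rw [e]; simp only; rw [integral_complex_ofReal]
    exact_mod_cast B.integral_pos.ne'
  · rw [e]
    simp_rw [← Complex.ofReal_mul]
    rw [integral_complex_ofReal]
    have hc : Continuous fun x => B x * B x := B.continuous.mul B.continuous
    have : 0 < ∫ x, B x * B x := by
      refine hc.integral_pos_of_hasCompactSupport_nonneg_nonzero (x := 0)
        B.hasCompactSupport.mul_left (fun x => mul_self_nonneg _) ?_
      have := B.one_of_mem_closedBall (x := 0) (Metric.mem_closedBall_self B.rIn_pos.le)
      simp [this]
    exact_mod_cast this.ne'

lemma exists_windows (c θ : SchwartzMap V ℂ) (hc : c 0 ≠ 0) (hθ : θ 0 ≠ 0) :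
    ∃ κ κ0 b q β : SchwartzMap V ℂ, (∫ z, κ z * κ z = 1) ∧ (∫ z, κ0 z = 1) ∧
      (∀ y, κ0 y = b y * c y) ∧ (∀ y, b y = q y * c y) ∧
      (∀ x y, κ x ≠ 0 → κ0 y ≠ 0 → θ (x - y) * β (x - y) = 1) := by
  have h1 : ∀ᶠ x in 𝓝 (0 : V), c x ≠ 0 ∧ θ x ≠ 0 :=
    (c.continuous.continuousAt.eventually_ne hc).and (θ.continuous.continuousAt.eventually_ne hθ)
  obtain ⟨ε, hε, h2⟩ := Metric.eventually_nhds_iff_ball.mp h1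
  obtain ⟨f, hf1, hf2, hf3, hf4, hf5, hf6⟩ := exists_bump (V := V) (ε / 6) (by positivity)
  obtain ⟨f', hf1', hf2', hf3', hf4', hf5', hf6'⟩ := exists_bump (V := V) (ε / 2) (by positivity)
  have hsub : ∀ r < ε, Metric.closedBall (0 : V) r ⊆ Metric.ball 0 ε := fun r hr =>
    Metric.closedBall_subset_ball hr
  obtain ⟨s, hs⟩ := IsAlgClosed.exists_pow_nat_eq (∫ x, f x * f x)⁻¹ (n := 2) (by norm_num)
  obtain ⟨b, hb1, hb2, hb3⟩ := div_schwartz ((∫ x, f x)⁻¹ • f) c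
    (by
      have : (((∫ x, f x)⁻¹ • f : SchwartzMap V ℂ) : V → ℂ) = fun x => (∫ x, f x)⁻¹ * f x := rfl
      rw [this]; exact hf2.mul_left)
    (by
      intro x hx
      have : (((∫ x, f x)⁻¹ • f : SchwartzMap V ℂ) : V → ℂ) = fun x => (∫ x, f x)⁻¹ * f x := rfl
      rw [this] at hx
      exact (h2 x (hsub (ε / 6) (by linarith) (hf1 (tsupport_mul_subset_right hx)))).1)
  obtain ⟨q, hq1, hq2, hq3⟩ := div_schwartz b c hb2
    (by
      intro x hx
      have hx := hb1 hx
      have : (((∫ x, f x)⁻¹ • f : SchwartzMap V ℂ) : V → ℂ) = fun x => (∫ x, f x)⁻¹ * f x := rfl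
      rw [this] at hx
      exact (h2 x (hsub (ε / 6) (by linarith) (hf1 (tsupport_mul_subset_right hx)))).1)
  obtain ⟨β, hβ1, hβ2, hβ3⟩ := div_schwartz f' θ hf2'
    (fun x hx => (h2 x (hsub (ε / 2) (by linarith) (hf1' hx))).2)
  refine ⟨s • f, (∫ x, f x)⁻¹ • f, b, q, β, ?_, ?_, hb3, hq3, ?_⟩
  · have : ∀ z, (s • f) z * (s • f) z = s ^ 2 * (f z * f z) := by
      intro z; simp only [smul_apply, smul_eq_mul]; ring
    simp_rw [this]
    rw [integral_const_mul, hs, inv_mul_cancel₀ hf6]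
  · simp only [smul_apply, smul_eq_mul]
    rw [integral_const_mul, inv_mul_cancel₀ hf5]
  · intro x y hx hy
    have hfx : ‖x‖ < ε / 6 := by
      by_contra h; push Not at h
      exact hx (by simp [hf4 x h])
    have hfy : ‖y‖ < ε / 6 := by
      by_contra h; push Not at h
      exact hy (by simp [hf4 y h])
    rw [mul_comm, ← hβ3]
    refine hf3' _ ?_
    simp only [Metric.mem_ball, dist_zero_right]
    have := norm_sub_le x y
    linarith

lemma Disp.kernel_bound {m : ℝ} {μ : V → ℝ} (H : Disp m μ) (χ : SchwartzMap V ℂ)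
    (hs : tsupport χ ⊆ Metric.closedBall 0 (1 / 4)) (β : SchwartzMap V ℂ)
    (q : ℝ≥0∞) (hq : 1 ≤ q) :
    ∃ C : ℝ≥0∞, C < ⊤ ∧ ∀ t : ℝ, 0 < t → ∀ E : V → ℂ, IsKer μ t E → ∀ r : V,
      lf (fun x => β (x - r) * (E x * ft volume χ (x - r))) < ⊤ ∧
      eLpNorm (ft volume (fun x => β (x - r) * (E x * ft volume χ (x - r)))) q volume ≤
        C * ENNReal.ofReal (t ^ (-(2 * Module.finrank ℝ V / (m * q.toReal))) + 1) := by
  have hm := H.hm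
  obtain ⟨C₁, hC₁, h1⟩ := H.etil_lintegral (χ := χ) χ.smooth' hs
  have hcs : HasCompactSupport χ :=
    (isCompact_closedBall (0 : V) (1 / 4)).of_isClosed_subset (isClosed_tsupport _) hs
  set θ : SchwartzMap V ℂ := 𝓕 χ with hθ
  have hθ1 : ft volume χ = θ := by rw [ft_eq_fourier, hθ, SchwartzMap.fourier_coe]
  set B : ℝ≥0∞ := lf β * ENNReal.ofReal (∫ η, ‖χ η‖) with hB
  have hBt : B < ⊤ := ENNReal.mul_lt_top (lf_schwartz β) ENNReal.ofReal_lt_top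
  set A : ℝ≥0∞ := lf β * C₁ with hA
  have hAt : A < ⊤ := ENNReal.mul_lt_top (lf_schwartz β) hC₁
  have main : ∀ t : ℝ, 0 < t → ∀ E : V → ℂ, IsKer μ t E → ∀ r : V,
      lf (fun x => β (x - r) * (E x * ft volume χ (x - r))) ≤
        A * ENNReal.ofReal (t ^ (-(2 * Module.finrank ℝ V / m)) + 1) ∧
      ∀ ξ, ‖ft volume (fun x => β (x - r) * (E x * ft volume χ (x - r))) ξ‖ₑ ≤ B := by
    intro t ht E hE r
    have hIntg : Integrable (fun x => E x * ft volume χ (x - r)) := by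
      rw [hθ1]; exact hE.1.mul_integrable (schwartz_sub_integrable θ r)
    have hβc : Continuous fun y => β (y - r) := β.continuous.comp (continuous_id.sub continuous_const)
    have hβi := schwartz_sub_integrable β r
    have hβl : lf (fun y => β (y - r)) = lf β := lf_translate β r
    have hβt : lf (fun y => β (y - r)) < ⊤ := hβl ▸ lf_schwartz β
    constructor
    · refine (lf_mul_le hβc hβi hβt hIntg).trans ?_
      rw [hβl, hA, mul_assoc]
      gcongr
      refine le_trans (le_of_eq ?_) (h1 t ht r)
      rw [lf]; congr 1; ext ξ
      rw [ft_kernel hE (χ := χ) χ.smooth' hcs]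
    · intro ξ
      have e : (fun x => β (x - r) * (E x * ft volume χ (x - r))) =
          fun x => ift (ft volume (fun y => β (y - r))) x * (E x * ft volume χ (x - r)) := by
        rw [ift_ft hβc hβi hβt]
      rw [e, ft_mul (integrable_ft_of_lf hβi hβt) hIntg]
      refine (enorm_integral_le_lintegral_enorm _).trans ?_
      rw [hB, ← hβl, lf, ← lintegral_mul_const' _ _ ENNReal.ofReal_ne_top]
      refine lintegral_mono fun η => ?_
      rw [enorm_mul]
      gcongr
      rw [ft_kernel hE (χ := χ) χ.smooth' hcs, ← ofReal_norm]
      exact ENNReal.ofReal_le_ofReal (Disp.norm_etil_le _ _ _ _ _)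
  by_cases hqt : q = ⊤
  · refine ⟨B, hBt, fun t ht E hE r => ?_⟩
    obtain ⟨g1, g2⟩ := main t ht E hE r
    refine ⟨g1.trans_lt (ENNReal.mul_lt_top hAt ENNReal.ofReal_lt_top), ?_⟩
    rw [hqt, eLpNorm_exponent_top]
    refine (eLpNormEssSup_le_of_ae_enorm_bound (Filter.Eventually.of_forall g2)).trans ?_
    refine le_mul_of_one_le_right' ?_
    rw [← ENNReal.ofReal_one]
    exact ENNReal.ofReal_le_ofReal (by simp)
  · set s := q.toReal with hs'
    have hs1 : 1 ≤ s := by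
      rw [hs', ← ENNReal.toReal_one]; exact ENNReal.toReal_mono hqt hq
    have hs0 : 0 < s := by linarith
    have hq0 : q ≠ 0 := (zero_lt_one.trans_le hq).ne'
    refine ⟨(B ^ (s - 1) * A) ^ (1 / s), ENNReal.rpow_lt_top_of_nonneg (by positivity)
      (ENNReal.mul_lt_top (ENNReal.rpow_lt_top_of_nonneg (by linarith) hBt.ne) hAt).ne,
      fun t ht E hE r => ?_⟩
    obtain ⟨g1, g2⟩ := main t ht E hE r
    refine ⟨g1.trans_lt (ENNReal.mul_lt_top hAt ENNReal.ofReal_lt_top), ?_⟩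
    rw [eLpNorm_eq_lintegral_rpow_enorm_toReal hq0 hqt, ← hs']
    set e := ft volume (fun x => β (x - r) * (E x * ft volume χ (x - r))) with he
    have k1 : ∫⁻ x, ‖e x‖ₑ ^ s ≤ B ^ (s - 1) * A *
        ENNReal.ofReal (t ^ (-(2 * Module.finrank ℝ V / m)) + 1) := by
      calc ∫⁻ x, ‖e x‖ₑ ^ s ≤ ∫⁻ x, B ^ (s - 1) * ‖e x‖ₑ := by
            refine lintegral_mono fun x => ?_
            have : ‖e x‖ₑ ^ s = ‖e x‖ₑ ^ (s - 1) * ‖e x‖ₑ := by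
              conv_rhs => rw [← ENNReal.rpow_one ‖e x‖ₑ, ← ENNReal.rpow_mul, one_mul]
              rw [← ENNReal.rpow_add_of_nonneg _ _ (by linarith) (by norm_num)]
              congr 1; ring
            rw [this]
            gcongr
            exact g2 x
        _ = B ^ (s - 1) * lf (fun x => β (x - r) * (E x * ft volume χ (x - r))) := by
            rw [lintegral_const_mul' _ _ (ENNReal.rpow_lt_top_of_nonneg (by linarith) hBt.ne).ne, lf]
        _ ≤ _ := by rw [mul_assoc]; gcongr
    refine (ENNReal.rpow_le_rpow k1 (by positivity)).trans ?_
    rw [ENNReal.mul_rpow_of_nonneg _ _ (by positivity : 0 ≤ 1 / s)]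
    gcongr
    have hp1 : 0 < t ^ (-(2 * (Module.finrank ℝ V : ℝ) / m)) := by positivity
    rw [ENNReal.ofReal_add hp1.le (by norm_num)]
    refine (ENNReal.rpow_add_le_add_rpow _ _ (by positivity) ((div_le_one hs0).mpr hs1)).trans ?_
    rw [ENNReal.ofReal_add (by positivity) (by norm_num), ENNReal.ofReal_one, ENNReal.one_rpow,
      ENNReal.ofReal_rpow_of_pos hp1, ← Real.rpow_mul ht.le]
    rw [show -(2 * (Module.finrank ℝ V : ℝ) / m) * (1 / s) = -(2 * Module.finrank ℝ V / (m * s)) by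
      field_simp]

end Kernel

/-! ### The operator bound -/
section Operator
open Topology FourierTransform

variable {V : Type*} [NormedAddCommGroup V] [InnerProductSpace ℝ V] [FiniteDimensional ℝ V]
  [MeasurableSpace V] [BorelSpace V]

/-- Convolution of `E` against `v w dρ`. -/
def Tp (E : V → ℂ) (ρ : Measure V) (w v : V → ℂ) (x : V) : ℂ := ∫ y, E (x - y) * v y * w y ∂ρ

section
variable {ρ : Measure V} [IsFiniteMeasure ρ] {w : V → ℂ}

lemma Tp_bound (hwm : Measurable w) (hw1 : ∀ y, ‖w y‖ ≤ 1)
    {E v : V → ℂ} {M M' : ℝ} (hM : ∀ x, ‖E x‖ ≤ M) (hM' : ∀ x, ‖v x‖ ≤ M') (x y : V) :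
    ‖E (x - y) * v y * w y‖ ≤ M * M' := by
  have h0 : 0 ≤ M := (norm_nonneg _).trans (hM 0)
  have h0' : 0 ≤ M' := (norm_nonneg _).trans (hM' 0)
  rw [norm_mul, norm_mul]
  calc _ ≤ M * M' * 1 := by
        gcongr
        · exact hM _
        · exact hM' _
        · exact hw1 _
    _ = _ := mul_one _

lemma Tp_integrable (hwm : Measurable w) (hw1 : ∀ y, ‖w y‖ ≤ 1)
    {E v : V → ℂ} (hE : BC E) (hv : BC v) (x : V) :
    Integrable (fun y => E (x - y) * v y * w y) ρ := by
  obtain ⟨M, hM⟩ := hE.2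
  obtain ⟨M', hM'⟩ := hv.2
  refine Integrable.of_bound (C := M * M') ?_ (Filter.Eventually.of_forall fun y => Tp_bound hwm hw1 hM hM' x y)
  exact (((hE.1.comp (continuous_const.sub continuous_id)).mul hv.1).measurable.mul hwm).aestronglyMeasurable

lemma Tp_BC (hwm : Measurable w) (hw1 : ∀ y, ‖w y‖ ≤ 1)
    {E v : V → ℂ} (hE : BC E) (hv : BC v) : BC (Tp E ρ w v) := by
  obtain ⟨M, hM⟩ := hE.2
  obtain ⟨M', hM'⟩ := hv.2
  constructor
  · refine continuous_of_dominated (bound := fun _ => M * M')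
      (fun x => (Tp_integrable hwm hw1 hE hv x).aestronglyMeasurable)
      (fun x => Filter.Eventually.of_forall fun y => Tp_bound hwm hw1 hM hM' x y)
      (integrable_const _) (Filter.Eventually.of_forall fun y => ?_)
    exact ((hE.1.comp (continuous_id.sub continuous_const)).mul continuous_const).mul continuous_const
  · refine ⟨M * M' * ρ.real Set.univ, fun x => ?_⟩
    exact norm_integral_le_of_norm_le_const (Filter.Eventually.of_forall fun y => Tp_bound hwm hw1 hM hM' x y)
end

lemma ift_conv {ρ : Measure V} [SFinite ρ] {a G : V → ℂ} (ha : Integrable a) (hG : Integrable G ρ) (x : V) :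
    ∫ y, ift a (x - y) * G y ∂ρ = ift (fun ξ => a ξ * ft ρ G ξ) x := by
  have h1 : ∀ y, ift a (x - y) * G y = ∫ ξ, chr (⟪x - y, ξ⟫) * (G y * a ξ) := by
    intro y
    rw [ift, ← integral_mul_const]
    congr 1; ext ξ; ring
  simp_rw [h1]
  rw [integral_integral_swap]
  · rw [ift]
    congr 1; ext ξ
    rw [ft, ← integral_const_mul, ← integral_const_mul]
    congr 1; ext y
    rw [inner_sub_left, sub_eq_add_neg, chr_add]; ring
  · refine integrable_chr_mul (hG.mul_prod ha) ?_
    exact Measurable.aemeasurable (by fun_prop)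

lemma prod_int {ρ : Measure V} [IsFiniteMeasure ρ] (κ : SchwartzMap V ℂ) {g : V → ℂ} (hg : Integrable g ρ) :
    Integrable (fun p : V × V => κ (p.2 - p.1) * g p.2) ((volume : Measure V).prod ρ) := by
  have hm : AEStronglyMeasurable (fun p : V × V => κ (p.2 - p.1) * g p.2) ((volume : Measure V).prod ρ) :=
    (κ.continuous.comp (continuous_snd.sub continuous_fst)).aestronglyMeasurable.mul
      (hg.aestronglyMeasurable.comp_quasiMeasurePreserving Measure.quasiMeasurePreserving_snd)
  rw [integrable_prod_iff' hm]
  constructor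
  · refine Filter.Eventually.of_forall fun y => ?_
    exact ((κ.integrable (μ := volume)).comp_sub_left y).mul_const (g y)
  · simp only [norm_mul]
    simp_rw [integral_mul_const]
    have : ∀ y, ∫ x, ‖κ (y - x)‖ = ∫ x, ‖κ x‖ := fun y =>
      integral_sub_left_eq_self (fun x => ‖κ x‖) volume y
    simp_rw [this]
    exact hg.norm.const_mul _

lemma holder_lint {f g : V → ℂ} (hf : AEStronglyMeasurable f) (hg : AEStronglyMeasurable g) {p p' : ℝ≥0∞}
    (hpp' : 1 / p + 1 / p' = 1) : ∫⁻ ξ, ‖f ξ‖ₑ * ‖g ξ‖ₑ ≤ eLpNorm f p' volume * eLpNorm g p volume := by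
  have : ENNReal.HolderTriple p' p 1 := ⟨by simpa [add_comm] using hpp'⟩
  have := eLpNorm_smul_le_mul_eLpNorm (p := p') (q := p) (r := 1) hg hf
  rw [eLpNorm_one_eq_lintegral_enorm] at this
  simpa [enorm_mul] using this

section
variable {ρ : Measure V} [IsFiniteMeasure ρ] {w : V → ℂ}
  {c κ κ0 b : SchwartzMap V ℂ} {p p' : ℝ≥0∞} {E : V → ℂ} {e : V → V → ℂ} {D : ℝ≥0∞} {v : V → ℂ}

lemma op_core_z (hwm : Measurable w) (hw1 : ∀ y, ‖w y‖ ≤ 1)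
    (hb : ∀ y, κ0 y = b y * c y) (hpp' : 1 / p + 1 / p' = 1)
    (hE : BC E) (hei : ∀ r, Integrable (e r))
    (hloc : ∀ r x y, κ x ≠ 0 → κ0 y ≠ 0 → ift (e r) (x - y + r) = E (x - y + r))
    (hD : ∀ r, eLpNorm (e r) p' volume ≤ D) (hv : BC v) (hvN : Nw b v < ⊤)
    (x0 z : V) :
    lf (fun x => κ (x - x0) * ∫ y, E (x - y) * κ0 (y - z) * v y * w y ∂ρ) ≤
      lf κ * (Nw b v * (D * eLpNorm (ft ρ (fun y => c (y - z) * w y)) p volume)) := by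
  set r := x0 - z with hr
  set G : V → ℂ := fun y => (v y * b (y - z)) * (c (y - z) * w y) with hG
  have hsub : Continuous (fun y : V => y - z) := continuous_id.sub continuous_const
  have hcw : Integrable (fun y => c (y - z) * w y) ρ := by
    obtain ⟨M, hM⟩ : ∃ M, ∀ x, ‖c x‖ ≤ M := by
      obtain ⟨C, hC⟩ := c.decay 0 0
      exact ⟨C, fun x => by simpa using hC.2 x⟩
    refine Integrable.of_bound (C := M) ((c.continuous.comp hsub).measurable.mul hwm).aestronglyMeasurable
      (Filter.Eventually.of_forall fun y => ?_)
    rw [norm_mul]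
    exact (mul_le_of_le_one_right (norm_nonneg _) (hw1 y)).trans (hM _)
  have hbBC : BC (fun y => v y * b (y - z)) := by
    obtain ⟨C, hC⟩ := b.decay 0 0
    obtain ⟨M, hM⟩ := hv.2
    refine ⟨hv.1.mul (b.continuous.comp hsub), M * C, fun x => ?_⟩
    rw [norm_mul]
    have := hC.2 (x - z)
    simp only [pow_zero, one_mul, norm_iteratedFDeriv_zero] at this
    exact mul_le_mul (hM x) this (norm_nonneg _) ((norm_nonneg _).trans (hM x))
  have hGi : Integrable G ρ := hbBC.mul_integrable hcw
  have h1 : (fun x => κ (x - x0) * ∫ y, E (x - y) * κ0 (y - z) * v y * w y ∂ρ) =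
      fun x => ift (fun ξ => e r ξ * ft ρ G ξ) x * κ (x - x0) := by
    ext x
    rw [mul_comm]
    by_cases hx : κ (x - x0) = 0
    · simp [hx]
    congr 1
    rw [← ift_conv (hei r) hGi]
    refine integral_congr_ae (Filter.Eventually.of_forall fun y => ?_)
    simp only [hG]
    by_cases hy : κ0 (y - z) = 0
    · have h2 := hb (y - z)
      rw [hy] at h2
      have h3 : v y * b (y - z) * (c (y - z) * w y) = 0 := by
        linear_combination - v y * w y * h2
      rw [h3, hy]; ring
    · have h2 := hloc r _ _ hx hy
      rw [show x - x0 - (y - z) + r = x - y by rw [hr]; abel] at h2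
      rw [h2, hb]; ring
  have hAi : Integrable (fun ξ => e r ξ * ft ρ G ξ) := by
    have := (hei r).bdd_mul (c := ∫ y, ‖G y‖ ∂ρ) (continuous_ft hGi).aestronglyMeasurable
      (Filter.Eventually.of_forall fun ξ => norm_ft_le G ξ)
    simpa only [mul_comm] using this
  rw [h1]
  refine (lf_ift_mul_le hAi (schwartz_sub_integrable κ x0)).trans ?_
  rw [lf_translate, mul_comm]
  gcongr
  have hvi : Integrable (fun y => v y * b (y - z)) := hv.mul_integrable (schwartz_sub_integrable b z)
  have hvl : lf (fun y => v y * b (y - z)) < ⊤ := (lf_le_Nw b v z).trans_lt hvN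
  have h2 : ∀ ξ, ft ρ G ξ = ∫ η, ft volume (fun y => v y * b (y - z)) η *
      ft ρ (fun y => c (y - z) * w y) (ξ - η) := by
    intro ξ
    rw [← ft_mul (integrable_ft_of_lf hvi hvl) hcw, ift_ft hbBC.1 hvi hvl]
  simp_rw [enorm_mul, h2]
  refine (lintegral_conv_le (B := D * eLpNorm (ft ρ (fun y => c (y - z) * w y)) p volume)
    (continuous_ft hvi).aestronglyMeasurable (continuous_ft hcw) (hei r).aestronglyMeasurable ?_).trans ?_
  · intro η
    have hm := (continuous_ft hcw).aestronglyMeasurable (μ := volume)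
    have hmp := measurePreserving_sub_right (volume : Measure V) η
    refine (holder_lint (hei r).aestronglyMeasurable
      (g := fun ξ => ft ρ (fun y => c (y - z) * w y) (ξ - η)) ?_ hpp').trans ?_
    · exact ((continuous_ft hcw).comp (continuous_id.sub continuous_const)).aestronglyMeasurable
    · refine mul_le_mul' (hD r) (le_of_eq ?_)
      exact eLpNorm_comp_measurePreserving hm hmp
  · gcongr
    exact lf_le_Nw b v z

lemma op_core (hwm : Measurable w) (hw1 : ∀ y, ‖w y‖ ≤ 1)
    (hb : ∀ y, κ0 y = b y * c y) (hpp' : 1 / p + 1 / p' = 1)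
    (hE : BC E) (hei : ∀ r, Integrable (e r))
    (hloc : ∀ r x y, κ x ≠ 0 → κ0 y ≠ 0 → ift (e r) (x - y + r) = E (x - y + r))
    (hD : ∀ r, eLpNorm (e r) p' volume ≤ D) (hv : BC v) (hvN : Nw b v < ⊤)
    (hκ0 : ∫ z, κ0 z = 1) (hDt : D < ⊤) :
    Nw κ (Tp E ρ w v) ≤
      lf κ * (Nw b v * (D * ∫⁻ z, eLpNorm (ft ρ (fun y => c (y - z) * w y)) p volume)) := by
  refine iSup_le fun x0 => ?_
  obtain ⟨M, hM⟩ := hE.2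
  obtain ⟨M', hM'⟩ := hv.2
  have hM0 : 0 ≤ M := (norm_nonneg _).trans (hM 0)
  have hM0' : 0 ≤ M' := (norm_nonneg _).trans (hM' 0)
  set F : V → V → ℂ := fun z x => κ (x - x0) * ∫ y, E (x - y) * κ0 (y - z) * v y * w y ∂ρ with hF
  have h1 : ∀ x, Tp E ρ w v x * κ (x - x0) = ∫ z, F z x := by
    intro x
    simp only [hF]
    rw [integral_const_mul, mul_comm]
    congr 1
    have hi := prod_int κ0 (Tp_integrable (ρ := ρ) hwm hw1 hE hv x)
    have e1 : ∀ z y, E (x - y) * κ0 (y - z) * v y * w y = κ0 (y - z) * (E (x - y) * v y * w y) := by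
      intros; ring
    simp_rw [e1]
    rw [integral_integral_swap hi, Tp]
    congr 1; ext y
    rw [integral_mul_const, integral_sub_left_eq_self (fun z => κ0 z) volume y, hκ0, one_mul]
  have h2 : Integrable (Function.uncurry F) ((volume : Measure V).prod volume) := by
    have hk : Integrable (fun z => ∫ y, ‖κ0 (y - z)‖ ∂ρ) := by
      have := (prod_int (ρ := ρ) κ0 (integrable_const (1 : ℂ))).norm.integral_prod_left
      simpa using this
    have hmaj := hk.mul_prod ((schwartz_sub_integrable κ x0).norm.mul_const (M * M'))
    refine hmaj.mono' ?_ ?_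
    · have hmeas : Measurable (fun q : (V × V) × V =>
          E (q.1.2 - q.2) * κ0 (q.2 - q.1.1) * v q.2 * w q.2) := by
        have := hE.1.measurable; have := κ0.continuous.measurable; have := hv.1.measurable
        fun_prop
      have hIntg : StronglyMeasurable (fun q : V × V =>
          ∫ y, E (q.2 - y) * κ0 (y - q.1) * v y * w y ∂ρ) :=
        hmeas.stronglyMeasurable.integral_prod_right'
      have hκm : StronglyMeasurable (fun q : V × V => κ (q.2 - x0)) :=
        (κ.continuous.comp (continuous_snd.sub continuous_const)).stronglyMeasurable
      exact (hκm.mul hIntg).aestronglyMeasurable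
    · refine Filter.Eventually.of_forall fun q => ?_
      obtain ⟨z, x⟩ := q
      simp only [Function.uncurry, hF]
      rw [norm_mul]
      have : ‖∫ y, E (x - y) * κ0 (y - z) * v y * w y ∂ρ‖ ≤ ∫ y, ‖κ0 (y - z)‖ * (M * M') ∂ρ := by
        refine norm_integral_le_of_norm_le ?_ (Filter.Eventually.of_forall fun y => ?_)
        · refine Integrable.mul_const ?_ _
          obtain ⟨C, hC⟩ := κ0.decay 0 0
          refine Integrable.of_bound (C := C) ((κ0.continuous.comp
            (continuous_id.sub continuous_const)).norm.aestronglyMeasurable) (Filter.Eventually.of_forall fun y => ?_)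
          have := hC.2 (y - z)
          simp only [pow_zero, one_mul, norm_iteratedFDeriv_zero] at this
          simpa using this
        · have e1 : E (x - y) * κ0 (y - z) * v y * w y = κ0 (y - z) * (E (x - y) * v y * w y) := by ring
          rw [e1, norm_mul]
          gcongr
          exact Tp_bound hwm hw1 hM hM' x y
      rw [integral_mul_const] at this
      calc _ ≤ ‖κ (x - x0)‖ * ((∫ y, ‖κ0 (y - z)‖ ∂ρ) * (M * M')) := by gcongr
        _ = _ := by ring
  simp_rw [h1]
  refine (lf_integral_le h2).trans ?_
  rw [← lintegral_const_mul' _ _ hDt.ne, ← lintegral_const_mul' _ _ hvN.ne,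
    ← lintegral_const_mul' _ _ (lf_schwartz κ).ne]
  exact lintegral_mono fun z => op_core_z hwm hw1 hb hpp' hE hei hloc hD hv hvN x0 z

end

/-- The main operator estimate. -/
lemma Disp.op_bound {m : ℝ} {μ : V → ℝ} (H : Disp m μ) {ρ : Measure V} [IsFiniteMeasure ρ] {w : V → ℂ}
    (hwm : Measurable w) (hw1 : ∀ y, ‖w y‖ ≤ 1) {c : SchwartzMap V ℂ} (hc : c 0 ≠ 0)
    {p p' : ℝ≥0∞} (hpp' : 1 / p + 1 / p' = 1) (hp' : 1 ≤ p')
    (hν : ∫⁻ z, eLpNorm (ft ρ (fun y => c (y - z) * w y)) p volume < ⊤) :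
    ∃ C : ℝ≥0∞, C < ⊤ ∧ ∀ t : ℝ, 0 < t → ∀ E : V → ℂ, IsKer μ t E → ∀ v : V → ℂ, BC v → Nw c v < ⊤ →
      Nw c (Tp E ρ w v) ≤
        C * ENNReal.ofReal (t ^ (-(2 * Module.finrank ℝ V / (m * p'.toReal))) + 1) * Nw c v := by
  obtain ⟨χ, hχ1, hχ2, -, -, hχ3, -⟩ := exists_bump (V := V) (1 / 4) (by norm_num)
  set θ : SchwartzMap V ℂ := 𝓕 χ with hθ
  have hθ1 : ft volume χ = θ := by rw [ft_eq_fourier, hθ, SchwartzMap.fourier_coe]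
  have hθ0 : θ 0 ≠ 0 := by
    rw [← hθ1, ft]; simpa [chr_zero] using hχ3
  obtain ⟨κ, κ0, b, q, β, hκ, hκ0, hb, hq, hβ⟩ := exists_windows c θ hc hθ0
  obtain ⟨C₁, hC₁, h1⟩ := H.kernel_bound χ hχ1 β p' hp'
  obtain ⟨C₂, hC₂, h2⟩ := Nw_large κ c hκ
  set N := ∫⁻ z, eLpNorm (ft ρ (fun y => c (y - z) * w y)) p volume with hN
  refine ⟨C₂ * lf κ * lf q * C₁ * N, ?_, fun t ht E hE v hv hvN => ?_⟩
  · exact ENNReal.mul_lt_top (ENNReal.mul_lt_top (ENNReal.mul_lt_top (ENNReal.mul_lt_top hC₂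
      (lf_schwartz _)) (lf_schwartz _)) hC₁) hν
  refine (h2 _ (Tp_BC hwm hw1 hE.1 hv)).trans ?_
  set D := C₁ * ENNReal.ofReal (t ^ (-(2 * Module.finrank ℝ V / (m * p'.toReal))) + 1) with hD
  have hbN : Nw b v ≤ lf q * Nw c v := Nw_small q c b hq hv
  have hbt : Nw b v < ⊤ := hbN.trans_lt (ENNReal.mul_lt_top (lf_schwartz q) hvN)
  have hfi : ∀ r, Integrable (fun x => β (x - r) * (E x * ft volume χ (x - r))) := by
    intro r
    rw [hθ1]
    have hβBC : BC (fun x => β (x - r)) := by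
      obtain ⟨C, hC⟩ := β.decay 0 0
      refine ⟨β.continuous.comp (continuous_id.sub continuous_const), C, fun x => ?_⟩
      have := hC.2 (x - r)
      simpa only [pow_zero, one_mul, norm_iteratedFDeriv_zero] using this
    exact hβBC.mul_integrable (hE.1.mul_integrable (schwartz_sub_integrable θ r))
  have key := op_core (ρ := ρ) (κ := κ) (e := fun r => ft volume (fun x => β (x - r) * (E x * ft volume χ (x - r))))
    hwm hw1 hb hpp' hE.1 (fun r => integrable_ft_of_lf (hfi r) (h1 t ht E hE r).1)
    (by
      intro r x y hx hy
      have hs : Continuous (fun x : V => x - r) := continuous_id.sub continuous_const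
      rw [ift_ft ?_ (hfi r) (h1 t ht E hE r).1]
      · simp only [add_sub_cancel_right]
        rw [hθ1]
        linear_combination E (x - y + r) * hβ x y hx hy
      · rw [hθ1]
        exact (β.continuous.comp hs).mul (hE.1.1.mul (θ.continuous.comp hs)))
    (fun r => (h1 t ht E hE r).2) hv hbt hκ0 (ENNReal.mul_lt_top hC₁ ENNReal.ofReal_lt_top)
  calc C₂ * Nw κ (Tp E ρ w v) ≤ C₂ * (lf κ * ((lf q * Nw c v) * (D * N))) := by
        gcongr
        refine key.trans ?_
        gcongr
    _ = _ := by rw [hD]; ring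

end Operator

/-! ### Abstract Volterra equation -/
section Volterra
open Topology FourierTransform

variable {V : Type*} [NormedAddCommGroup V] [InnerProductSpace ℝ V] [FiniteDimensional ℝ V]
  [MeasurableSpace V] [BorelSpace V]

/-- Data for the Volterra equation: an operator-valued kernel with an integrable norm bound. -/
structure Vol (c : SchwartzMap V ℂ) (K : ℝ → V → ℂ) (ρ : Measure V) (w : V → ℂ)
    (k : ℝ → ℝ≥0∞) (lam : ℝ) : Prop where
  c0 : c 0 ≠ 0
  Km : Measurable (Function.uncurry K)
  KBC : ∀ τ, 0 < τ → BC (K τ)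
  wm : Measurable w
  w1 : ∀ y, ‖w y‖ ≤ 1
  km : Measurable k
  kint : ∀ T, ∫⁻ τ in Set.Ioo 0 T, k τ < ⊤
  lam0 : 0 ≤ lam
  klam : ENNReal.ofReal (2 * π) * ∫⁻ τ in Set.Ioi 0, k τ * ENNReal.ofReal (Real.exp (-(lam * τ))) ≤ 2⁻¹
  bd : ∀ τ, 0 < τ → ∀ v, BC v → Nw c v < ⊤ → Nw c (Tp (K τ) ρ w v) ≤ k τ * Nw c v

variable {c : SchwartzMap V ℂ} {K : ℝ → V → ℂ} {ρ : Measure V} [IsFiniteMeasure ρ] {w : V → ℂ}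
  {k : ℝ → ℝ≥0∞} {lam : ℝ}

lemma Vol.meas (H : Vol c K ρ w k lam) {v : ℝ → V → ℂ} (hv : Measurable (Function.uncurry v)) :
    StronglyMeasurable (fun z : ℝ × V => Tp (K z.1) ρ w (v z.1) z.2) := by
  unfold Tp
  refine StronglyMeasurable.integral_prod_right' (f := fun q : (ℝ × V) × V =>
    K q.1.1 (q.1.2 - q.2) * v q.1.1 q.2 * w q.2) ?_
  refine Measurable.stronglyMeasurable ?_
  have h1 : Measurable (fun q : (ℝ × V) × V => Function.uncurry K (q.1.1, q.1.2 - q.2)) :=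
    H.Km.comp (by fun_prop)
  have h2 : Measurable (fun q : (ℝ × V) × V => Function.uncurry v (q.1.1, q.2)) :=
    hv.comp (by fun_prop)
  exact (h1.mul h2).mul (H.wm.comp measurable_snd)

lemma Vol.D0 (H : Vol c K ρ w k lam) {S : Set ℝ} (hS : MeasurableSet S) (hS0 : S ⊆ Set.Ioi 0)
    {v : ℝ → V → ℂ} (hv : Measurable (Function.uncurry v)) (hBC : ∀ τ ∈ S, BC (v τ))
    {B : ℝ → ℝ≥0∞} (hB : Measurable B) (hN : ∀ τ ∈ S, Nw c (v τ) ≤ B τ) (hBt : ∀ τ ∈ S, B τ < ⊤)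
    (hIntg : ∫⁻ τ in S, k τ * B τ < ⊤) :
    (∀ x, IntegrableOn (fun τ => Tp (K τ) ρ w (v τ) x) S) ∧
    BC (fun x => ∫ τ in S, Tp (K τ) ρ w (v τ) x) ∧
    Nw c (fun x => ∫ τ in S, Tp (K τ) ρ w (v τ) x) ≤ ∫⁻ τ in S, k τ * B τ := by
  have hm := H.meas hv
  have hc0 : ‖c 0‖ₑ ≠ 0 := by simpa using H.c0
  have hct : ‖c 0‖ₑ ≠ ⊤ := enorm_ne_top
  set b : ℝ → ℝ≥0∞ := fun τ => k τ * B τ * ‖c 0‖ₑ⁻¹ with hb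
  have hbi : ∫⁻ τ in S, b τ ≠ ⊤ := by
    rw [hb, lintegral_mul_const' _ _ (by simpa using hc0)]
    exact ENNReal.mul_ne_top hIntg.ne (by simpa using hc0)
  have hbm : Measurable b := (H.km.mul hB).mul_const _
  have hNw : ∀ τ ∈ S, Nw c (Tp (K τ) ρ w (v τ)) ≤ k τ * B τ := fun τ hτ =>
    (H.bd τ (hS0 hτ) _ (hBC τ hτ) ((hN τ hτ).trans_lt (hBt τ hτ))).trans (by gcongr; exact hN τ hτ)
  have hTB : ∀ τ ∈ S, BC (Tp (K τ) ρ w (v τ)) := fun τ hτ =>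
    Tp_BC H.wm H.w1 (H.KBC τ (hS0 hτ)) (hBC τ hτ)
  have hpt : ∀ τ ∈ S, ∀ x, ‖Tp (K τ) ρ w (v τ) x‖ₑ ≤ b τ := by
    intro τ hτ x
    have := (enorm_le_Nw c (hTB τ hτ) x).trans (hNw τ hτ)
    rw [hb]
    simp only
    rw [← div_eq_mul_inv, ENNReal.le_div_iff_mul_le (Or.inl hc0) (Or.inl hct)]
    exact this
  have hbr : Integrable (fun τ => (b τ).toReal) (volume.restrict S) :=
    integrable_toReal_of_lintegral_ne_top hbm.aemeasurable hbi
  have hfin : ∀ᵐ τ ∂(volume.restrict S), b τ < ⊤ := ae_lt_top hbm hbi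
  have hae : ∀ᵐ τ ∂(volume.restrict S), ∀ x, ‖Tp (K τ) ρ w (v τ) x‖ ≤ (b τ).toReal := by
    filter_upwards [hfin, ae_restrict_mem hS] with τ h1 h2 x
    have := hpt τ h2 x
    rw [← ofReal_norm] at this
    exact (ENNReal.ofReal_le_iff_le_toReal h1.ne).1 this
  have hmx : ∀ x, AEStronglyMeasurable (fun τ => Tp (K τ) ρ w (v τ) x) (volume.restrict S) :=
    fun x => (hm.comp_measurable (measurable_id.prodMk measurable_const)).aestronglyMeasurable
  have hI : ∀ x, IntegrableOn (fun τ => Tp (K τ) ρ w (v τ) x) S := fun x =>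
    hbr.mono' (hmx x) (hae.mono fun τ h => h x)
  have hBCi : BC (fun x => ∫ τ in S, Tp (K τ) ρ w (v τ) x) := by
    refine ⟨continuous_of_dominated hmx (fun x => hae.mono fun τ h => h x) hbr ?_,
      ∫ τ in S, (b τ).toReal, fun x => norm_integral_le_of_norm_le hbr (hae.mono fun τ h => h x)⟩
    filter_upwards [ae_restrict_mem hS] with τ h2 using (hTB τ h2).1
  refine ⟨hI, hBCi, iSup_le fun x0 => ?_⟩
  simp_rw [← integral_mul_const]
  have hci := schwartz_sub_integrable c x0
  refine (lf_integral_le (Φ := fun τ y => Tp (K τ) ρ w (v τ) y * c (y - x0)) ?_).trans ?_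
  · refine (hbr.mul_prod hci.norm).mono' ?_ ?_
    · exact (hm.mul (c.continuous.measurable.comp (measurable_snd.sub_const x0)).stronglyMeasurable).aestronglyMeasurable
    · have := (Measure.quasiMeasurePreserving_fst (μ := volume.restrict S) (ν := (volume : Measure V))).ae hae
      filter_upwards [this] with z hz
      simp only [Function.uncurry, norm_mul]
      gcongr
      exact hz _
  · refine lintegral_mono_ae ?_
    filter_upwards [ae_restrict_mem hS] with τ h2
    exact (lf_le_Nw _ _ _).trans (hNw τ h2)

end Volterra

/-! ### Continuous curves in the window norm -/
section Curves
open Topology FourierTransform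

variable {V : Type*} [NormedAddCommGroup V] [InnerProductSpace ℝ V] [FiniteDimensional ℝ V]
  [MeasurableSpace V] [BorelSpace V]

lemma Nw_zero (c : V → ℂ) : Nw c (fun _ => 0) = 0 := by
  have := Nw_const_mul c 0 (fun _ => (0 : ℂ))
  simpa using this

lemma BC.zero : BC (fun _ : V => (0 : ℂ)) := ⟨continuous_const, 0, by simp⟩

/-- Bounded continuous functions, with the extended distance induced by the window norm. -/
structure BCs (c : SchwartzMap V ℂ) where
  /-- the underlying function -/
  fn : V → ℂ
  bc : BC fn

instance (c : SchwartzMap V ℂ) : PseudoEMetricSpace (BCs c) where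
  edist u v := Nw c (fun x => u.fn x - v.fn x)
  edist_self u := by simp [Nw_zero]
  edist_comm u v := Nw_sub_comm c _ _
  edist_triangle u v z := by
    have := Nw_add_le c (u.bc.sub v.bc) (v.bc.sub z.bc)
    simpa using this

lemma BCs.edist_def {c : SchwartzMap V ℂ} (u v : BCs c) :
    edist u v = Nw c (fun x => u.fn x - v.fn x) := rfl

lemma BCs.continuous_eval {c : SchwartzMap V ℂ} (hc : c 0 ≠ 0) (x : V) :
    Continuous (fun u : BCs c => u.fn x) := by
  have hc0 : ‖c 0‖₊ ≠ 0 := by simpa using hc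
  refine LipschitzWith.continuous (K := ‖c 0‖₊⁻¹) fun u v => ?_
  rw [BCs.edist_def, ENNReal.coe_inv hc0, mul_comm, ← div_eq_mul_inv,
    ENNReal.le_div_iff_mul_le (Or.inl (by simpa using hc)) (Or.inl ENNReal.coe_ne_top), edist_eq_enorm_sub]
  exact enorm_le_Nw c (u.bc.sub v.bc) x

/-- Continuous curves. -/
structure WC (c : SchwartzMap V ℂ) (u : ℝ → V → ℂ) : Prop where
  bc : ∀ t, BC (u t)
  fin : ∀ t, Nw c (u t) < ⊤
  cont : Continuous (fun t => (⟨u t, bc t⟩ : BCs c))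

variable {c : SchwartzMap V ℂ} {u v : ℝ → V → ℂ}

lemma WC.meas (hu : WC c u) (hc : c 0 ≠ 0) : Measurable (Function.uncurry u) := by
  have := measurable_uncurry_of_continuous_of_measurable (u := fun (x : V) (t : ℝ) => u t x)
    (fun t => (hu.bc t).1) (fun x => ((BCs.continuous_eval hc x).comp hu.cont).measurable)
  exact this.comp measurable_swap

lemma WC.bdd (hu : WC c u) (a b : ℝ) : ∃ M : ℝ≥0∞, M < ⊤ ∧ ∀ t ∈ Set.Icc a b, Nw c (u t) ≤ M := by
  have hcont : Continuous (fun t => Nw c (u t)) := by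
    have := hu.cont.edist (continuous_const (y := (⟨_, BC.zero⟩ : BCs c)))
    simpa [BCs.edist_def] using this
  rcases (Set.Icc a b).eq_empty_or_nonempty with h | h
  · exact ⟨0, by simp, by simp [h]⟩
  · obtain ⟨t, -, ht⟩ := isCompact_Icc.exists_isMaxOn h hcont.continuousOn
    exact ⟨_, hu.fin t, ht⟩

lemma WC.unif (hu : WC c u) (a b : ℝ) {ε : ℝ≥0∞} (hε : 0 < ε) : ∃ δ : ℝ, 0 < δ ∧
    ∀ s ∈ Set.Icc a b, ∀ t ∈ Set.Icc a b, |s - t| < δ → Nw c (fun x => u s x - u t x) < ε := by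
  have h := isCompact_Icc.uniformContinuousOn_of_continuous (hu.cont.continuousOn (s := Set.Icc a b))
  rw [EMetric.uniformContinuousOn_iff] at h
  obtain ⟨δ, hδ, h⟩ := h ε hε
  obtain ⟨δ', h1, h2⟩ := ENNReal.lt_iff_exists_nnreal_btwn.1 hδ
  refine ⟨δ', by exact_mod_cast h1, fun s hs t ht hst => h hs ht ?_⟩
  refine lt_trans ?_ h2
  rw [edist_dist, Real.dist_eq]
  have h3 : ENNReal.ofReal |s - t| < ENNReal.ofReal δ' := by
    rwa [ENNReal.ofReal_lt_ofReal_iff (by exact_mod_cast h1)]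
  simpa using h3

lemma WC.mk' (bc : ∀ t, BC (u t)) (fin : ∀ t, Nw c (u t) < ⊤)
    (h : ∀ t, ∀ ε : ℝ≥0∞, 0 < ε → ∃ δ : ℝ, 0 < δ ∧ ∀ s, |s - t| < δ → Nw c (fun x => u s x - u t x) ≤ ε) :
    WC c u := by
  refine ⟨bc, fin, continuous_iff_continuousAt.2 fun t => ?_⟩
  rw [ContinuousAt, EMetric.tendsto_nhds]
  intro ε hε
  obtain ⟨ε', h1, h2⟩ := exists_between hε
  obtain ⟨δ, hδ, h⟩ := h t ε' h1
  filter_upwards [Metric.ball_mem_nhds t hδ] with s hs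
  exact (h s (by simpa [Real.dist_eq] using hs)).trans_lt h2

lemma WC.at' (hu : WC c u) (t : ℝ) {ε : ℝ≥0∞} (hε : 0 < ε) :
    ∃ δ : ℝ, 0 < δ ∧ ∀ s, |s - t| < δ → Nw c (fun x => u s x - u t x) ≤ ε := by
  obtain ⟨δ, hδ, h⟩ := hu.unif (t - 1) (t + 1) hε
  refine ⟨min δ 1, by positivity, fun s hs => (h s ?_ t ?_ (hs.trans_le (min_le_left _ _))).le⟩
  · have := abs_lt.1 (hs.trans_le (min_le_right _ _))
    constructor <;> linarith
  · constructor <;> linarith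

lemma WC.add (hu : WC c u) (hv : WC c v) : WC c (fun t x => u t x + v t x) := by
  refine WC.mk' (fun t => (hu.bc t).add (hv.bc t)) (fun t =>
    (Nw_add_le c (hu.bc t) (hv.bc t)).trans_lt (ENNReal.add_lt_top.2 ⟨hu.fin t, hv.fin t⟩)) ?_
  intro t ε hε
  obtain ⟨δ, h1, h2⟩ := hu.at' t (ENNReal.half_pos hε.ne')
  obtain ⟨δ', h1', h2'⟩ := hv.at' t (ENNReal.half_pos hε.ne')
  refine ⟨min δ δ', by positivity, fun s hs => ?_⟩
  have := Nw_add_le c ((hu.bc s).sub (hu.bc t)) ((hv.bc s).sub (hv.bc t))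
  have h3 := this.trans (add_le_add (h2 s (hs.trans_le (min_le_left _ _))) (h2' s (hs.trans_le (min_le_right _ _))))
  rw [ENNReal.add_halves] at h3
  simp_rw [add_sub_add_comm]
  exact h3

lemma WC.const_mul (hu : WC c u) (a : ℂ) : WC c (fun t x => a * u t x) := by
  refine WC.mk' (fun t => (hu.bc t).const_mul a) (fun t => ?_) ?_
  · rw [Nw_const_mul]; exact ENNReal.mul_lt_top enorm_lt_top (hu.fin t)
  intro t ε hε
  obtain ⟨η, hη, h⟩ := ENNReal.exists_nnreal_pos_mul_lt (a := ‖a‖ₑ) (enorm_ne_top) hε.ne'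
  obtain ⟨δ, h1, h2⟩ := hu.at' t (ε := η) (by exact_mod_cast hη)
  refine ⟨δ, h1, fun s hs => ?_⟩
  simp_rw [← mul_sub]
  rw [Nw_const_mul, mul_comm]
  refine le_trans ?_ h.le
  gcongr
  exact h2 s hs

lemma WC.sub (hu : WC c u) (hv : WC c v) : WC c (fun t x => u t x - v t x) := by
  have := hu.add (hv.const_mul (-1))
  convert this using 3
  ring

end Curves

/-! ### The Duhamel operator -/
section Duhamel
open Topology FourierTransform

variable {V : Type*} [NormedAddCommGroup V] [InnerProductSpace ℝ V] [FiniteDimensional ℝ V]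
  [MeasurableSpace V] [BorelSpace V]

/-- The Duhamel operator. -/
def Du (K : ℝ → V → ℂ) (ρ : Measure V) (w : V → ℂ) (u : ℝ → V → ℂ) (t : ℝ) (x : V) : ℂ :=
  (2 * (Real.pi : ℂ)) * Complex.I * ∫ τ in Set.Ioo 0 t, Tp (K τ) ρ w (u (t - τ)) x

variable {c : SchwartzMap V ℂ} {K : ℝ → V → ℂ} {ρ : Measure V} [IsFiniteMeasure ρ] {w : V → ℂ}
  {k : ℝ → ℝ≥0∞} {lam : ℝ} {u v : ℝ → V → ℂ}

lemma Du_neg (u : ℝ → V → ℂ) {t : ℝ} (ht : t ≤ 0) : Du K ρ w u t = fun _ => 0 := by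
  funext x
  simp [Du, Set.Ioo_eq_empty (not_lt.2 ht)]

lemma enorm_two_pi_I : ‖(2 * (Real.pi : ℂ)) * Complex.I‖ₑ = ENNReal.ofReal (2 * π) := by
  rw [← ofReal_norm]
  simp [abs_of_pos Real.pi_pos]

lemma Tp_sub (hwm : Measurable w) (hw1 : ∀ y, ‖w y‖ ≤ 1) {E a b : V → ℂ} (hE : BC E) (ha : BC a) (hb : BC b) (x : V) :
    Tp E ρ w (fun y => a y - b y) x = Tp E ρ w a x - Tp E ρ w b x := by
  unfold Tp
  rw [← integral_sub (Tp_integrable hwm hw1 hE ha x) (Tp_integrable hwm hw1 hE hb x)]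
  congr 1
  funext y
  ring

lemma WC.shift_meas (hu : WC c u) (hc : c 0 ≠ 0) (t : ℝ) :
    Measurable (Function.uncurry fun τ => u (t - τ)) :=
  (hu.meas hc).comp (f := fun z : ℝ × V => (t - z.1, z.2)) (by fun_prop)

/-- Constant-bound version of `D0`. -/
lemma Vol.D1 (H : Vol c K ρ w k lam) {S : Set ℝ} (hS : MeasurableSet S) {T : ℝ} (hS0 : S ⊆ Set.Ioo 0 T)
    {v : ℝ → V → ℂ} (hv : Measurable (Function.uncurry v)) (hBC : ∀ τ ∈ S, BC (v τ))
    {M : ℝ≥0∞} (hM : M < ⊤) (hN : ∀ τ ∈ S, Nw c (v τ) ≤ M) :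
    (∀ x, IntegrableOn (fun τ => Tp (K τ) ρ w (v τ) x) S) ∧
    BC (fun x => ∫ τ in S, Tp (K τ) ρ w (v τ) x) ∧
    Nw c (fun x => ∫ τ in S, Tp (K τ) ρ w (v τ) x) ≤ (∫⁻ τ in S, k τ) * M := by
  rw [← lintegral_mul_const' _ _ hM.ne]
  refine H.D0 hS (hS0.trans fun τ h => h.1) hv hBC measurable_const hN (fun _ _ => hM) ?_
  rw [lintegral_mul_const' _ _ hM.ne]
  exact ENNReal.mul_lt_top ((lintegral_mono_set hS0).trans_lt (H.kint T)) hM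

lemma Vol.D_base (H : Vol c K ρ w k lam) (hu : WC c u) (t T : ℝ) {S : Set ℝ} (hS : MeasurableSet S)
    (hS0 : S ⊆ Set.Ioo 0 T) :
    (∀ x, IntegrableOn (fun τ => Tp (K τ) ρ w (u (t - τ)) x) S) ∧
    BC (fun x => ∫ τ in S, Tp (K τ) ρ w (u (t - τ)) x) ∧
    Nw c (fun x => ∫ τ in S, Tp (K τ) ρ w (u (t - τ)) x) < ⊤ := by
  obtain ⟨M, hM, hb⟩ := hu.bdd (t - T) t
  obtain ⟨h1, h2, h3⟩ := H.D1 hS hS0 (hu.shift_meas H.c0 t) (fun τ _ => hu.bc _) hM (fun τ hτ => hb _ (by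
    have := hS0 hτ
    constructor <;> linarith [this.1, this.2]))
  exact ⟨h1, h2, h3.trans_lt (ENNReal.mul_lt_top ((lintegral_mono_set hS0).trans_lt (H.kint T)) hM)⟩

lemma Vol.D_BC (H : Vol c K ρ w k lam) (hu : WC c u) (t : ℝ) : BC (Du K ρ w u t) :=
  (H.D_base hu t t measurableSet_Ioo subset_rfl).2.1.const_mul _

lemma Vol.D_fin (H : Vol c K ρ w k lam) (hu : WC c u) (t : ℝ) : Nw c (Du K ρ w u t) < ⊤ := by
  unfold Du
  rw [Nw_const_mul]
  exact ENNReal.mul_lt_top enorm_lt_top (H.D_base hu t t measurableSet_Ioo subset_rfl).2.2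

lemma Vol.D_sub (H : Vol c K ρ w k lam) (hu : WC c u) (hv : WC c v) (t : ℝ) (x : V) :
    Du K ρ w (fun t x => u t x - v t x) t x = Du K ρ w u t x - Du K ρ w v t x := by
  unfold Du
  rw [← mul_sub, ← integral_sub ((H.D_base hu t t measurableSet_Ioo subset_rfl).1 x)
    ((H.D_base hv t t measurableSet_Ioo subset_rfl).1 x)]
  congr 1
  refine setIntegral_congr_fun measurableSet_Ioo fun τ hτ => ?_
  exact Tp_sub H.wm H.w1 (H.KBC τ hτ.1) (hu.bc _) (hv.bc _) x

lemma Vol.D_diff (H : Vol c K ρ w k lam) (hu : WC c u) {t t' : ℝ} (htt : t ≤ t') (x : V) :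
    Du K ρ w u t' x - Du K ρ w u t x = (2 * (Real.pi : ℂ)) * Complex.I *
      ((∫ τ in Set.Ioo 0 t', Tp (K τ) ρ w (fun y => u (t' - τ) y - u (t - τ) y) x) +
      ∫ τ in Set.Ioo 0 t' \ Set.Ioo 0 t, Tp (K τ) ρ w (u (t - τ)) x) := by
  unfold Du
  rw [← mul_sub]
  congr 1
  have h1 := (H.D_base hu t' t' measurableSet_Ioo subset_rfl).1 x
  have h2 := (H.D_base hu t t' measurableSet_Ioo subset_rfl).1 x
  have hss : Set.Ioo 0 t ⊆ Set.Ioo 0 t' := Set.Ioo_subset_Ioo_right htt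
  rw [setIntegral_congr_fun (g := fun τ => Tp (K τ) ρ w (u (t' - τ)) x - Tp (K τ) ρ w (u (t - τ)) x)
    measurableSet_Ioo fun τ hτ => Tp_sub H.wm H.w1 (H.KBC τ hτ.1) (hu.bc _) (hu.bc _) x,
    integral_sub h1 h2, setIntegral_sdiff measurableSet_Ioo h2 hss]
  ring

lemma Vol.D_WC (H : Vol c K ρ w k lam) (hu : WC c u) : WC c (Du K ρ w u) := by
  have key : ∀ T : ℝ, ∀ ε : ℝ≥0∞, 0 < ε → ∃ δ : ℝ, 0 < δ ∧ ∀ t t' : ℝ, t ≤ t' → t' ≤ T → t' - t < δ →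
      Nw c (fun x => Du K ρ w u t' x - Du K ρ w u t x) ≤ ε := by
    intro T ε hε
    obtain ⟨M, hM, hMb⟩ := hu.bdd (-1) T
    set P : ℝ≥0∞ := ENNReal.ofReal (2 * π) with hP
    have hPt : P ≠ ⊤ := ENNReal.ofReal_ne_top
    have hkT := H.kint T
    obtain ⟨η, hη, hη'⟩ := ENNReal.exists_nnreal_pos_mul_lt (a := P * ∫⁻ τ in Set.Ioo 0 T, k τ)
      (ENNReal.mul_ne_top hPt hkT.ne) (ENNReal.half_pos hε.ne').ne'
    obtain ⟨θ, hθ, hθ'⟩ := ENNReal.exists_nnreal_pos_mul_lt (a := P * M)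
      (ENNReal.mul_ne_top hPt hM.ne) (ENNReal.half_pos hε.ne').ne'
    obtain ⟨δ1, hδ1, h1⟩ := hu.unif (-1) T (ε := η) (by exact_mod_cast hη)
    obtain ⟨δ2, hδ2, h2⟩ := exists_pos_setLIntegral_lt_of_measure_lt (μ := volume.restrict (Set.Ioo 0 T))
      (f := k) hkT.ne (ε := θ) (by exact_mod_cast hθ.ne')
    obtain ⟨δ3, h3, h4⟩ := ENNReal.lt_iff_exists_nnreal_btwn.1 hδ2
    have hδ3 : (0 : ℝ) < δ3 := by exact_mod_cast h3
    refine ⟨min (min δ1 δ3) 1, by positivity, fun t t' htt htT hlt => ?_⟩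
    have hl1 : t' - t < δ1 := hlt.trans_le ((min_le_left _ _).trans (min_le_left _ _))
    have hl3 : t' - t < δ3 := hlt.trans_le ((min_le_left _ _).trans (min_le_right _ _))
    have hl : t' - t < 1 := hlt.trans_le (min_le_right _ _)
    have hmem : ∀ τ ∈ Set.Ioo 0 t', t' - τ ∈ Set.Icc (-1) T ∧ t - τ ∈ Set.Icc (-1) T := by
      intro τ hτ
      obtain ⟨ha, hb⟩ := hτ
      refine ⟨⟨?_, ?_⟩, ⟨?_, ?_⟩⟩ <;> linarith
    have hA := H.D1 (S := Set.Ioo 0 t') (T := T) measurableSet_Ioo (Set.Ioo_subset_Ioo_right htT)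
      (v := fun τ y => u (t' - τ) y - u (t - τ) y)
      ((hu.shift_meas H.c0 t').sub (hu.shift_meas H.c0 t)) (fun τ _ => (hu.bc _).sub (hu.bc _))
      (M := η) ENNReal.coe_lt_top (fun τ hτ => (h1 _ (hmem τ hτ).1 _ (hmem τ hτ).2 (by
        rw [abs_lt]; constructor <;> linarith)).le)
    have hB := H.D1 (S := Set.Ioo 0 t' \ Set.Ioo 0 t) (T := T) (measurableSet_Ioo.diff measurableSet_Ioo)
      (Set.sdiff_subset.trans (Set.Ioo_subset_Ioo_right htT)) (hu.shift_meas H.c0 t) (fun τ _ => hu.bc _)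
      hM (fun τ hτ => hMb _ (hmem τ hτ.1).2)
    have hsmall : ∫⁻ τ in Set.Ioo 0 t' \ Set.Ioo 0 t, k τ ≤ θ := by
      have := (h2 (Set.Ioo 0 t' \ Set.Ioo 0 t) ?_).le
      · rwa [Measure.restrict_restrict (measurableSet_Ioo.diff measurableSet_Ioo),
          Set.inter_eq_left.2 (Set.sdiff_subset.trans (Set.Ioo_subset_Ioo_right htT))] at this
      · refine (Measure.restrict_apply_le _ _).trans_lt (lt_of_le_of_lt ?_ h4)
        have hsub : Set.Ioo 0 t' \ Set.Ioo 0 t ⊆ Set.Icc t t' := by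
          intro τ hτ
          refine ⟨?_, hτ.1.2.le⟩
          by_contra hcon
          exact hτ.2 ⟨hτ.1.1, not_le.1 hcon⟩
        refine (measure_mono hsub).trans ?_
        rw [Real.volume_Icc]
        have := ENNReal.ofReal_le_ofReal hl3.le
        simpa using this
    have hk' : ∫⁻ τ in Set.Ioo 0 t', k τ ≤ ∫⁻ τ in Set.Ioo 0 T, k τ :=
      lintegral_mono_set (Set.Ioo_subset_Ioo_right htT)
    simp_rw [H.D_diff hu htt]
    rw [Nw_const_mul, enorm_two_pi_I]
    calc _ ≤ P * ((∫⁻ τ in Set.Ioo 0 T, k τ) * η + θ * M) := by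
          gcongr
          refine (Nw_add_le c hA.2.1 hB.2.1).trans (add_le_add (hA.2.2.trans ?_) (hB.2.2.trans ?_))
          · gcongr
          · gcongr
      _ = η * (P * ∫⁻ τ in Set.Ioo 0 T, k τ) + θ * (P * M) := by ring
      _ ≤ ε / 2 + ε / 2 := add_le_add hη'.le hθ'.le
      _ = ε := ENNReal.add_halves ε
  refine WC.mk' (H.D_BC hu) (H.D_fin hu) fun t ε hε => ?_
  obtain ⟨δ, hδ, h⟩ := key (t + 1) ε hε
  refine ⟨min δ 1, by positivity, fun s hs => ?_⟩
  have hs1 := abs_lt.1 (hs.trans_le (min_le_left _ _))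
  have hs2 := abs_lt.1 (hs.trans_le (min_le_right _ _))
  rcases le_total t s with hts | hts
  · exact h t s hts (by linarith) (by linarith)
  · rw [Nw_sub_comm]
    exact h s t hts (by linarith) (by linarith)

lemma Vol.D_bound (H : Vol c K ρ w k lam) (hu : WC c u) {T : ℝ} {A : ℝ≥0∞} (hA : A < ⊤)
    (hb : ∀ s ∈ Set.Icc 0 T, Nw c (u s) ≤ A * ENNReal.ofReal (Real.exp (lam * |s|))) {t : ℝ} (ht : t ≤ T) :
    Nw c (Du K ρ w u t) ≤ A * 2⁻¹ * ENNReal.ofReal (Real.exp (lam * |t|)) := by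
  rcases le_or_gt t 0 with h0 | h0
  · rw [Du_neg u h0, Nw_zero]; exact zero_le
  rw [abs_of_pos h0]
  set P : ℝ≥0∞ := ENNReal.ofReal (2 * π) with hP
  set X : ℝ≥0∞ := A * ENNReal.ofReal (Real.exp (lam * t)) with hX
  have hXt : X ≠ ⊤ := ENNReal.mul_ne_top hA.ne ENNReal.ofReal_ne_top
  set J := ∫⁻ τ in Set.Ioi 0, k τ * ENNReal.ofReal (Real.exp (-(lam * τ))) with hJ
  have hJt : J < ⊤ := by
    have h1 := H.klam
    by_contra hcon
    rw [not_lt_top_iff] at hcon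
    rw [← hJ, hcon, ENNReal.mul_top (by simp [Real.pi_pos])] at h1
    simp at h1
  have hI : ∫⁻ τ in Set.Ioo 0 t, k τ * (X * ENNReal.ofReal (Real.exp (-(lam * τ)))) ≤ X * J := by
    rw [hJ, ← lintegral_const_mul' _ _ hXt]
    refine (lintegral_mono_set (Set.Ioo_subset_Ioi_self)).trans (le_of_eq ?_)
    congr 1
    funext τ
    ring
  obtain ⟨-, -, h3⟩ := H.D0 (S := Set.Ioo 0 t) measurableSet_Ioo Set.Ioo_subset_Ioi_self
    (hu.shift_meas H.c0 t) (fun τ _ => hu.bc _) (B := fun τ => X * ENNReal.ofReal (Real.exp (-(lam * τ))))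
    (by fun_prop) (fun τ hτ => by
      refine (hb _ ⟨by linarith [hτ.2], by linarith [hτ.1]⟩).trans (le_of_eq ?_)
      rw [hX, mul_assoc, ← ENNReal.ofReal_mul (Real.exp_nonneg _), ← Real.exp_add,
        abs_of_pos (by linarith [hτ.2])]
      ring_nf) (fun τ _ => ENNReal.mul_lt_top hXt.lt_top ENNReal.ofReal_lt_top)
    (hI.trans_lt (ENNReal.mul_lt_top hXt.lt_top hJt))
  unfold Du
  rw [Nw_const_mul, enorm_two_pi_I]
  calc _ ≤ P * (X * J) := by gcongr; exact h3.trans hI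
    _ = X * (P * J) := by ring
    _ ≤ X * 2⁻¹ := by gcongr; exact H.klam
    _ = _ := by rw [hX]; ring

end Duhamel

/-! ### Solving the Volterra equation -/
section Solve
open Topology FourierTransform

variable {V : Type*} [NormedAddCommGroup V] [InnerProductSpace ℝ V] [FiniteDimensional ℝ V]
  [MeasurableSpace V] [BorelSpace V]

lemma Nw_tsum {c : SchwartzMap V ℂ} (hc : c 0 ≠ 0) {u : ℕ → V → ℂ} (hu : ∀ n, BC (u n))
    (hs : ∑' n, Nw c (u n) ≠ ⊤) :
    (∀ x, Summable (fun n => u n x)) ∧ BC (fun x => ∑' n, u n x) ∧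
    Nw c (fun x => ∑' n, u n x) ≤ ∑' n, Nw c (u n) := by
  have hc0 : ‖c 0‖ₑ ≠ 0 := by simpa using hc
  set b : ℕ → ℝ≥0∞ := fun n => Nw c (u n) * ‖c 0‖ₑ⁻¹ with hb
  have hbs : ∑' n, b n ≠ ⊤ := by
    rw [hb, ENNReal.tsum_mul_right]
    exact ENNReal.mul_ne_top hs (by simpa using hc0)
  have hbt : ∀ n, b n ≠ ⊤ := ENNReal.ne_top_of_tsum_ne_top hbs
  have hbr : Summable (fun n => (b n).toReal) := ENNReal.summable_toReal hbs
  have hpt : ∀ n x, ‖u n x‖ ≤ (b n).toReal := by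
    intro n x
    rw [← ENNReal.ofReal_le_iff_le_toReal (hbt n), ofReal_norm, hb]
    simp only
    rw [← div_eq_mul_inv, ENNReal.le_div_iff_mul_le (Or.inl hc0) (Or.inl enorm_ne_top)]
    exact enorm_le_Nw c (hu n) x
  have hsum : ∀ x, Summable (fun n => u n x) := fun x => Summable.of_norm_bounded hbr (fun n => hpt n x)
  refine ⟨hsum, ⟨continuous_tsum (fun n => (hu n).1) hbr hpt, _, fun x =>
    tsum_of_norm_bounded hbr.hasSum (fun n => hpt n x)⟩, iSup_le fun x0 => ?_⟩
  have hci := schwartz_sub_integrable c x0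
  have hbi : Integrable (fun n => (b n).toReal) Measure.count := by
    rw [integrable_count_iff]
    exact hbr.norm
  have hΦ : Integrable (Function.uncurry fun (n : ℕ) y => u n y * c (y - x0)) (Measure.count.prod volume) := by
    refine (hbi.mul_prod hci.norm).mono' ?_ (Filter.Eventually.of_forall fun z => ?_)
    · refine Measurable.aestronglyMeasurable ?_
      refine measurable_from_prod_countable_right fun n => ?_
      exact ((hu n).1.mul (c.continuous.comp (continuous_id.sub continuous_const))).measurable
    · simp only [Function.uncurry, norm_mul]
      gcongr
      exact hpt _ _
  have hEq : (fun y => (∑' n, u n y) * c (y - x0)) = fun y => ∫ n, u n y * c (y - x0) ∂Measure.count := by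
    funext y
    rw [← tsum_mul_right, integral_countable]
    · simp
    · rw [integrable_count_iff]
      exact ((hsum y).mul_right _).norm
  rw [hEq]
  refine (lf_integral_le hΦ).trans ?_
  rw [lintegral_count]
  exact ENNReal.tsum_le_tsum fun n => lf_le_Nw _ _ _

lemma Nw_eq_zero {c : SchwartzMap V ℂ} (hc : c 0 ≠ 0) {v : V → ℂ} (hv : BC v) (h : Nw c v = 0) (x : V) : v x = 0 := by
  have := enorm_le_Nw c hv x
  rw [h] at this
  simpa [hc] using this

lemma WC.lim {c : SchwartzMap V ℂ} {U : ℝ → V → ℂ} (hbc : ∀ t, BC (U t))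
    (h : ∀ T : ℝ, ∀ ε : ℝ≥0∞, 0 < ε → ∃ S : ℝ → V → ℂ, WC c S ∧
      ∀ t, |t| ≤ T → Nw c (fun x => U t x - S t x) ≤ ε) : WC c U := by
  refine WC.mk' hbc (fun t => ?_) fun t ε hε => ?_
  · obtain ⟨S, hS, h1⟩ := h |t| 1 one_pos
    have h2 := Nw_add_le c ((hbc t).sub (hS.bc t)) (hS.bc t)
    simp only [sub_add_cancel] at h2
    exact h2.trans_lt (ENNReal.add_lt_top.2 ⟨(h1 t le_rfl).trans_lt ENNReal.one_lt_top, hS.fin t⟩)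
  · have hε3 : 0 < ε / 3 := ENNReal.div_pos hε.ne' (by norm_num)
    obtain ⟨S, hS, h1⟩ := h (|t| + 1) (ε / 3) hε3
    obtain ⟨δ, hδ, h2⟩ := hS.at' t hε3
    refine ⟨min δ 1, by positivity, fun s hs => ?_⟩
    have hs1 : |s| ≤ |t| + 1 := by
      have := abs_sub_abs_le_abs_sub s t
      have := hs.trans_le (min_le_right δ 1)
      linarith
    have h3 := h2 s (hs.trans_le (min_le_left _ _))
    have h4 := h1 s hs1
    have h5 := h1 t (by linarith)
    have h6 := Nw_add_le c (((hbc s).sub (hS.bc s)).add ((hS.bc s).sub (hS.bc t))) ((hS.bc t).sub (hbc t))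
    have h7 := Nw_add_le c ((hbc s).sub (hS.bc s)) ((hS.bc s).sub (hS.bc t))
    rw [Nw_sub_comm] at h5
    simp only [sub_add_sub_cancel] at h6 h7
    refine h6.trans ((add_le_add (h7.trans (add_le_add h4 h3)) h5).trans (le_of_eq ?_))
    exact ENNReal.add_thirds ε

variable {c : SchwartzMap V ℂ} {K : ℝ → V → ℂ} {ρ : Measure V} [IsFiniteMeasure ρ] {w : V → ℂ}
  {k : ℝ → ℝ≥0∞} {lam : ℝ} {u v F : ℝ → V → ℂ}

lemma Vol.D_add (H : Vol c K ρ w k lam) (hu : WC c u) (hv : WC c v) (t : ℝ) (x : V) :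
    Du K ρ w (fun t x => u t x + v t x) t x = Du K ρ w u t x + Du K ρ w v t x := by
  have := H.D_sub (hu.add hv) hv t x
  simp only [add_sub_cancel_right] at this
  rw [this]
  ring

lemma pow_half_zero {N X : ℝ≥0∞} (hX : X ≠ ⊤) (h : ∀ n : ℕ, N ≤ X * 2⁻¹ ^ n) : N = 0 := by
  have h1 := ENNReal.Tendsto.const_mul (a := X)
    (ENNReal.tendsto_pow_atTop_nhds_zero_of_lt_one (r := 2⁻¹) (by simp)) (Or.inr hX)
  rw [mul_zero] at h1
  exact le_antisymm (ge_of_tendsto' h1 h) zero_le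

/-- Picard iterates. -/
def Pic (K : ℝ → V → ℂ) (ρ : Measure V) (w : V → ℂ) (F : ℝ → V → ℂ) : ℕ → ℝ → V → ℂ
  | 0 => F
  | n + 1 => Du K ρ w (Pic K ρ w F n)

lemma Vol.Pic_WC (H : Vol c K ρ w k lam) (hF : WC c F) (n : ℕ) : WC c (Pic K ρ w F n) := by
  induction n with
  | zero => exact hF
  | succ n ih => exact H.D_WC ih

lemma Vol.Pic_bound (H : Vol c K ρ w k lam) (hF : WC c F) {A : ℝ≥0∞} (hA : A < ⊤) (hFA : ∀ t, Nw c (F t) ≤ A)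
    (n : ℕ) (t : ℝ) : Nw c (Pic K ρ w F n t) ≤ A * 2⁻¹ ^ n * ENNReal.ofReal (Real.exp (lam * |t|)) := by
  induction n generalizing t with
  | zero =>
    rw [pow_zero, mul_one]
    refine (hFA t).trans (le_mul_of_one_le_right' ?_)
    rw [ENNReal.one_le_ofReal]
    exact Real.one_le_exp (mul_nonneg H.lam0 (abs_nonneg t))
  | succ n ih =>
    rw [pow_succ, ← mul_assoc]
    refine H.D_bound (T := t) (H.Pic_WC hF n) (ENNReal.mul_lt_top hA ?_) (fun s _ => ih s) le_rfl
    exact (ENNReal.pow_ne_top (by simp)).lt_top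

lemma Vol.exists_sol (H : Vol c K ρ w k lam) (hF : WC c F) {A : ℝ≥0∞} (hA : A < ⊤) (hFA : ∀ t, Nw c (F t) ≤ A) :
    ∃ U, WC c U ∧ ∀ t x, U t x = F t x + Du K ρ w U t x := by
  set P := Pic K ρ w F with hP
  set e : ℝ → ℝ≥0∞ := fun t => ENNReal.ofReal (Real.exp (lam * |t|)) with he
  have het : ∀ t, e t ≠ ⊤ := fun t => ENNReal.ofReal_ne_top
  have hPW := H.Pic_WC hF
  have htail : ∀ N t, ∑' n, Nw c (P (n + N) t) ≤ 2 * A * 2⁻¹ ^ N * e t := by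
    intro N t
    calc _ ≤ ∑' n : ℕ, (A * 2⁻¹ ^ N * e t) * 2⁻¹ ^ n := by
          refine ENNReal.tsum_le_tsum fun n => (H.Pic_bound hF hA hFA (n + N) t).trans (le_of_eq ?_)
          rw [pow_add]; ring
      _ = _ := by
          rw [ENNReal.tsum_mul_left, ENNReal.tsum_geometric, ENNReal.one_sub_inv_two, inv_inv]; ring
  have hpow : ∀ N : ℕ, ((2 : ℝ≥0∞)⁻¹ ^ N) ≠ ⊤ := fun N => ENNReal.pow_ne_top (by simp)
  have hfin : ∀ N t, ∑' n, Nw c (P (n + N) t) ≠ ⊤ := fun N t =>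
    ((htail N t).trans_lt (ENNReal.mul_lt_top (ENNReal.mul_lt_top (ENNReal.mul_lt_top (by simp) hA)
      (hpow N).lt_top) (het t).lt_top)).ne
  have hT := fun N t => Nw_tsum H.c0 (fun n => (hPW (n + N)).bc t) (hfin N t)
  set U : ℝ → V → ℂ := fun t x => ∑' n, P n t x with hU
  set S : ℕ → ℝ → V → ℂ := fun N t x => ∑ n ∈ Finset.range N, P n t x with hS
  have hSW : ∀ N, WC c (S N) := by
    intro N
    induction N with
    | zero =>
      simp only [hS, Finset.range_zero, Finset.sum_empty]
      exact WC.mk' (fun _ => BC.zero) (fun _ => by simp [Nw_zero]) fun t ε hε =>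
        ⟨1, one_pos, fun s _ => by simp [Nw_zero]⟩
    | succ N ih =>
      simp only [hS, Finset.sum_range_succ]
      exact ih.add (hPW N)
  have hUS : ∀ N t x, U t x - S N t x = ∑' n, P (n + N) t x := by
    intro N t x
    rw [hU, hS]
    simp only
    have h0 : Summable (fun n => P n t x) := (hT 0 t).1 x
    rw [← h0.sum_add_tsum_nat_add N]
    simp
  have hUSN : ∀ N t, Nw c (fun x => U t x - S N t x) ≤ 2 * A * 2⁻¹ ^ N * e t := by
    intro N t
    simp_rw [hUS]
    exact (hT N t).2.2.trans (htail N t)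
  have hUW : WC c U := by
    refine WC.lim (fun t => (hT 0 t).2.1) fun T ε hε => ?_
    have h1 := ENNReal.Tendsto.const_mul (a := 2 * A * e T)
      (ENNReal.tendsto_pow_atTop_nhds_zero_of_lt_one (r := 2⁻¹) (by simp))
      (Or.inr (ENNReal.mul_ne_top (ENNReal.mul_ne_top (by simp) hA.ne) (het T)))
    rw [mul_zero] at h1
    obtain ⟨N, hN⟩ := (h1.eventually (gt_mem_nhds hε)).exists
    refine ⟨S N, hSW N, fun t ht => (hUSN N t).trans (le_trans ?_ hN.le)⟩
    rw [mul_right_comm]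
    gcongr
    · exact ENNReal.ofReal_le_ofReal (Real.exp_le_exp.2
        (mul_le_mul_of_nonneg_left (ht.trans (le_abs_self T)) H.lam0))
  have hDS : ∀ N t x, S (N + 1) t x = F t x + Du K ρ w (S N) t x := by
    intro N
    induction N with
    | zero =>
      intro t x
      have : Du K ρ w (S 0) t x = 0 := by simp [hS, Du, Tp]
      rw [this]
      simp [hS, hP, Pic]
    | succ N ih =>
      intro t x
      have h1 : S (N + 1 + 1) t x = S (N + 1) t x + P (N + 1) t x := Finset.sum_range_succ _ _
      have h2 : S (N + 1) = fun t x => S N t x + P N t x := by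
        funext t x
        exact Finset.sum_range_succ _ _
      rw [h1, ih, h2, H.D_add (hSW N) (hPW N), add_assoc]
      rfl
  refine ⟨U, hUW, fun t x => ?_⟩
  have hDU := H.D_WC hUW
  have hzero : Nw c (fun x => U t x - (F t x + Du K ρ w U t x)) = 0 := by
    refine pow_half_zero (X := 2 * A * e t) (ENNReal.mul_ne_top (ENNReal.mul_ne_top (by simp) hA.ne) (het t)) fun N => ?_
    have h1 := Nw_add_le c ((hUW.bc t).sub ((hSW (N + 1)).bc t)) (((H.D_WC (hSW N)).bc t).sub (hDU.bc t))
    have h2 := H.D_bound (T := t) ((hSW N).sub hUW) (A := 2 * A * 2⁻¹ ^ N)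
      (ENNReal.mul_lt_top (ENNReal.mul_lt_top (by simp) hA) (hpow N).lt_top)
      (fun s _ => by rw [Nw_sub_comm]; exact hUSN N s) le_rfl
    have h3 := H.D_sub (hSW N) hUW t
    have h4 : Nw c (fun x => Du K ρ w (S N) t x - Du K ρ w U t x) ≤ 2 * A * 2⁻¹ ^ N * 2⁻¹ * e t := by
      simp_rw [← h3]; exact h2
    have h5 : (fun x => U t x - S (N + 1) t x + (Du K ρ w (S N) t x - Du K ρ w U t x)) =
        fun x => U t x - (F t x + Du K ρ w U t x) := by
      funext x
      rw [hDS]; ring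
    rw [h5] at h1
    refine h1.trans ((add_le_add (hUSN (N + 1) t) h4).trans (le_of_eq ?_))
    rw [pow_succ]
    calc _ = 2 * A * e t * 2⁻¹ ^ N * (2⁻¹ + 2⁻¹) := by ring
      _ = _ := by rw [ENNReal.inv_two_add_inv_two, mul_one]
  have h6 := Nw_eq_zero H.c0 ((hUW.bc t).sub ((hF.bc t).add (hDU.bc t))) hzero x
  exact sub_eq_zero.1 h6

lemma Vol.uniq (H : Vol c K ρ w k lam) {d : ℝ → V → ℂ} (hd : WC c d)
    (heq : ∀ t, 0 ≤ t → ∀ x, d t x = Du K ρ w d t x) {t : ℝ} (ht : 0 ≤ t) (x : V) : d t x = 0 := by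
  obtain ⟨M, hM, hb⟩ := hd.bdd 0 t
  have key : ∀ n : ℕ, ∀ s ∈ Set.Icc 0 t, Nw c (d s) ≤ M * 2⁻¹ ^ n * ENNReal.ofReal (Real.exp (lam * |s|)) := by
    intro n
    induction n with
    | zero =>
      intro s hs
      rw [pow_zero, mul_one]
      refine (hb s hs).trans (le_mul_of_one_le_right' ?_)
      rw [ENNReal.one_le_ofReal]
      exact Real.one_le_exp (mul_nonneg H.lam0 (abs_nonneg s))
    | succ n ih =>
      intro s hs
      rw [pow_succ, ← mul_assoc, show d s = Du K ρ w d s from funext (heq s hs.1)]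
      exact H.D_bound (T := t) hd (ENNReal.mul_lt_top hM (ENNReal.pow_ne_top (by simp)).lt_top) ih hs.2
  refine Nw_eq_zero H.c0 (hd.bc t) (pow_half_zero (X := M * ENNReal.ofReal (Real.exp (lam * |t|)))
    (ENNReal.mul_ne_top hM.ne ENNReal.ofReal_ne_top) fun n => ?_) x
  refine (key n t ⟨ht, le_rfl⟩).trans (le_of_eq (by ring))

end Solve

/-! ### Verification of the abstract hypotheses -/
section Verify
open Topology FourierTransform

variable {V : Type*} [NormedAddCommGroup V] [InnerProductSpace ℝ V] [FiniteDimensional ℝ V]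
  [MeasurableSpace V] [BorelSpace V]

lemma Disp.measurable {m : ℝ} {μ : V → ℝ} (H : Disp m μ) : Measurable μ :=
  measurable_of_continuousOn_compl_singleton 0 (by
    have := H.smooth.continuousOn
    exact this)

/-- The kernel extended by zero to nonpositive times. -/
def Kex (EE : ℝ → V → ℂ) (τ : ℝ) (x : V) : ℂ := if 0 < τ then EE τ x else 0

lemma Kex_measurable {m : ℝ} {μ : V → ℝ} (H : Disp m μ) {EE : ℝ → V → ℂ}
    (hE : ∀ t, 0 < t → IsKer μ t (EE t)) : Measurable (Function.uncurry (Kex EE)) := by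
  obtain ⟨χ, hχ1, hχ2, -, -, hχ3, -⟩ := exists_bump (V := V) (1 / 4) (by norm_num)
  set θ : SchwartzMap V ℂ := 𝓕 χ with hθ
  have hθ1 : ft volume χ = θ := by rw [ft_eq_fourier, hθ, SchwartzMap.fourier_coe]
  have hθ0 : θ 0 ≠ 0 := by
    rw [← hθ1, ft]; simpa [chr_zero] using hχ3
  obtain ⟨C, hC, h1⟩ := H.etil_lintegral (χ := χ) χ.smooth' hχ1
  have hrep : ∀ t, 0 < t → ∀ x, EE t x * θ 0 = ∫ ξ, chr ⟪x, ξ⟫ * Disp.etil χ μ t x ξ := by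
    intro t ht x
    have hk := fun ξ => ft_kernel (hE t ht) (χ := χ) χ.smooth' hχ2 x ξ
    have hi : Integrable (fun y => EE t y * ft volume χ (y - x)) := by
      rw [hθ1]; exact (hE t ht).1.mul_integrable (schwartz_sub_integrable θ x)
    have hcont : Continuous (fun y => EE t y * ft volume χ (y - x)) := by
      rw [hθ1]; exact (hE t ht).1.1.mul (θ.continuous.comp (continuous_id.sub continuous_const))
    have hl : lf (fun y => EE t y * ft volume χ (y - x)) < ⊤ := by
      refine lt_of_le_of_lt (le_of_eq ?_) ((h1 t ht x).trans_lt (ENNReal.mul_lt_top hC ENNReal.ofReal_lt_top))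
      rw [lf]; congr 1; ext ξ
      rw [hk]
    have h2 := congrFun (ift_ft hcont hi hl) x
    simp only [sub_self] at h2
    rw [hθ1] at h2
    rw [← h2, ift]
    congr 1
    ext ξ
    rw [← hk, hθ1]
  have hmeas : ∀ x : V, Measurable (fun t : ℝ => ∫ ξ, chr ⟪x, ξ⟫ * Disp.etil χ μ t x ξ) := by
    intro x
    have he : StronglyMeasurable (fun z : ℝ × V => Disp.etil χ μ z.1 x z.2) := by
      unfold Disp.etil
      refine StronglyMeasurable.integral_prod_right' (f := fun q : (ℝ × V) × V =>
        chr ⟪x, q.2⟫ * (chr (q.1.1 * μ (q.1.2 + q.2)) * χ q.2)) ?_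
      refine Measurable.stronglyMeasurable ?_
      have a1 : Measurable (fun q : (ℝ × V) × V => chr ⟪x, q.2⟫) :=
        measurable_chr.comp (by fun_prop)
      have a2 : Measurable (fun q : (ℝ × V) × V => μ (q.1.2 + q.2)) := H.measurable.comp (by fun_prop)
      have a3 : Measurable (fun q : (ℝ × V) × V => chr (q.1.1 * μ (q.1.2 + q.2))) :=
        measurable_chr.comp ((measurable_fst.comp measurable_fst).mul a2)
      have a4 : Measurable (fun q : (ℝ × V) × V => χ q.2) := χ.continuous.measurable.comp measurable_snd
      exact a1.mul (a3.mul a4)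
    have hc : Measurable (fun z : ℝ × V => chr ⟪x, z.2⟫) := measurable_chr.comp (by fun_prop)
    exact (StronglyMeasurable.integral_prod_right' (f := fun z : ℝ × V =>
      chr ⟪x, z.2⟫ * Disp.etil χ μ z.1 x z.2) (hc.stronglyMeasurable.mul he)).measurable
  have := measurable_uncurry_of_continuous_of_measurable (u := fun (x : V) (t : ℝ) => Kex EE t x)
    (fun t => by
      unfold Kex
      by_cases ht : 0 < t
      · simpa [ht] using (hE t ht).1.1
      · simpa [ht] using continuous_const)
    (fun x => by
      have : (fun t => Kex EE t x) = fun t : ℝ => if t ∈ Set.Ioi (0 : ℝ) then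
          (∫ ξ, chr ⟪x, ξ⟫ * Disp.etil χ μ t x ξ) * (θ 0)⁻¹ else 0 := by
        funext t
        unfold Kex
        simp only [Set.mem_Ioi]
        split_ifs with ht
        · rw [← hrep t ht x, mul_assoc, mul_inv_cancel₀ hθ0, mul_one]
        · rfl
      rw [this]
      exact Measurable.ite measurableSet_Ioi ((hmeas x).mul_const _) measurable_const)
  exact this.comp measurable_swap

lemma exists_lam {k : ℝ → ℝ≥0∞} (hk : Measurable k) (hkt : ∀ τ, k τ ≠ ⊤)
    (hJ : ∫⁻ τ in Set.Ioi 0, k τ * ENNReal.ofReal (Real.exp (-τ)) ≠ ⊤) :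
    (∀ T, ∫⁻ τ in Set.Ioo 0 T, k τ < ⊤) ∧ ∃ lam : ℝ, 0 ≤ lam ∧
    ENNReal.ofReal (2 * π) * ∫⁻ τ in Set.Ioi 0, k τ * ENNReal.ofReal (Real.exp (-(lam * τ))) ≤ 2⁻¹ := by
  constructor
  · intro T
    calc ∫⁻ τ in Set.Ioo 0 T, k τ ≤ ∫⁻ τ in Set.Ioo 0 T, k τ * ENNReal.ofReal (Real.exp (-τ)) * ENNReal.ofReal (Real.exp T) := by
          refine setLIntegral_mono' measurableSet_Ioo fun τ hτ => ?_
          rw [mul_assoc, ← ENNReal.ofReal_mul (Real.exp_nonneg _), ← Real.exp_add]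
          refine le_mul_of_one_le_right' ?_
          rw [ENNReal.one_le_ofReal]
          exact Real.one_le_exp (by linarith [hτ.2])
      _ ≤ ∫⁻ τ in Set.Ioi 0, k τ * ENNReal.ofReal (Real.exp (-τ)) * ENNReal.ofReal (Real.exp T) :=
          lintegral_mono_set Set.Ioo_subset_Ioi_self
      _ < ⊤ := by
          rw [lintegral_mul_const' _ _ ENNReal.ofReal_ne_top]
          exact ENNReal.mul_lt_top hJ.lt_top ENNReal.ofReal_lt_top
  · have hlim : Filter.Tendsto (fun n : ℕ => ∫⁻ τ in Set.Ioi 0, k τ * ENNReal.ofReal (Real.exp (-(((n : ℝ) + 1) * τ))))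
        Filter.atTop (𝓝 (∫⁻ τ in Set.Ioi (0 : ℝ), 0)) := by
      refine tendsto_lintegral_of_dominated_convergence (fun τ => k τ * ENNReal.ofReal (Real.exp (-τ)))
        (fun n => by fun_prop) (fun n => ?_) hJ ?_
      · filter_upwards [ae_restrict_mem measurableSet_Ioi] with τ hτ
        have hτ' : 0 < τ := hτ
        gcongr
        nlinarith [(Nat.cast_nonneg n : (0 : ℝ) ≤ n)]
      · filter_upwards [ae_restrict_mem measurableSet_Ioi] with τ hτ
        have hτ' : 0 < τ := hτ
        have h1 : Filter.Tendsto (fun n : ℕ => ((n : ℝ) + 1) * τ) Filter.atTop Filter.atTop :=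
          Filter.Tendsto.atTop_mul_const hτ' (Filter.tendsto_atTop_add_const_right _ _ tendsto_natCast_atTop_atTop)
        have h2 := (Real.tendsto_exp_neg_atTop_nhds_zero).comp h1
        have h3 := ENNReal.Tendsto.const_mul (a := k τ) (ENNReal.tendsto_ofReal h2) (Or.inr (hkt τ))
        simpa using h3
    rw [lintegral_zero] at hlim
    have h4 := ENNReal.Tendsto.const_mul (a := ENNReal.ofReal (2 * π)) hlim (Or.inr ENNReal.ofReal_ne_top)
    rw [mul_zero] at h4
    obtain ⟨n, hn⟩ := (h4.eventually (gt_mem_nhds (show (0 : ℝ≥0∞) < 2⁻¹ by simp))).exists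
    exact ⟨(n : ℝ) + 1, by positivity, hn.le⟩

lemma gamma_fin {a : ℝ} (ha : a < 1) (C : ℝ≥0∞) (hC : C < ⊤) :
    ∫⁻ τ in Set.Ioi (0 : ℝ), C * ENNReal.ofReal (τ ^ (-a) + 1) * ENNReal.ofReal (Real.exp (-τ)) ≠ ⊤ := by
  have h1 := Real.GammaIntegral_convergent (s := 1 - a) (by linarith)
  have h2 := Real.GammaIntegral_convergent (s := 1) (by norm_num)
  have h3 := (h1.add h2).lintegral_lt_top
  simp_rw [mul_assoc]
  rw [lintegral_const_mul' _ _ hC.ne]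
  refine (ENNReal.mul_lt_top hC (lt_of_le_of_lt (le_of_eq ?_) h3)).ne
  refine setLIntegral_congr_fun measurableSet_Ioi fun τ hτ => ?_
  have hτ' : 0 < τ := hτ
  have : 0 < τ ^ (-a) := by positivity
  rw [← ENNReal.ofReal_mul (by positivity)]
  congr 1
  rw [show 1 - a - 1 = -a by ring]
  simp
  ring

lemma Disp.vol {m : ℝ} {μ : V → ℝ} (H : Disp m μ) {ρ : Measure V} [IsFiniteMeasure ρ] {w : V → ℂ}
    (hwm : Measurable w) (hw1 : ∀ y, ‖w y‖ ≤ 1) {c : SchwartzMap V ℂ} (hc : c 0 ≠ 0)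
    {p p' : ℝ≥0∞} (hpp' : 1 / p + 1 / p' = 1) (hp' : 1 ≤ p')
    (hν : ∫⁻ z, eLpNorm (ft ρ (fun y => c (y - z) * w y)) p volume < ⊤)
    (ha : 2 * Module.finrank ℝ V / (m * p'.toReal) < 1)
    {EE : ℝ → V → ℂ} (hE : ∀ t, 0 < t → IsKer μ t (EE t)) :
    ∃ k lam, Vol c (Kex EE) ρ w k lam := by
  obtain ⟨C, hC, hop⟩ := H.op_bound hwm hw1 hc hpp' hp' hν
  set a : ℝ := 2 * Module.finrank ℝ V / (m * p'.toReal) with haa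
  set k : ℝ → ℝ≥0∞ := fun τ => C * ENNReal.ofReal (τ ^ (-a) + 1) with hk
  have hkm : Measurable k := by fun_prop
  obtain ⟨h1, lam, h2, h3⟩ := exists_lam hkm
    (fun τ => (ENNReal.mul_lt_top hC ENNReal.ofReal_lt_top).ne) (gamma_fin ha C hC)
  have hKe : ∀ τ, 0 < τ → Kex EE τ = EE τ := fun τ hτ => by funext x; simp [Kex, hτ]
  exact ⟨k, lam, hc, Kex_measurable H hE, fun τ hτ => by rw [hKe τ hτ]; exact (hE τ hτ).1, hwm, hw1, hkm, h1, h2, h3,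
    fun τ hτ v hv hvN => by rw [hKe τ hτ]; exact hop τ hτ _ (hE τ hτ) v hv hvN⟩

/-- The free evolution (frozen at negative times). -/
def Fr (μ : V → ℝ) (h : V → ℂ) (t : ℝ) : V → ℂ := ift (fun ξ => chr (max t 0 * μ ξ) * h ξ)

lemma Fr_bound (c : SchwartzMap V ℂ) {μ : V → ℝ} (hμ : Measurable μ) {h : V → ℂ} (hh : Integrable h) (t : ℝ) :
    Nw c (Fr μ h t) ≤ (∫⁻ ξ, ‖h ξ‖ₑ) * lf c := by
  refine (Nw_ift_le c (integrable_chr_mul hh (hμ.const_mul _).aemeasurable)).trans (le_of_eq ?_)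
  congr 2
  ext ξ
  rw [enorm_mul, enorm_chr, one_mul]

lemma Fr_WC (c : SchwartzMap V ℂ) {μ : V → ℝ} (hμ : Measurable μ) {h : V → ℂ} (hh : Integrable h) :
    WC c (Fr μ h) := by
  have hi : ∀ t : ℝ, Integrable (fun ξ => chr (max t 0 * μ ξ) * h ξ) := fun t =>
    integrable_chr_mul hh (hμ.const_mul _).aemeasurable
  have hA : (∫⁻ ξ, ‖h ξ‖ₑ) < ⊤ := hh.2
  refine WC.mk' (fun t => BC.ift (hi t)) (fun t => (Fr_bound c hμ hh t).trans_lt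
    (ENNReal.mul_lt_top hA (lf_schwartz c))) fun t ε hε => ?_
  have hsub : ∀ s, (fun x => Fr μ h s x - Fr μ h t x) =
      ift (fun ξ => chr (max s 0 * μ ξ) * h ξ - chr (max t 0 * μ ξ) * h ξ) := by
    intro s
    funext x
    unfold Fr ift
    rw [← integral_sub (integrable_chr_mul (hi s) (by fun_prop)) (integrable_chr_mul (hi t) (by fun_prop))]
    simp_rw [mul_sub]
  have hlim : Filter.Tendsto (fun s : ℝ => ∫⁻ ξ, ‖chr (max s 0 * μ ξ) * h ξ - chr (max t 0 * μ ξ) * h ξ‖ₑ) (𝓝 t)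
      (𝓝 (∫⁻ _ : V, 0)) := by
    refine tendsto_lintegral_filter_of_dominated_convergence' (fun ξ => 2 * ‖h ξ‖ₑ)
      (Filter.Eventually.of_forall fun s => ((hi s).sub (hi t)).1.enorm)
      (Filter.Eventually.of_forall fun s => Filter.Eventually.of_forall fun ξ => ?_) ?_
      (Filter.Eventually.of_forall fun ξ => ?_)
    · refine (enorm_sub_le).trans (le_of_eq ?_)
      simp only [enorm_mul, enorm_chr, one_mul]
      ring
    · rw [lintegral_const_mul' _ _ (by simp)]
      exact (ENNReal.mul_lt_top (by simp) hA).ne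
    · have hcont : Continuous (fun s : ℝ => ‖chr (max s 0 * μ ξ) * h ξ - chr (max t 0 * μ ξ) * h ξ‖ₑ) := by
        have h1 : Continuous (fun s : ℝ => chr (max s 0 * μ ξ)) :=
          continuous_chr.comp ((continuous_id.max continuous_const).mul continuous_const)
        exact ((h1.mul continuous_const).sub continuous_const).enorm
      have := hcont.tendsto t
      simpa using this
  rw [lintegral_zero] at hlim
  have h4 := ENNReal.Tendsto.mul_const (b := lf c) hlim (Or.inr (lf_schwartz c).ne)
  rw [zero_mul] at h4
  obtain ⟨δ, hδ, h5⟩ := Metric.eventually_nhds_iff.1 (h4.eventually (gt_mem_nhds hε))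
  refine ⟨δ, hδ, fun s hs => ?_⟩
  rw [hsub]
  exact (Nw_ift_le c ((hi s).sub (hi t))).trans (h5 (by rwa [Real.dist_eq])).le

end Verify

/-! ### Bridge to the frozen definitions -/
section Bridge
open Topology FourierTransform

lemma setIntegral_reflect (G : ℝ → ℂ) (t : ℝ) :
    (IntegrableOn (fun τ => G (t - τ)) (Set.Ioo 0 t) ↔ IntegrableOn G (Set.Ioo 0 t)) ∧
    ∫ τ in Set.Ioo 0 t, G (t - τ) = ∫ s in Set.Ioo 0 t, G s := by
  have hmp := Measure.measurePreserving_sub_left (volume : Measure ℝ) t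
  have hemb := measurableEmbedding_subLeft t
  have hpre : (fun x => t - x) ⁻¹' Set.Ioo 0 t = Set.Ioo 0 t := by
    rw [Set.preimage_const_sub_Ioo, sub_self, sub_zero]
  constructor
  · have := hmp.integrableOn_comp_preimage hemb (f := G) (s := Set.Ioo 0 t)
    rw [hpre] at this
    exact this
  · have := hmp.setIntegral_preimage_emb hemb G (Set.Ioo 0 t)
    rw [hpre] at this
    exact this

section
variable {V : Type*} [NormedAddCommGroup V] [InnerProductSpace ℝ V] [FiniteDimensional ℝ V]
  [MeasurableSpace V] [BorelSpace V]

lemma Tp_reflect {EE : ℝ → V → ℂ} {ρ : Measure V} {w : V → ℂ} {u v : ℝ → V → ℂ} {t : ℝ}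
    (huv : ∀ s ∈ Set.Ioo 0 t, v s = u s) (x : V) :
    Set.EqOn (fun τ => Tp (Kex EE τ) ρ w (v (t - τ)) x)
      (fun τ => (fun s => ∫ y, EE (t - s) (x - y) * u s y * w y ∂ρ) (t - τ)) (Set.Ioo 0 t) := by
  intro τ hτ
  have h1 : v (t - τ) = u (t - τ) := huv _ ⟨by linarith [hτ.2], by linarith [hτ.1]⟩
  simp only [Tp, h1, sub_sub_cancel]
  congr 1
  funext y
  rw [Kex, if_pos hτ.1]

lemma Du_reflect {EE : ℝ → V → ℂ} {ρ : Measure V} {w : V → ℂ} {u v : ℝ → V → ℂ} {t : ℝ}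
    (huv : ∀ s ∈ Set.Ioo 0 t, v s = u s) (x : V) :
    Du (Kex EE) ρ w v t x = (2 * (Real.pi : ℂ)) * Complex.I *
        ∫ s in Set.Ioo (0 : ℝ) t, ∫ y, EE (t - s) (x - y) * u s y * w y ∂ρ := by
  unfold Du
  rw [setIntegral_congr_fun measurableSet_Ioo (Tp_reflect huv x)]
  congr 1
  exact (setIntegral_reflect (fun s => ∫ y, EE (t - s) (x - y) * u s y * w y ∂ρ) t).2

/-- The complex conjugate of a Schwartz function. -/
def cw (g : SchwartzMap V ℂ) : SchwartzMap V ℂ :=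
  SchwartzMap.postcompCLM (𝕜 := ℝ) (Complex.conjCLE : ℂ →L[ℝ] ℂ) g

lemma cw_apply (g : SchwartzMap V ℂ) (x : V) : cw g x = (starRingEnd ℂ) (g x) := by
  simp [cw]

lemma Fr_zero (μ : V → ℝ) (h : V → ℂ) (x : V) : Fr μ h 0 x =
    ∫ ξ, Complex.exp (((2 * Real.pi * ⟪x, ξ⟫ : ℝ) : ℂ) * Complex.I) * h ξ := by
  simp [Fr, ift, chr_zero]
  simp [chr]

lemma Fr_pos (μ : V → ℝ) (h : V → ℂ) {t : ℝ} (ht : 0 < t) (x : V) : Fr μ h t x =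
    ∫ ξ, Complex.exp (((2 * Real.pi * (⟪x, ξ⟫ + t * μ ξ) : ℝ) : ℂ) * Complex.I) * h ξ := by
  unfold Fr ift
  rw [max_eq_left ht.le]
  congr 1
  funext ξ
  rw [← mul_assoc, ← chr_add]
  rfl
end

lemma chr_neg_inner {d : ℕ} (ξ y : EuclideanSpace ℝ (Fin d)) :
    Complex.exp (-(((2 * Real.pi * ⟪ξ, y⟫ : ℝ) : ℂ) * Complex.I)) = chr (-⟪y, ξ⟫) := by
  unfold chr
  rw [real_inner_comm y ξ]
  congr 1
  push_cast
  ring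

lemma gaborT_eq (d : ℕ) (g : SchwartzMap (EuclideanSpace ℝ (Fin d)) ℂ)
    (v : EuclideanSpace ℝ (Fin d) → ℂ) (x ξ : EuclideanSpace ℝ (Fin d)) :
    gaborT d g v x ξ = ft volume (fun y => v y * cw g (y - x)) ξ := by
  unfold gaborT ft
  congr 1
  funext y
  rw [chr_neg_inner, mul_assoc]
  simp only [cw_apply]

lemma wOneInfNorm_eq (d : ℕ) (g : SchwartzMap (EuclideanSpace ℝ (Fin d)) ℂ)
    (v : EuclideanSpace ℝ (Fin d) → ℂ) : wOneInfNorm d g v = Nw (cw g) v := by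
  unfold wOneInfNorm Nw lf
  simp_rw [gaborT_eq]
  rfl

lemma gaborMeas_eq (d : ℕ) (g : SchwartzMap (EuclideanSpace ℝ (Fin d)) ℂ)
    (ρ : Measure (EuclideanSpace ℝ (Fin d))) (w : EuclideanSpace ℝ (Fin d) → ℂ)
    (x : EuclideanSpace ℝ (Fin d)) :
    (fun ξ => gaborMeas d g ρ w x ξ) = ft ρ (fun y => cw g (y - x) * w y) := by
  funext ξ
  unfold gaborMeas ft
  congr 1
  funext y
  rw [chr_neg_inner, mul_assoc]
  simp only [cw_apply]

section
variable {d : ℕ} {μ : EuclideanSpace ℝ (Fin d) → ℝ} {g : SchwartzMap (EuclideanSpace ℝ (Fin d)) ℂ}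
  {EE : ℝ → EuclideanSpace ℝ (Fin d) → ℂ} {ρ : Measure (EuclideanSpace ℝ (Fin d))} [IsFiniteMeasure ρ]
  {w : EuclideanSpace ℝ (Fin d) → ℂ} {h : EuclideanSpace ℝ (Fin d) → ℂ}
  {k : ℝ → ℝ≥0∞} {lam : ℝ}

lemma isGlobalSolution_of (H : Vol (cw g) (Kex EE) ρ w k lam) {U : ℝ → EuclideanSpace ℝ (Fin d) → ℂ}
    (hU : WC (cw g) U) (heq : ∀ t x, U t x = Fr μ h t x + Du (Kex EE) ρ w U t x) :
    IsGlobalSolution d μ g EE ρ w h U := by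
  refine ⟨fun t _ => ⟨(hU.bc t).1, (hU.bc t).2, by rw [wOneInfNorm_eq]; exact hU.fin t⟩, ?_, ?_, ?_⟩
  · intro t _ ε hε
    obtain ⟨δ, hδ, h1⟩ := hU.at' t (ε := ENNReal.ofReal (ε / 2)) (by simpa using hε)
    refine ⟨δ, hδ, fun s _ hs => ?_⟩
    rw [wOneInfNorm_eq]
    refine (h1 s hs).trans_lt ?_
    rw [ENNReal.ofReal_lt_ofReal_iff hε]
    linarith
  · intro x
    rw [heq, Du_neg U le_rfl, add_zero, Fr_zero]
  · intro t ht x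
    refine ⟨fun s hs => ?_, ?_, ?_⟩
    · have h0 : 0 < t - s := by linarith [hs.2]
      have h1 := H.KBC _ h0
      have h2 : Kex EE (t - s) = EE (t - s) := by funext y; simp [Kex, h0]
      rw [h2] at h1
      exact Tp_integrable H.wm H.w1 h1 (hU.bc s) x
    · rw [← (setIntegral_reflect _ t).1]
      have h1 := (H.D_base hU t t measurableSet_Ioo subset_rfl).1 x
      exact h1.congr_fun (Tp_reflect (fun s _ => rfl) x) measurableSet_Ioo
    · rw [heq, Fr_pos μ h ht, Du_reflect (u := U) (fun s _ => rfl)]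

lemma clamp_WC {u : ℝ → EuclideanSpace ℝ (Fin d) → ℂ} (hu : IsGlobalSolution d μ g EE ρ w h u) :
    WC (cw g) (fun t => u (max t 0)) := by
  obtain ⟨h1, h2, -, -⟩ := hu
  have hm : ∀ t : ℝ, max t 0 ∈ Set.Ici (0 : ℝ) := fun t => Set.mem_Ici.2 (le_max_right _ _)
  refine WC.mk' (fun t => ⟨(h1 _ (hm t)).1, (h1 _ (hm t)).2.1⟩)
    (fun t => by rw [← wOneInfNorm_eq]; exact (h1 _ (hm t)).2.2) fun t ε hε => ?_
  obtain ⟨ε', he1, he2⟩ := ENNReal.lt_iff_exists_nnreal_btwn.1 hε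
  obtain ⟨δ, hδ, h3⟩ := h2 _ (hm t) ε' (by exact_mod_cast he1)
  refine ⟨δ, hδ, fun s hs => ?_⟩
  have h4 := h3 _ (hm s) ((abs_max_sub_max_le_abs s t 0).trans_lt hs)
  rw [wOneInfNorm_eq, ENNReal.ofReal_coe_nnreal] at h4
  exact (h4.trans he2).le

lemma clamp_eq {u : ℝ → EuclideanSpace ℝ (Fin d) → ℂ} (hu : IsGlobalSolution d μ g EE ρ w h u) {t : ℝ}
    (ht : 0 ≤ t) (x : EuclideanSpace ℝ (Fin d)) :
    u t x = Fr μ h t x + Du (Kex EE) ρ w (fun t => u (max t 0)) t x := by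
  obtain ⟨-, -, h3, h4⟩ := hu
  rcases ht.eq_or_lt with rfl | ht
  · rw [h3, Du_neg _ le_rfl, add_zero, Fr_zero]
  · rw [(h4 t ht x).2.2, Fr_pos μ h ht, Du_reflect (u := u) (fun s hs => by simp [hs.1.le])]
end
end Bridge

/-- (Theorem 1.5, `q = 1`, measure-potential instance.) Under hypotheses (H),
for `1 ≤ p ≤ ∞` with conjugate `p'` and `m > 2d/p'`, if the finite complex measure `ν = w dρ`
belongs to `W^{p,1}(ℝ^d)` — i.e. `∫ (∫ |V_g ν(x,ξ)|^p dξ)^{1/p} dx < ∞`, with the essential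
supremum in `ξ` when `p = ∞` — then every datum `f = (h)^∨` with `h ∈ L¹` admits a unique
global solution `u ∈ C⁰([0,∞); W^{1,∞})` of the Duhamel equation. -/
theorem global_linear_wellposedness_low_dispersion (d : ℕ) (hd : 1 ≤ d)
    (m : ℝ) (hm : 2 ≤ m)
    (p p' : ℝ≥0∞) (hp : 1 ≤ p) (hpp' : 1 / p + 1 / p' = 1)
    (hmd : 2 * (d : ℝ) / p'.toReal < m)
    (μ : EuclideanSpace ℝ (Fin d) → ℝ)
    (hsmooth : ContDiffOn ℝ (⊤ : ℕ∞) μ {x | x ≠ 0})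
    (hhom : ∀ c : ℝ, 0 < c → ∀ x : EuclideanSpace ℝ (Fin d), x ≠ 0 →
      μ (c • x) = c ^ m * μ x)
    (hhess : ∀ x : EuclideanSpace ℝ (Fin d), ‖x‖ = 1 →
      Function.Bijective ⇑(fderiv ℝ (fderiv ℝ μ) x))
    (g : SchwartzMap (EuclideanSpace ℝ (Fin d)) ℂ) (hg : g 0 ≠ 0)
    (EE : ℝ → EuclideanSpace ℝ (Fin d) → ℂ)
    (hEE : ∀ t : ℝ, 0 < t → Continuous (EE t) ∧ (∃ M : ℝ, ∀ x, ‖EE t x‖ ≤ M) ∧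
      ∀ φ : SchwartzMap (EuclideanSpace ℝ (Fin d)) ℂ,
        ∫ x, EE t x * φ x =
          ∫ (ξ : EuclideanSpace ℝ (Fin d)),
            Complex.exp (((2 * Real.pi * (t * μ ξ) : ℝ) : ℂ) * Complex.I) *
              ∫ x, Complex.exp (((2 * Real.pi * ⟪ξ, x⟫ : ℝ) : ℂ) * Complex.I) * φ x)
    (ρ : Measure (EuclideanSpace ℝ (Fin d))) [IsFiniteMeasure ρ]
    (w : EuclideanSpace ℝ (Fin d) → ℂ) (hwm : Measurable w) (hw1 : ∀ y, ‖w y‖ ≤ 1)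
    (hν : (∫⁻ x : EuclideanSpace ℝ (Fin d),
      eLpNorm (fun ξ => gaborMeas d g ρ w x ξ) p volume ∂volume) < ⊤)
    (h : EuclideanSpace ℝ (Fin d) → ℂ) (hh : Integrable h) :
    ∃ u : ℝ → EuclideanSpace ℝ (Fin d) → ℂ,
      IsGlobalSolution d μ g EE ρ w h u ∧
      ∀ u' : ℝ → EuclideanSpace ℝ (Fin d) → ℂ,
        IsGlobalSolution d μ g EE ρ w h u' →
        ∀ t ∈ Set.Ici (0 : ℝ), ∀ x, u' t x = u t x := by
  have hm0 : 0 < m := by linarith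
  have HD : Disp m μ := ⟨hm, hsmooth, fun c hc x hx => by rw [hhom c hc x hx, smul_eq_mul], hhess⟩
  have hker : ∀ t, 0 < t → IsKer μ t (EE t) := fun t ht =>
    ⟨⟨(hEE t ht).1, (hEE t ht).2.1⟩, (hEE t ht).2.2⟩
  have hc : cw g 0 ≠ 0 := by rw [cw_apply]; simpa using hg
  have hp' : 1 ≤ p' := by
    have h1 : 1 / p' ≤ 1 := by
      calc 1 / p' ≤ 1 / p + 1 / p' := le_add_self
        _ = 1 := hpp'
    rw [one_div] at h1
    exact ENNReal.inv_le_one.1 h1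
  have hν' : ∫⁻ z, eLpNorm (ft ρ (fun y => cw g (y - z) * w y)) p volume < ⊤ := by
    simpa only [gaborMeas_eq] using hν
  have ha : 2 * (Module.finrank ℝ (EuclideanSpace ℝ (Fin d)) : ℝ) / (m * p'.toReal) < 1 := by
    rw [finrank_euclideanSpace, Fintype.card_fin, mul_comm m, ← div_div, div_lt_one hm0]
    exact hmd
  obtain ⟨k, lam, HV⟩ := HD.vol hwm hw1 hc hpp' hp' hν' ha hker
  have hF := Fr_WC (cw g) HD.measurable hh
  obtain ⟨U, hU, hUeq⟩ := HV.exists_sol hF (A := (∫⁻ ξ, ‖h ξ‖ₑ) * lf (cw g))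
    (ENNReal.mul_lt_top hh.2 (lf_schwartz _)) (Fr_bound (cw g) HD.measurable hh)
  refine ⟨U, isGlobalSolution_of HV hU hUeq, fun u' hu' t ht x => ?_⟩
  have hW := clamp_WC hu'
  have h0 := HV.uniq (hW.sub hU) (fun s hs y => by
    rw [HV.D_sub hW hU, max_eq_left hs, clamp_eq hu' hs y, hUeq s y]
    ring) (t := t) ht x
  rw [max_eq_left ht] at h0
  exact sub_eq_zero.1 h0
end
end

section
/- Let m be a real number with 0 < m < 2. Then there is no constant C > 0 such that m·|x^{m−1} − 1| ≥ C |x−1| (x^{m−2} + 1) for all x > 0. (This shows that the conic gradient estimate |∇μ(x) − ∇μ(y)| ≥ C|x−y|(|x|^{m−2}+|y|^{m−2}) fails for μ(x) = |x|^m in dimension d = 1 when m < 2, so the assumption m ≥ 2 in the conic gradient lower bound cannot be relaxed.) -/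
open Real

noncomputable section

/-- For `0 < m < 2` there is no constant `C > 0` such that
`m|x^{m−1} − 1| ≥ C|x−1|(x^{m−2} + 1)` for all `x > 0`: the conic gradient estimate for
`μ(x) = |x|^m` in dimension one fails when `m < 2`. -/
theorem no_conic_gradient_bound_of_lt_two (m : ℝ) (hm0 : 0 < m) (hm2 : m < 2) :
    ¬ ∃ C : ℝ, 0 < C ∧ ∀ x : ℝ, 0 < x →
      C * |x - 1| * (x ^ (m - 2) + 1) ≤ m * |x ^ (m - 1) - 1| := by
  rintro ⟨C, hC, h⟩
  have h1 : Filter.Tendsto (fun x : ℝ => x⁻¹) Filter.atTop (nhds 0) := tendsto_inv_atTop_zero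
  have h2 : Filter.Tendsto (fun x : ℝ => x ^ (m - 2)) Filter.atTop (nhds 0) := by
    have := tendsto_rpow_neg_atTop (y := 2 - m) (by linarith)
    simpa using this
  have hL : Filter.Tendsto (fun x : ℝ => C * (1 - x⁻¹)) Filter.atTop (nhds (C * (1 - 0))) :=
    (tendsto_const_nhds.sub h1).const_mul C
  have hR : Filter.Tendsto (fun x : ℝ => m * (x ^ (m - 2) + x⁻¹)) Filter.atTop
      (nhds (m * (0 + 0))) := (h2.add h1).const_mul m
  have hle : C * (1 - 0) ≤ m * (0 + 0) := by
    refine le_of_tendsto_of_tendsto hL hR ?_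
    filter_upwards [Filter.eventually_ge_atTop (1 : ℝ)] with x hx
    have hx0 : 0 < x := by linarith
    have hp : 0 < x ^ (m - 2) := rpow_pos_of_pos hx0 _
    have e : x ^ (m - 1) = x ^ (m - 2) * x := by
      rw [← rpow_add_one hx0.ne']
      congr 1
      ring
    have hb := h x hx0
    rw [e, abs_of_nonneg (by linarith : 0 ≤ x - 1)] at hb
    have ha : |x ^ (m - 2) * x - 1| ≤ x ^ (m - 2) * x + 1 := by
      have := mul_pos hp hx0
      rw [abs_le]
      constructor <;> linarith
    have hb2 : m * |x ^ (m - 2) * x - 1| ≤ m * (x ^ (m - 2) * x + 1) :=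
      mul_le_mul_of_nonneg_left ha hm0.le
    have hc : 0 ≤ C * (x - 1) * x ^ (m - 2) :=
      mul_nonneg (mul_nonneg hC.le (by linarith)) hp.le
    have hd : C * (x - 1) ≤ m * (x ^ (m - 2) * x + 1) := by linarith
    have hi : x * x⁻¹ = 1 := mul_inv_cancel₀ hx0.ne'
    have e1 : C * (1 - x⁻¹) = C * (x - 1) * x⁻¹ := by linear_combination (-C) * hi
    have e2 : m * (x ^ (m - 2) + x⁻¹) = m * (x ^ (m - 2) * x + 1) * x⁻¹ := by
      linear_combination (-m * x ^ (m - 2)) * hi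
    rw [e1, e2]
    exact mul_le_mul_of_nonneg_right hd (inv_pos.mpr hx0).le
  linarith
end
end
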